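/- For every nondegenerate triangle T in ℝ², λ₁^{MS}(T) ≥ π²/|T|, and equality is attained if and only if T is an isosceles right triangle. -/

import Mathlib

open MeasureTheory Set EuclideanGeometry

noncomputable section

abbrev E2 : Type := EuclideanSpace ℝ (Fin 2)

/-- The Rayleigh quotient of a function `u` on the domain `Ω ⊆ ℝ²`. -/
def rayleigh (Ω : Set E2) (u : E2 → ℝ) : ℝ :=
  (∫ x in Ω, ‖fderiv ℝ u x‖ ^ 2) / (∫ x in Ω, (u x) ^ 2)

/-- `u` is not almost everywhere zero on `Ω`. -/
def NotAEZero (Ω : Set E2) (u : E2 → ℝ) : Prop :=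
  ¬ (∀ᵐ x ∂(volume.restrict Ω), u x = 0)

/-- The first mixed Dirichlet–Neumann eigenvalue of the Laplacian on `Ω`,
with Dirichlet condition on `D` and Neumann condition on the rest of the boundary,
defined variationally. -/
def firstMixedEig (Ω D : Set E2) : ℝ :=
  sInf { r | ∃ u : E2 → ℝ, ContDiff ℝ (⊤ : ℕ∞) u ∧ (∀ x ∈ D, u x = 0) ∧
    NotAEZero Ω u ∧ r = rayleigh Ω u }

/-- The `k`-th mixed Dirichlet–Neumann eigenvalue of the Laplacian on `Ω`,
with Dirichlet condition on `D`, via the Courant–Fischer min–max principle. -/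
def mixedEig (Ω D : Set E2) (k : ℕ) : ℝ :=
  sInf { r | ∃ V : Submodule ℝ (E2 → ℝ), Module.finrank ℝ V = k ∧
    (∀ u ∈ V, ContDiff ℝ (⊤ : ℕ∞) u ∧ ∀ x ∈ D, u x = 0) ∧
    r = sSup { q | ∃ u ∈ V, NotAEZero Ω u ∧ q = rayleigh Ω u } }

/-- The open triangle with vertices `A`, `B`, `C`. -/
def triangleO (A B C : E2) : Set E2 := interior (convexHull ℝ ({A, B, C} : Set E2))

/-- The area of a plane region. -/
def area2 (s : Set E2) : ℝ := (volume s).toReal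

/-- The open rectangle `(0,a) × (0,b)`. -/
def rectO (a b : ℝ) : Set E2 := {p : E2 | p 0 ∈ Ioo 0 a ∧ p 1 ∈ Ioo 0 b}

/-- The closed rectangle `[0,a] × [0,b]`. -/
def rectC (a b : ℝ) : Set E2 := {p : E2 | p 0 ∈ Icc 0 a ∧ p 1 ∈ Icc 0 b}

/-- The two vertical sides of the closed rectangle `[0,a] × [0,b]`. -/
def vSides (a b : ℝ) : Set E2 := {p : E2 | (p 0 = 0 ∨ p 0 = a) ∧ p 1 ∈ Icc 0 b}

/-- The two horizontal sides of the closed rectangle `[0,a] × [0,b]`. -/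
def hSides (a b : ℝ) : Set E2 := {p : E2 | p 0 ∈ Icc 0 a ∧ (p 1 = 0 ∨ p 1 = b)}

/-- `F(y) = Σ_{j=0}^∞ ((y − j²)₊)^{1/2}`. -/
def Ffun (y : ℝ) : ℝ := ∑' j : ℕ, Real.sqrt (max (y - (j : ℝ) ^ 2) 0)

/-- `M`, the inverse function of `F` on `[0,∞)`. -/
def Mfun (x : ℝ) : ℝ := sInf {y : ℝ | 0 ≤ y ∧ x ≤ Ffun y}

set_option linter.unusedSectionVars false

section Calibration

open Filter Topology
open scoped NNReal Manifold

variable {E : Type*} [NormedAddCommGroup E] [NormedSpace ℝ E] [FiniteDimensional ℝ E]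

theorem exists_contDiff_cutoff {K U : Set E} (hK : IsCompact K) (hU : IsOpen U) (hKU : K ⊆ U) :
    ∃ χ : E → ℝ, ContDiff ℝ 1 χ ∧ HasCompactSupport χ ∧ tsupport χ ⊆ U ∧
      ∀ x ∈ K, χ =ᶠ[𝓝 x] fun _ => 1 := by
  obtain ⟨L, hL, hKL, hLU⟩ := exists_compact_between hK hU hKU
  obtain ⟨χ, h0, h1, -⟩ := exists_contMDiffMap_zero_one_nhds_of_isClosed (n := 1) 𝓘(ℝ, E)
    (s := (interior L)ᶜ) (t := K) isOpen_interior.isClosed_compl hK.isClosed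
    (disjoint_compl_left_iff_subset.2 hKL)
  have hsub : tsupport χ ⊆ L := by
    refine closure_minimal (fun x hx => ?_) hL.isClosed
    by_contra hxL
    have hx' : x ∈ (interior L)ᶜ := fun h => hxL (interior_subset h)
    exact hx (h0.filter_mono (nhds_le_nhdsSet hx')).self_of_nhds
  exact ⟨χ, χ.contMDiff.contDiff, hL.of_isClosed_subset (isClosed_tsupport _) hsub,
    hsub.trans hLU, fun x hx => h1.filter_mono (nhds_le_nhdsSet hx)⟩

theorem exists_contDiff_eventuallyEq {K U : Set E} {f : E → ℝ} (hK : IsCompact K) (hU : IsOpen U)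
    (hKU : K ⊆ U) (hf : ContDiffOn ℝ 1 f U) :
    ∃ g : E → ℝ, ContDiff ℝ 1 g ∧ HasCompactSupport g ∧ ∀ x ∈ K, g =ᶠ[𝓝 x] f := by
  obtain ⟨χ, hχ, hc, hs, h1⟩ := exists_contDiff_cutoff hK hU hKU
  refine ⟨fun x => χ x * f x, ?_, hc.mul_right, fun x hx => ?_⟩
  · rw [contDiff_iff_contDiffAt]
    intro x
    by_cases hx : x ∈ tsupport χ
    · exact hχ.contDiffAt.mul (hf.contDiffAt (hU.mem_nhds (hs hx)))
    · have : (fun x => χ x * f x) =ᶠ[𝓝 x] fun _ => 0 := by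
        filter_upwards [notMem_tsupport_iff_eventuallyEq.1 hx] with y hy
        simp [hy]
      exact contDiffAt_const.congr_of_eventuallyEq this
  · filter_upwards [h1 x hx] with y hy
    simp [hy]

variable {w : E → ℝ} {C : ℝ≥0}

theorem lineDeriv_eq_zero_of_notMem_tsupport {x v : E} (hx : x ∉ tsupport w) :
    lineDeriv ℝ w x v = 0 := by
  have := (notMem_tsupport_iff_eventuallyEq.1 hx).lineDeriv_eq (𝕜 := ℝ) (v := v)
  rw [this]
  simp [lineDeriv]

theorem lineDeriv_eq_zero_of_nonneg (h : ∀ x, 0 ≤ w x) {x : E} (hx : w x = 0) (v : E) :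
    lineDeriv ℝ w x v = 0 := by
  refine IsLocalMin.deriv_eq_zero (Eventually.of_forall fun t => ?_)
  simpa [hx] using h _

variable [MeasurableSpace E] [BorelSpace E] {μ : Measure E} [μ.IsAddHaarMeasure]

theorem integrable_lineDeriv_mul (hw : LipschitzWith C w) (hc : HasCompactSupport w) (v : E)
    {f : E → ℝ} (hf : Continuous f) : Integrable (fun x => lineDeriv ℝ w x v * f x) μ := by
  have hl := (hw.locallyIntegrable_lineDeriv (μ := μ) v)
  obtain ⟨χ, hχ, hχc, -, hχ1⟩ := exists_contDiff_cutoff hc isOpen_univ (subset_univ _)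
  have := hl.integrable_smul_left_of_hasCompactSupport (hf.mul hχ.continuous) hχc.mul_left
  refine this.congr (Eventually.of_forall fun x => ?_)
  by_cases hx : x ∈ tsupport w
  · simp [(hχ1 x hx).self_of_nhds, mul_comm]
  · simp [lineDeriv_eq_zero_of_notMem_tsupport hx]

theorem integrable_lineDeriv_sq (hw : LipschitzWith C w) (hc : HasCompactSupport w) (v : E) :
    Integrable (fun x => lineDeriv ℝ w x v ^ 2) μ := by
  have h1 : Integrable (fun x => lineDeriv ℝ w x v) μ := by
    simpa using integrable_lineDeriv_mul (μ := μ) hw hc v (continuous_const (y := (1 : ℝ)))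
  have := h1.bdd_mul (c := C * ‖v‖) (f := fun x => lineDeriv ℝ w x v) h1.aestronglyMeasurable
    (Eventually.of_forall fun x => norm_lineDeriv_le_of_lipschitz ℝ hw)
  simpa [sq] using this

theorem integral_lineDeriv_mul_eq_neg (hw : LipschitzWith C w) (hc : HasCompactSupport w) (v : E)
    {f : E → ℝ} (hf : ContDiff ℝ 1 f) :
    ∫ x, lineDeriv ℝ w x v * f x ∂μ = -∫ x, w x * lineDeriv ℝ f x v ∂μ := by
  obtain ⟨g, hg, hgc, hgf⟩ := exists_contDiff_eventuallyEq hc isOpen_univ (subset_univ _)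
    hf.contDiffOn
  obtain ⟨D, hD⟩ := hg.lipschitzWith_of_hasCompactSupport hgc one_ne_zero
  have h := hw.integral_lineDeriv_mul_eq (μ := μ) hD hgc v
  rw [← integral_neg]
  convert h using 1
  · refine integral_congr_ae (Eventually.of_forall fun x => ?_)
    by_cases hx : x ∈ tsupport w
    · simp [(hgf x hx).self_of_nhds]
    · simp [lineDeriv_eq_zero_of_notMem_tsupport hx]
  · refine integral_congr_ae (Eventually.of_forall fun x => ?_)
    by_cases hx : x ∈ tsupport w
    · simp [(hgf x hx).lineDeriv_eq, lineDeriv_neg, mul_comm]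
    · simp [image_eq_zero_of_notMem_tsupport hx]

theorem lipschitzWith_mul_of_hasCompactSupport {w₁ w₂ : E → ℝ} {C₁ C₂ : ℝ≥0}
    (h₁ : LipschitzWith C₁ w₁) (h₂ : LipschitzWith C₂ w₂) (hc₁ : HasCompactSupport w₁)
    (hc₂ : HasCompactSupport w₂) : ∃ D, LipschitzWith D fun x => w₁ x * w₂ x := by
  obtain ⟨M₁, hM₁⟩ := hc₁.exists_bound_of_continuous h₁.continuous
  obtain ⟨M₂, hM₂⟩ := hc₂.exists_bound_of_continuous h₂.continuous
  refine ⟨_, LipschitzWith.of_dist_le' (K := M₁ * C₂ + M₂ * C₁) fun x y => ?_⟩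
  have e : w₁ x * w₂ x - w₁ y * w₂ y = w₁ x * (w₂ x - w₂ y) + w₂ y * (w₁ x - w₁ y) := by ring
  rw [Real.dist_eq, e]
  have a := h₁.dist_le_mul x y
  have b := h₂.dist_le_mul x y
  rw [Real.dist_eq] at a b
  refine (abs_add_le _ _).trans ?_
  rw [abs_mul, abs_mul]
  have c := hM₁ x
  have d := hM₂ y
  rw [Real.norm_eq_abs] at c d
  have := mul_le_mul c b (abs_nonneg _) ((abs_nonneg _).trans c)
  have := mul_le_mul d a (abs_nonneg _) ((abs_nonneg _).trans d)
  linarith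

theorem le_integral_lineDeriv_sq_of_riccati (hw : LipschitzWith C w) (hc : HasCompactSupport w)
    (v : E) {g : E → ℝ} (hg : ContDiff ℝ 1 g) {k : ℝ}
    (hk : ∀ x, w x ≠ 0 → k ≤ lineDeriv ℝ g x v - g x ^ 2) :
    k * ∫ x, w x ^ 2 ∂μ ≤ ∫ x, lineDeriv ℝ w x v ^ 2 ∂μ := by
  obtain ⟨D, hD⟩ := lipschitzWith_mul_of_hasCompactSupport hw hw hc hc
  have hDc : HasCompactSupport fun x => w x * w x := hc.mul_left
  have hibp := integral_lineDeriv_mul_eq_neg (μ := μ) hD hDc v hg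
  have hgd : Continuous fun x => lineDeriv ℝ g x v := by
    have : (fun x => lineDeriv ℝ g x v) = fun x => fderiv ℝ g x v := by
      ext x
      exact ((hg.differentiable one_ne_zero) x).lineDeriv_eq_fderiv
    rw [this]
    exact (hg.continuous_fderiv one_ne_zero).clm_apply continuous_const
  have i1 : Integrable (fun x => w x * w x * lineDeriv ℝ g x v) μ :=
    ((hw.continuous.mul hw.continuous).mul hgd).integrable_of_hasCompactSupport hDc.mul_right
  have i2 : Integrable (fun x => w x * w x * g x ^ 2) μ :=
    ((hw.continuous.mul hw.continuous).mul
      (hg.continuous.pow 2)).integrable_of_hasCompactSupport hDc.mul_right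
  have i3 : Integrable (fun x => w x ^ 2) μ := by
    simp only [sq]
    exact (hw.continuous.mul hw.continuous).integrable_of_hasCompactSupport hDc
  have i4 := integrable_lineDeriv_mul (μ := μ) hD hDc v hg.continuous
  calc k * ∫ x, w x ^ 2 ∂μ = ∫ x, k * w x ^ 2 ∂μ := (integral_const_mul _ _).symm
    _ ≤ ∫ x, (w x * w x * lineDeriv ℝ g x v - w x * w x * g x ^ 2) ∂μ := by
        refine integral_mono (i3.const_mul k) (i1.sub i2) fun x => ?_
        by_cases hx : w x = 0
        · simp [hx]
        · have := mul_le_mul_of_nonneg_left (hk x hx) (mul_self_nonneg (w x))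
          simp only
          nlinarith
    _ = ∫ x, (-(lineDeriv ℝ (fun x => w x * w x) x v * g x) - w x * w x * g x ^ 2) ∂μ := by
        rw [integral_sub i1 i2, integral_sub i4.fun_neg i2, integral_neg, hibp, neg_neg]
    _ ≤ ∫ x, lineDeriv ℝ w x v ^ 2 ∂μ := by
        refine integral_mono_ae (i4.neg.sub i2) (integrable_lineDeriv_sq hw hc v) ?_
        filter_upwards [hw.ae_lineDifferentiableAt (μ := μ) v] with x hx
        have h1 := hx.hasLineDerivAt
        have h2 : HasLineDerivAt ℝ (fun x => w x * w x)
            (lineDeriv ℝ w x v * w x + w x * lineDeriv ℝ w x v) x v := by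
          have := HasDerivAt.fun_mul h1 h1
          simpa [HasLineDerivAt] using this
        rw [h2.lineDeriv]
        nlinarith [sq_nonneg (lineDeriv ℝ w x v + g x * w x)]

/-- One-dimensional Poincaré inequality along `v` for functions supported in a slab. -/
theorem poincare_slab (hw : LipschitzWith C w) (hc : HasCompactSupport w) {v : E}
    (ℓ : E →L[ℝ] ℝ) (hv : ℓ v = 1) (c : ℝ) (hs : ∀ x, w x ≠ 0 → |ℓ x - c| < 1) :
    (Real.pi / 2) ^ 2 * ∫ x, w x ^ 2 ∂μ ≤ ∫ x, lineDeriv ℝ w x v ^ 2 ∂μ := by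
  have key : ∀ κ ∈ Ioo 0 (Real.pi / 2),
      κ ^ 2 * ∫ x, w x ^ 2 ∂μ ≤ ∫ x, lineDeriv ℝ w x v ^ 2 ∂μ := by
    rintro κ ⟨h0, h1⟩
    let U : Set E := {x | |κ * (ℓ x - c)| < Real.pi / 2}
    have hU : IsOpen U := isOpen_lt (by fun_prop) continuous_const
    have hts : tsupport w ⊆ {x | |ℓ x - c| ≤ 1} :=
      closure_minimal (fun x hx => (hs x hx).le) (isClosed_le (by fun_prop) continuous_const)
    have hsub : tsupport w ⊆ U := fun x hx => by
      have := hts hx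
      simp only [mem_ofPred_eq, U, abs_mul, abs_of_pos h0] at this ⊢
      nlinarith
    have hcos : ∀ x ∈ U, Real.cos (κ * (ℓ x - c)) ≠ 0 := fun x hx =>
      (Real.cos_pos_of_mem_Ioo (abs_lt.1 hx)).ne'
    have hf : ContDiffOn ℝ 1 (fun x => κ * Real.tan (κ * (ℓ x - c))) U := by
      intro x hx
      refine ContDiffAt.contDiffWithinAt ?_
      refine contDiffAt_const.mul ?_
      exact ContDiffAt.comp (g := Real.tan) x (Real.contDiffAt_tan.2 (hcos x hx)) (by fun_prop)
    obtain ⟨g, hg, -, hgf⟩ := exists_contDiff_eventuallyEq hc hU hsub hf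
    refine le_integral_lineDeriv_sq_of_riccati hw hc v hg fun x hx => ?_
    have hxs := subset_tsupport _ hx
    rw [(hgf x hxs).lineDeriv_eq, (hgf x hxs).self_of_nhds]
    have hd : HasLineDerivAt ℝ (fun x => κ * Real.tan (κ * (ℓ x - c)))
        (κ * (1 / Real.cos (κ * (ℓ x - c)) ^ 2 * κ)) x v := by
      have e : HasDerivAt (fun t : ℝ => κ * (ℓ (x + t • v) - c)) κ 0 := by
        have : (fun t : ℝ => κ * (ℓ (x + t • v) - c)) = fun t => κ * t + κ * (ℓ x - c) := by
          ext t
          simp [hv]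
          ring
        rw [this]
        simpa using ((hasDerivAt_id (0 : ℝ)).const_mul κ).add_const (κ * (ℓ x - c))
      have t := Real.hasDerivAt_tan (hcos x (hsub hxs))
      have t' : HasDerivAt Real.tan (1 / Real.cos (κ * (ℓ x - c)) ^ 2)
        (κ * (ℓ (x + (0 : ℝ) • v) - c)) := by simpa using t
      exact (t'.comp 0 e).const_mul κ
    rw [hd.lineDeriv]
    simp only [Real.tan_eq_sin_div_cos]
    have hx0 := hcos x (hsub hxs)
    have := Real.sin_sq_add_cos_sq (κ * (ℓ x - c))
    refine le_of_eq ?_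
    field_simp
    linear_combination this
  have hlim : Tendsto (fun κ : ℝ => κ ^ 2 * ∫ x, w x ^ 2 ∂μ) (𝓝[<] (Real.pi / 2))
      (𝓝 ((Real.pi / 2) ^ 2 * ∫ x, w x ^ 2 ∂μ)) :=
    ((by fun_prop : Continuous fun κ : ℝ => κ ^ 2 * ∫ x, w x ^ 2 ∂μ).tendsto _).mono_left
      nhdsWithin_le_nhds
  refine le_of_tendsto hlim ?_
  filter_upwards [Ioo_mem_nhdsLT (by positivity : (0 : ℝ) < Real.pi / 2)] with κ hκ
  exact key κ hκ

end Calibration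

section Diamond

open Filter Topology
open scoped NNReal

/-- The Dirichlet energy of `w` in the direction `v`. -/
def dirEnergy (w : ℝ × ℝ → ℝ) (v : ℝ × ℝ) : ℝ := ∫ p, lineDeriv ℝ w p v ^ 2

/-- The squared `L²` norm of `w`. -/
def sqNorm (w : ℝ × ℝ → ℝ) : ℝ := ∫ p, w p ^ 2

variable {w : ℝ × ℝ → ℝ} {C : ℝ≥0}

theorem sqNorm_nonneg : 0 ≤ sqNorm w := integral_nonneg fun _ => sq_nonneg _

theorem dirEnergy_nonneg (v : ℝ × ℝ) : 0 ≤ dirEnergy w v := integral_nonneg fun _ => sq_nonneg _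

theorem ae_lineDeriv_eq_combination (hw : LipschitzWith C w) :
    ∀ᵐ p, ∀ a b : ℝ, lineDeriv ℝ w p (a, b) =
      a * lineDeriv ℝ w p (1, 0) + b * lineDeriv ℝ w p (0, 1) := by
  filter_upwards [hw.ae_differentiableAt (μ := (volume : Measure (ℝ × ℝ)))] with p hp a b
  rw [hp.lineDeriv_eq_fderiv, hp.lineDeriv_eq_fderiv, hp.lineDeriv_eq_fderiv]
  have : ((a, b) : ℝ × ℝ) = a • (1, 0) + b • (0, 1) := by simp
  rw [this, map_add, map_smul, map_smul, smul_eq_mul, smul_eq_mul]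

theorem diamond_energy_bound (hw : LipschitzWith C w) (hc : HasCompactSupport w)
    {α β a μ ν P : ℝ} (hα : 0 < α) (hβ : 0 < β) (hμ : 0 < μ) (hν : 0 < ν)
    (hP : P = μ / α ^ 2 + ν / β ^ 2)
    (hs : ∀ p, w p ≠ 0 → |p.1 - a| / α + |p.2| / β < 1) :
    (Real.pi / 2) ^ 2 * (P + 4 * μ * ν / (α ^ 2 * β ^ 2 * P)) * sqNorm w ≤
      μ * dirEnergy w (1, 0) + ν * dirEnergy w (0, 1) := by
  have hPpos : 0 < P := by rw [hP]; positivity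
  set Q := μ / α ^ 2 - ν / β ^ 2 with hQ
  set r := Q / P with hr
  have habs : ∀ p, w p ≠ 0 → |(p.1 - a) / α| + |p.2 / β| < 1 := fun p hp => by
    simpa [abs_div, abs_of_pos hα, abs_of_pos hβ] using hs p hp
  let ξ : ℝ × ℝ →L[ℝ] ℝ := α⁻¹ • ContinuousLinearMap.fst ℝ ℝ ℝ + β⁻¹ • ContinuousLinearMap.snd ℝ ℝ ℝ
  let η : ℝ × ℝ →L[ℝ] ℝ := α⁻¹ • ContinuousLinearMap.fst ℝ ℝ ℝ - β⁻¹ • ContinuousLinearMap.snd ℝ ℝ ℝ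
  have h1 := poincare_slab (μ := volume) hw hc (v := (α / 2, β / 2)) ξ
    (by simp [ξ]; field_simp; norm_num) (a / α) (fun p hp => by
      have := habs p hp
      have e : ξ p - a / α = (p.1 - a) / α + p.2 / β := by simp [ξ]; ring
      rw [e]
      exact (abs_add_le _ _).trans_lt this)
  have h2 := poincare_slab (μ := volume) hw hc
    (v := (α / 2 * (1 + r), β / 2 * (r - 1))) η
    (by simp [η]; field_simp; ring) (a / α) (fun p hp => by
      have := habs p hp
      have e : η p - a / α = (p.1 - a) / α - p.2 / β := by simp [η]; ring
      rw [e]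
      exact (abs_sub _ _).trans_lt this)
  have key : μ * dirEnergy w (1, 0) + ν * dirEnergy w (0, 1) =
      P * (∫ p, lineDeriv ℝ w p (α / 2 * (1 + r), β / 2 * (r - 1)) ^ 2) +
      (4 * μ * ν / (α ^ 2 * β ^ 2 * P)) * ∫ p, lineDeriv ℝ w p (α / 2, β / 2) ^ 2 := by
    have i := fun v => integrable_lineDeriv_sq (μ := (volume : Measure (ℝ × ℝ))) hw hc v
    rw [dirEnergy, dirEnergy, ← integral_const_mul, ← integral_const_mul, ← integral_const_mul,
      ← integral_const_mul, ← integral_add ((i _).const_mul _) ((i _).const_mul _),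
      ← integral_add ((i _).const_mul _) ((i _).const_mul _)]
    refine integral_congr_ae ?_
    filter_upwards [ae_lineDeriv_eq_combination hw] with p hp
    rw [hp (α / 2) (β / 2), hp (α / 2 * (1 + r)) (β / 2 * (r - 1))]
    generalize lineDeriv ℝ w p (1, 0) = X
    generalize lineDeriv ℝ w p (0, 1) = Y
    have hrP : r * P = Q := by rw [hr]; field_simp
    have hμ' : μ = α ^ 2 * (P + Q) / 2 := by rw [hP, hQ]; field_simp; ring
    have hν' : ν = β ^ 2 * (P - Q) / 2 := by rw [hP, hQ]; field_simp; ring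
    rw [hμ', hν', ← hrP]
    field_simp
    ring
  rw [key]
  have hpos : 0 ≤ 4 * μ * ν / (α ^ 2 * β ^ 2 * P) := by positivity
  have := mul_le_mul_of_nonneg_left h1 hpos
  have := mul_le_mul_of_nonneg_left h2 hPpos.le
  rw [sqNorm]
  linarith

end Diamond

section Polarization

open Filter Topology
open scoped NNReal

/-- Nonnegative compactly supported Lipschitz functions on the plane. -/
structure IsAdmissible (w : ℝ × ℝ → ℝ) : Prop where
  lipschitz : ∃ C, LipschitzWith C w
  compact : HasCompactSupport w
  nonneg : ∀ p, 0 ≤ w p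

/-- The reflection of the plane in the vertical line of abscissa `c`. -/
def vreflect (c : ℝ) (p : ℝ × ℝ) : ℝ × ℝ := (2 * c - p.1, p.2)

/-- The two-point symmetrization of `w` with respect to the vertical line of abscissa `c`. -/
def polarize (c : ℝ) (w : ℝ × ℝ → ℝ) (p : ℝ × ℝ) : ℝ :=
  if p.1 ≤ c then max (w p) (w (vreflect c p)) else min (w p) (w (vreflect c p))

variable {c : ℝ} {w : ℝ × ℝ → ℝ}

theorem vreflect_vreflect (p : ℝ × ℝ) : vreflect c (vreflect c p) = p := by simp [vreflect]

theorem measurePreserving_vreflect : MeasurePreserving (vreflect c) volume volume :=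
  (Measure.measurePreserving_sub_left volume (2 * c)).prod (MeasurePreserving.id volume)

theorem isometry_vreflect : Isometry (vreflect c) :=
  Isometry.of_dist_eq fun p q => by
    rw [vreflect, vreflect, Prod.dist_eq, Prod.dist_eq, dist_sub_left]

theorem measurableEmbedding_vreflect : MeasurableEmbedding (vreflect c) :=
  isometry_vreflect.isClosedEmbedding.measurableEmbedding

theorem integral_comp_vreflect (F : ℝ × ℝ → ℝ) : ∫ p, F (vreflect c p) = ∫ p, F p :=
  measurePreserving_vreflect.integral_comp measurableEmbedding_vreflect F

theorem integral_le_of_symmetrized_le {F G : ℝ × ℝ → ℝ} (hF : Integrable F) (hG : Integrable G)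
    (h : ∀ᵐ p, F p + F (vreflect c p) ≤ G p + G (vreflect c p)) : ∫ p, F p ≤ ∫ p, G p := by
  have i : ∀ {F : ℝ × ℝ → ℝ}, Integrable F → Integrable fun p => F (vreflect c p) := fun hF =>
    (measurePreserving_vreflect.integrable_comp_emb measurableEmbedding_vreflect).2 hF
  have := integral_mono_ae (hF.add (i hF)) (hG.add (i hG)) h
  simp only [Pi.add_apply] at this
  rw [integral_add hF (i hF), integral_add hG (i hG), integral_comp_vreflect,
    integral_comp_vreflect] at this
  linarith

theorem integral_eq_of_symmetrized_eq {F G : ℝ × ℝ → ℝ} (hF : Integrable F) (hG : Integrable G)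
    (h : ∀ p, F p + F (vreflect c p) = G p + G (vreflect c p)) : ∫ p, F p = ∫ p, G p :=
  (integral_le_of_symmetrized_le hF hG (.of_forall fun p => (h p).le)).antisymm
    (integral_le_of_symmetrized_le hG hF (.of_forall fun p => (h p).ge))

theorem polarize_of_le {p : ℝ × ℝ} (h : p.1 ≤ c) :
    polarize c w p = max (w p) (w (vreflect c p)) := if_pos h

theorem polarize_of_ge {p : ℝ × ℝ} (h : c ≤ p.1) :
    polarize c w p = min (w p) (w (vreflect c p)) := by
  rcases h.eq_or_lt with h | h
  · have e : vreflect c p = p := by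
      ext <;> simp [vreflect]
      linarith
    rw [polarize_of_le h.ge, e, max_self, min_self]
  · exact if_neg h.not_ge

theorem lipschitzWith_polarize {C : ℝ≥0} (hw : LipschitzWith C w) :
    LipschitzWith C (polarize c w) := by
  have hσ : LipschitzWith C fun p => w (vreflect c p) := by
    simpa [Function.comp_def] using hw.comp (isometry_vreflect (c := c)).lipschitz
  have hmax := hw.max hσ
  have hmin := hw.min hσ
  rw [max_self] at hmax hmin
  have cross : ∀ p q : ℝ × ℝ, p.1 ≤ c → c ≤ q.1 →
      |polarize c w p - polarize c w q| ≤ C * dist p q := by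
    intro p q hp hq
    rw [polarize_of_le hp, polarize_of_ge hq]
    have a1 := hw.dist_le_mul p q
    have a2 := hσ.dist_le_mul p q
    have hd : dist (vreflect c p) q ≤ dist p q := by
      simp only [vreflect, Prod.dist_eq, Real.dist_eq]
      refine max_le_max ?_ le_rfl
      rw [abs_le]
      constructor <;> rw [abs_sub_comm, abs_of_nonneg (by linarith)] <;> linarith
    have hd' : dist p (vreflect c q) ≤ dist p q := by
      have := isometry_vreflect.dist_eq (vreflect c p) q (f := vreflect c)
      rw [vreflect_vreflect] at this
      rw [this]
      exact hd
    have a3 := (hw.dist_le_mul (vreflect c p) q).trans (mul_le_mul_of_nonneg_left hd C.2)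
    have a4 := (hw.dist_le_mul p (vreflect c q)).trans (mul_le_mul_of_nonneg_left hd' C.2)
    simp only [Real.dist_eq] at a1 a2 a3 a4
    rcases max_cases (w p) (w (vreflect c p)) with h | h <;>
    rcases min_cases (w q) (w (vreflect c q)) with h' | h' <;> rw [h.1, h'.1] <;> assumption
  refine LipschitzWith.of_dist_le_mul fun p q => ?_
  rcases le_total p.1 c with hp | hp <;> rcases le_total q.1 c with hq | hq
  · rw [polarize_of_le hp, polarize_of_le hq]
    exact hmax.dist_le_mul p q
  · exact cross p q hp hq
  · rw [dist_comm, dist_comm p]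
    exact cross q p hq hp
  · rw [polarize_of_ge hp, polarize_of_ge hq]
    exact hmin.dist_le_mul p q

theorem IsAdmissible.polarize (hw : IsAdmissible w) : IsAdmissible (polarize c w) where
  lipschitz := hw.lipschitz.imp fun _ => lipschitzWith_polarize
  compact := by
    refine HasCompactSupport.intro (hw.compact.isCompact.union
      (hw.compact.isCompact.image isometry_vreflect.continuous (f := vreflect c))) fun p hp => ?_
    have h1 : w p = 0 := image_eq_zero_of_notMem_tsupport fun h => hp (Or.inl h)
    have h2 : w (vreflect c p) = 0 := image_eq_zero_of_notMem_tsupport fun h =>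
      hp (Or.inr ⟨_, h, vreflect_vreflect p⟩)
    simp [_root_.polarize, h1, h2]
  nonneg p := by
    unfold _root_.polarize
    split_ifs
    · exact le_max_of_le_left (hw.nonneg p)
    · exact le_min (hw.nonneg _) (hw.nonneg _)

theorem deriv_max_sq_add_deriv_min_sq_le {f g : ℝ → ℝ} {s : ℝ} (hf : DifferentiableAt ℝ f s)
    (hg : DifferentiableAt ℝ g s) :
    deriv (fun t => max (f t) (g t)) s ^ 2 + deriv (fun t => min (f t) (g t)) s ^ 2 ≤
      deriv f s ^ 2 + deriv g s ^ 2 := by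
  have strict : ∀ {f g : ℝ → ℝ}, DifferentiableAt ℝ f s → DifferentiableAt ℝ g s → f s < g s →
      deriv (fun t => max (f t) (g t)) s ^ 2 + deriv (fun t => min (f t) (g t)) s ^ 2 ≤
      deriv f s ^ 2 + deriv g s ^ 2 := by
    intro f g hf hg h
    have ev := hf.continuousAt.eventually_lt hg.continuousAt h
    have e1 : (fun t => max (f t) (g t)) =ᶠ[𝓝 s] g := by
      filter_upwards [ev] with t ht using max_eq_right ht.le
    have e2 : (fun t => min (f t) (g t)) =ᶠ[𝓝 s] f := by
      filter_upwards [ev] with t ht using min_eq_left ht.le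
    rw [e1.deriv_eq, e2.deriv_eq, add_comm]
  rcases lt_trichotomy (f s) (g s) with h | h | h
  · exact strict hf hg h
  · have touch : ∀ {k l : ℝ → ℝ}, DifferentiableAt ℝ k s → DifferentiableAt ℝ l s →
        (∀ t, k t ≤ l t) → k s = l s → deriv k s = deriv l s := by
      intro k l hk hl hkl hs
      have : deriv (fun t => l t - k t) s = 0 :=
        IsLocalMin.deriv_eq_zero (Eventually.of_forall fun t => by
          simp only [hs, sub_self]
          exact sub_nonneg.2 (hkl t))
      rw [deriv_fun_sub hl hk] at this
      linarith
    have hmax : deriv (fun t => max (f t) (g t)) s = 0 ∨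
        deriv (fun t => max (f t) (g t)) s = deriv f s ∧
        deriv (fun t => max (f t) (g t)) s = deriv g s := by
      by_cases hd : DifferentiableAt ℝ (fun t => max (f t) (g t)) s
      · exact Or.inr ⟨(touch hf hd (fun t => le_max_left _ _) (by simp [h])).symm,
          (touch hg hd (fun t => le_max_right _ _) (by simp [h])).symm⟩
      · exact Or.inl (deriv_zero_of_not_differentiableAt hd)
    have hmin : deriv (fun t => min (f t) (g t)) s = 0 ∨
        deriv (fun t => min (f t) (g t)) s = deriv f s ∧
        deriv (fun t => min (f t) (g t)) s = deriv g s := by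
      by_cases hd : DifferentiableAt ℝ (fun t => min (f t) (g t)) s
      · exact Or.inr ⟨touch hd hf (fun t => min_le_left _ _) (by simp [h]),
          touch hd hg (fun t => min_le_right _ _) (by simp [h])⟩
      · exact Or.inl (deriv_zero_of_not_differentiableAt hd)
    rcases hmax with h1 | ⟨h1, h1'⟩ <;> rcases hmin with h2 | ⟨h2, h2'⟩ <;> rw [h1, h2]
    · nlinarith [sq_nonneg (deriv f s), sq_nonneg (deriv g s)]
    · nlinarith [sq_nonneg (deriv g s)]
    · nlinarith [sq_nonneg (deriv g s)]
    · rw [← h1.symm.trans h1']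
  · have := strict hg hf h
    simp only [max_comm (f _), min_comm (f _)]
    linarith

theorem polarize_lineDeriv_sq_le {p v : ℝ × ℝ} (hp : p.1 ≠ c)
    (h1 : LineDifferentiableAt ℝ w p v)
    (h2 : LineDifferentiableAt ℝ w (vreflect c p) (vreflect 0 v)) :
    lineDeriv ℝ (polarize c w) p v ^ 2 +
      lineDeriv ℝ (polarize c w) (vreflect c p) (vreflect 0 v) ^ 2 ≤
    lineDeriv ℝ w p v ^ 2 + lineDeriv ℝ w (vreflect c p) (vreflect 0 v) ^ 2 := by
  have hr : ∀ (p v : ℝ × ℝ) (t : ℝ), vreflect c (p + t • v) = vreflect c p + t • vreflect 0 v := by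
    intro p v t
    ext <;> simp [vreflect]
    ring
  have hv : vreflect 0 (vreflect 0 v) = v := vreflect_vreflect v
  have hlt : ∀ {q u : ℝ × ℝ}, q.1 < c → lineDeriv ℝ (polarize c w) q u =
      deriv (fun t : ℝ => max (w (q + t • u)) (w (vreflect c q + t • vreflect 0 u))) 0 := by
    intro q u hq
    refine EventuallyEq.deriv_eq ?_
    have hcont : Continuous fun t : ℝ => (q + t • u).1 := by fun_prop
    have : ∀ᶠ t : ℝ in 𝓝 0, (q + t • u).1 < c :=
      hcont.continuousAt.eventually_lt continuousAt_const (by simpa using hq)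
    filter_upwards [this] with t ht
    rw [polarize_of_le ht.le, hr]
  have hgt : ∀ {q u : ℝ × ℝ}, c < q.1 → lineDeriv ℝ (polarize c w) q u =
      deriv (fun t : ℝ => min (w (q + t • u)) (w (vreflect c q + t • vreflect 0 u))) 0 := by
    intro q u hq
    refine EventuallyEq.deriv_eq ?_
    have hcont : Continuous fun t : ℝ => (q + t • u).1 := by fun_prop
    have : ∀ᶠ t : ℝ in 𝓝 0, c < (q + t • u).1 :=
      continuousAt_const.eventually_lt hcont.continuousAt (by simpa using hq)
    filter_upwards [this] with t ht
    rw [polarize_of_ge ht.le, hr]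
  have key := deriv_max_sq_add_deriv_min_sq_le h1 h2
  rcases hp.lt_or_gt with h | h
  · have h' : c < (vreflect c p).1 := by simp only [vreflect]; linarith
    rw [hlt h, hgt h', vreflect_vreflect, hv]
    simp only [min_comm (w (vreflect c p + _))]
    exact key
  · have h' : (vreflect c p).1 < c := by simp only [vreflect]; linarith
    rw [hgt h, hlt h', vreflect_vreflect, hv, add_comm]
    simp only [max_comm (w (vreflect c p + _))]
    exact key

theorem polarize_add_polarize_vreflect (φ : ℝ → ℝ) (p : ℝ × ℝ) :
    φ (polarize c w p) + φ (polarize c w (vreflect c p)) = φ (w p) + φ (w (vreflect c p)) := by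
  rcases le_total p.1 c with h | h
  · have h' : c ≤ (vreflect c p).1 := by simp only [vreflect]; linarith
    rw [polarize_of_le h, polarize_of_ge h', vreflect_vreflect]
    rcases le_total (w p) (w (vreflect c p)) with h | h <;> simp [h, add_comm]
  · have h' : (vreflect c p).1 ≤ c := by simp only [vreflect]; linarith
    rw [polarize_of_ge h, polarize_of_le h', vreflect_vreflect]
    rcases le_total (w p) (w (vreflect c p)) with h | h <;> simp [h, add_comm]

theorem IsAdmissible.integrable_mul (hw : IsAdmissible w) {f : ℝ × ℝ → ℝ} (hf : Continuous f) :
    Integrable fun p => w p * f p := by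
  obtain ⟨C, hC⟩ := hw.lipschitz
  exact (hC.continuous.mul hf).integrable_of_hasCompactSupport hw.compact.mul_right

theorem IsAdmissible.integrable_sq (hw : IsAdmissible w) : Integrable fun p => w p ^ 2 := by
  obtain ⟨C, hC⟩ := hw.lipschitz
  simpa [sq] using hw.integrable_mul hC.continuous

theorem sqNorm_polarize (hw : IsAdmissible w) : sqNorm (polarize c w) = sqNorm w :=
  integral_eq_of_symmetrized_eq hw.polarize.integrable_sq hw.integrable_sq
    (polarize_add_polarize_vreflect (· ^ 2))

theorem integral_polarize_mul (hw : IsAdmissible w) {b : ℝ → ℝ} (hb : Continuous b) :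
    ∫ p, polarize c w p * b p.2 = ∫ p, w p * b p.2 :=
  integral_eq_of_symmetrized_eq (hw.polarize.integrable_mul (f := fun p => b p.2) (by fun_prop))
    (hw.integrable_mul (f := fun p => b p.2) (by fun_prop))
    fun p => by simpa [vreflect] using polarize_add_polarize_vreflect (c := c) (w := w) (· * b p.2) p

theorem ae_fst_ne (c : ℝ) : ∀ᵐ p : ℝ × ℝ, p.1 ≠ c := by
  have : ∀ᵐ x : ℝ, x ≠ c := Measure.ae_ne volume c
  exact Measure.quasiMeasurePreserving_fst.ae this

theorem dirEnergy_polarize_le (hw : IsAdmissible w) {v : ℝ × ℝ}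
    (hv : vreflect 0 v = v ∨ vreflect 0 v = -v) :
    dirEnergy (polarize c w) v ≤ dirEnergy w v := by
  obtain ⟨C, hC⟩ := hw.lipschitz
  obtain ⟨D, hD⟩ := hw.polarize (c := c) |>.lipschitz
  have hsq : ∀ (u : ℝ × ℝ → ℝ) q, lineDeriv ℝ u q (vreflect 0 v) ^ 2 = lineDeriv ℝ u q v ^ 2 := by
    intro u q
    rcases hv with h | h <;> rw [h]
    rw [lineDeriv_neg, neg_sq]
  refine integral_le_of_symmetrized_le (c := c) (integrable_lineDeriv_sq hD hw.polarize.compact v)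
    (integrable_lineDeriv_sq hC hw.compact v) ?_
  filter_upwards [ae_fst_ne c, hC.ae_lineDifferentiableAt (μ := volume) v,
    measurePreserving_vreflect.quasiMeasurePreserving.ae
      (hC.ae_lineDifferentiableAt (μ := volume) (vreflect 0 v))] with p hp h1 h2
  have := polarize_lineDeriv_sq_le hp h1 h2
  rwa [hsq, hsq] at this

theorem dirEnergy_polarize_fst_le (hw : IsAdmissible w) :
    dirEnergy (polarize c w) (1, 0) ≤ dirEnergy w (1, 0) :=
  dirEnergy_polarize_le hw (Or.inr (by simp [vreflect]))

theorem dirEnergy_polarize_snd_le (hw : IsAdmissible w) :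
    dirEnergy (polarize c w) (0, 1) ≤ dirEnergy w (0, 1) :=
  dirEnergy_polarize_le hw (Or.inl (by simp [vreflect]))

theorem polarize_support (hw : ∀ p, 0 ≤ w p) {m κ : ℝ → ℝ}
    (hs : ∀ p, w p ≠ 0 → |p.1 - m p.2| < κ p.2) {p : ℝ × ℝ} (hp : polarize c w p ≠ 0) :
    |p.1 - (c - |m p.2 - c|)| < κ p.2 := by
  rcases le_total p.1 c with h | h
  · rw [polarize_of_le h] at hp
    have : w p ≠ 0 ∨ w (vreflect c p) ≠ 0 := by
      by_contra! hcon
      exact hp (by simp [hcon.1, hcon.2])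
    rcases this with h0 | h0
    · have := abs_lt.1 (hs _ h0)
      rw [abs_lt]
      rcases abs_cases (m p.2 - c) with h' | h' <;> rw [h'.1] <;> constructor <;> linarith
    · have := abs_lt.1 (hs _ h0)
      simp only [vreflect] at this
      rw [abs_lt]
      rcases abs_cases (m p.2 - c) with h' | h' <;> rw [h'.1] <;> constructor <;> linarith
  · rw [polarize_of_ge h] at hp
    have hpos : 0 < min (w p) (w (vreflect c p)) := (le_min (hw _) (hw _)).lt_of_ne' hp
    have h1 := abs_lt.1 (hs _ (lt_min_iff.1 hpos).1.ne')
    have h2 := abs_lt.1 (hs _ (lt_min_iff.1 hpos).2.ne')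
    simp only [vreflect] at h2
    rw [abs_lt]
    rcases abs_cases (m p.2 - c) with h' | h' <;> rw [h'.1] <;> constructor <;> linarith

/-- Iterated polarization aligns the horizontal fibres of the support up to an arbitrarily small
error, without increasing the directional energies. -/
theorem exists_aligned (hw : IsAdmissible w) {m κ : ℝ → ℝ} {a d : ℝ}
    (hs : ∀ p, w p ≠ 0 → |p.1 - m p.2| < κ p.2) (hm : ∀ y, m y ∈ Icc a (a + d)) {ε : ℝ}
    (hε : 0 < ε) : ∃ u, IsAdmissible u ∧ (∀ p, u p ≠ 0 → |p.1 - a| < κ p.2 + ε) ∧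
      sqNorm u = sqNorm w ∧ dirEnergy u (1, 0) ≤ dirEnergy w (1, 0) ∧
      dirEnergy u (0, 1) ≤ dirEnergy w (0, 1) ∧
      ∀ b : ℝ → ℝ, Continuous b → ∫ p, u p * b p.2 = ∫ p, w p * b p.2 := by
  have step : ∀ n : ℕ, ∃ u, IsAdmissible u ∧ (∃ m' : ℝ → ℝ, (∀ y, m' y ∈ Icc a (a + d / 2 ^ n)) ∧
      ∀ p, u p ≠ 0 → |p.1 - m' p.2| < κ p.2) ∧
      sqNorm u = sqNorm w ∧ dirEnergy u (1, 0) ≤ dirEnergy w (1, 0) ∧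
      dirEnergy u (0, 1) ≤ dirEnergy w (0, 1) ∧
      ∀ b : ℝ → ℝ, Continuous b → ∫ p, u p * b p.2 = ∫ p, w p * b p.2 := by
    intro n
    induction n with
    | zero => exact ⟨w, hw, ⟨m, by simpa using hm, hs⟩, rfl, le_rfl, le_rfl, fun _ _ => rfl⟩
    | succ n ih =>
      obtain ⟨u, hu, ⟨m', hm', hs'⟩, hN, hx, hy, hb⟩ := ih
      refine ⟨polarize (a + d / 2 ^ n / 2) u, hu.polarize,
        ⟨fun y => (a + d / 2 ^ n / 2) - |m' y - (a + d / 2 ^ n / 2)|, fun y => ?_,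
          fun p hp => polarize_support hu.nonneg hs' hp⟩,
        (sqNorm_polarize hu).trans hN, (dirEnergy_polarize_fst_le hu).trans hx,
        (dirEnergy_polarize_snd_le hu).trans hy,
        fun b hb' => (integral_polarize_mul hu hb').trans (hb b hb')⟩
      have := hm' y
      rw [pow_succ, ← div_div]
      generalize d / 2 ^ n = e at this ⊢
      rcases abs_cases (m' y - (a + e / 2)) with h' | h' <;> simp only [h'.1] <;> constructor <;>
        linarith [this.1, this.2]
  have hlim : Tendsto (fun n : ℕ => d / 2 ^ n) atTop (𝓝 0) := by
    have := (tendsto_pow_atTop_nhds_zero_of_lt_one (r := (1 / 2 : ℝ)) (by norm_num)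
      (by norm_num)).const_mul d
    simpa [div_eq_mul_inv] using this
  obtain ⟨n, hn⟩ := (hlim.eventually_lt_const hε).exists
  obtain ⟨u, hu, ⟨m', hm', hs'⟩, h⟩ := step n
  refine ⟨u, hu, fun p hp => ?_, h⟩
  have h1 := abs_lt.1 (hs' p hp)
  have h2 := hm' p.2
  rw [abs_lt]
  constructor <;> linarith [h2.1, h2.2]

end Polarization

section Kite

open Filter Topology
open scoped NNReal

/-- `w` vanishes outside the open kite with vertices `(±π, 0)` and `(t β, ±β)`. -/
def SupportedInKite (t β : ℝ) (w : ℝ × ℝ → ℝ) : Prop :=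
  ∀ p, w p ≠ 0 → |p.1 - t * abs p.2| < Real.pi - Real.pi / β * |p.2|

variable {t β : ℝ} {w : ℝ × ℝ → ℝ}

theorem exists_aligned_kite (hw : IsAdmissible w) (hβ : 0 < β) (hs : SupportedInKite t β w)
    {r : ℝ} (hr : 1 < r) : ∃ u, IsAdmissible u ∧
      (∀ p, u p ≠ 0 → |p.1 - min 0 (t * β)| / (Real.pi * r) + |p.2| / (β * r) < 1) ∧
      sqNorm u = sqNorm w ∧ dirEnergy u (1, 0) ≤ dirEnergy w (1, 0) ∧
      dirEnergy u (0, 1) ≤ dirEnergy w (0, 1) ∧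
      ∀ b : ℝ → ℝ, Continuous b → ∫ p, u p * b p.2 = ∫ p, w p * b p.2 := by
  have hπ := Real.pi_pos
  obtain ⟨u, hu, hus, h⟩ := exists_aligned hw (m := fun y => t * min |y| β)
    (κ := fun y => Real.pi - Real.pi / β * |y|) (a := min 0 (t * β)) (d := |t * β|)
    (ε := Real.pi * (r - 1)) (fun p hp => by
      have h1 := hs p hp
      have h2 : |p.2| < β := by
        have := (abs_nonneg _).trans_lt h1
        have h3 : Real.pi / β * |p.2| < Real.pi / β * β := by
          rw [div_mul_cancel₀ _ hβ.ne']
          linarith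
        exact lt_of_mul_lt_mul_left h3 (by positivity)
      simpa only [min_eq_left h2.le] using h1) (fun y => by
      have h0 : 0 ≤ min |y| β := le_min (abs_nonneg _) hβ.le
      have h1 : min |y| β ≤ β := min_le_right _ _
      generalize min |y| β = z at h0 h1 ⊢
      rcases le_total 0 t with ht | ht
      · rw [min_eq_left (by positivity), abs_of_nonneg (by positivity)]
        constructor <;> nlinarith
      · have : t * β ≤ 0 := mul_nonpos_of_nonpos_of_nonneg ht hβ.le
        rw [min_eq_right this, abs_of_nonpos this]
        constructor <;> nlinarith) (by nlinarith)
  refine ⟨u, hu, fun p hp => ?_, h⟩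
  have h1 := hus p hp
  rw [div_add_div _ _ (by positivity) (by positivity), div_lt_one (by positivity)]
  have h2 : (|p.1 - min 0 (t * β)| + Real.pi / β * |p.2|) * (β * r) <
      Real.pi * r * (β * r) := mul_lt_mul_of_pos_right (by linarith) (by positivity)
  have h3 : Real.pi / β * |p.2| * (β * r) = Real.pi * r * |p.2| := by field_simp
  linarith

theorem kite_energy_bound (hw : IsAdmissible w) (hβ : 0 < β) (hs : SupportedInKite t β w)
    {μ ν P : ℝ} (hμ : 0 < μ) (hν : 0 < ν) (hP : P = μ / Real.pi ^ 2 + ν / β ^ 2) :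
    (Real.pi / 2) ^ 2 * (P + 4 * μ * ν / (Real.pi ^ 2 * β ^ 2 * P)) * sqNorm w ≤
      μ * dirEnergy w (1, 0) + ν * dirEnergy w (0, 1) := by
  have hπ := Real.pi_pos
  have hPpos : 0 < P := by rw [hP]; positivity
  have key : ∀ r : ℝ, 1 < r →
      (Real.pi / 2) ^ 2 * (P + 4 * μ * ν / (Real.pi ^ 2 * β ^ 2 * P)) * sqNorm w ≤
      r ^ 2 * (μ * dirEnergy w (1, 0) + ν * dirEnergy w (0, 1)) := by
    intro r hr
    obtain ⟨u, hu, hus, hN, hx, hy, -⟩ := exists_aligned_kite hw hβ hs hr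
    obtain ⟨C, hC⟩ := hu.lipschitz
    have h1 := diamond_energy_bound hC hu.compact (α := Real.pi * r) (β := β * r) (P := P / r ^ 2)
      (by positivity) (by positivity) hμ hν (by rw [hP]; field_simp) hus
    have h2 : P / r ^ 2 + 4 * μ * ν / ((Real.pi * r) ^ 2 * (β * r) ^ 2 * (P / r ^ 2)) =
        (P + 4 * μ * ν / (Real.pi ^ 2 * β ^ 2 * P)) / r ^ 2 := by
      field_simp
    rw [h2, hN] at h1
    have h3 := mul_le_mul_of_nonneg_left hx hμ.le
    have h4 := mul_le_mul_of_nonneg_left hy hν.le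
    have h5 := mul_le_mul_of_nonneg_left (h1.trans (add_le_add h3 h4))
      (by positivity : 0 ≤ r ^ 2)
    refine le_trans (le_of_eq ?_) h5
    field_simp
  have hlim : Tendsto (fun r : ℝ => r ^ 2 * (μ * dirEnergy w (1, 0) + ν * dirEnergy w (0, 1)))
      (𝓝[>] 1) (𝓝 (1 ^ 2 * (μ * dirEnergy w (1, 0) + ν * dirEnergy w (0, 1)))) :=
    ((by fun_prop : Continuous fun r : ℝ => r ^ 2 * (μ * dirEnergy w (1, 0) +
      ν * dirEnergy w (0, 1))).tendsto _).mono_left nhdsWithin_le_nhds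
  rw [one_pow, one_mul] at hlim
  exact ge_of_tendsto hlim (eventually_nhdsWithin_of_forall fun r hr => key r hr)

/-- The energy bound obtained from the rhombus for a general aspect ratio. -/
theorem kite_isotropic_bound (hw : IsAdmissible w) (hβ : 0 < β) (hs : SupportedInKite t β w) :
    (Real.pi ^ 2 + β ^ 2) / (4 * β ^ 2) * sqNorm w +
      Real.pi ^ 2 / (Real.pi ^ 2 + β ^ 2) * sqNorm w ≤
      dirEnergy w (1, 0) + dirEnergy w (0, 1) := by
  have hπ := Real.pi_pos
  have := kite_energy_bound hw hβ hs one_pos one_pos rfl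
  rw [one_mul, one_mul] at this
  refine le_trans (le_of_eq ?_) this
  field_simp
  ring

/-- For kites of height `π` the vertical and horizontal energies of near-minimizers agree. -/
theorem kite_anisotropic_bound (hw : IsAdmissible w) (hs : SupportedInKite t Real.pi w) {s : ℝ}
    (h0 : -1 < s) (h1 : s < 1) : (1 - s ^ 2 / 2) * sqNorm w ≤
      (1 + s) * dirEnergy w (1, 0) + (1 - s) * dirEnergy w (0, 1) := by
  have hπ := Real.pi_pos
  have := kite_energy_bound hw hπ hs (μ := 1 + s) (ν := 1 - s) (P := 2 / Real.pi ^ 2)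
    (by linarith) (by linarith) (by ring)
  refine le_trans (le_of_eq ?_) this
  field_simp
  ring

end Kite

section AffineChange

open Filter Topology
open scoped NNReal

/-- The linear map of the plane with matrix `!![a, b; c, d]`. -/
def planeMap (a b c d : ℝ) : ℝ × ℝ →L[ℝ] ℝ × ℝ :=
  (a • ContinuousLinearMap.fst ℝ ℝ ℝ + b • ContinuousLinearMap.snd ℝ ℝ ℝ).prod
    (c • ContinuousLinearMap.fst ℝ ℝ ℝ + d • ContinuousLinearMap.snd ℝ ℝ ℝ)

variable {a b c d : ℝ}

@[simp] theorem planeMap_apply (p : ℝ × ℝ) :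
    planeMap a b c d p = (a * p.1 + b * p.2, c * p.1 + d * p.2) := rfl

theorem det_planeMap : (planeMap a b c d : ℝ × ℝ →ₗ[ℝ] ℝ × ℝ).det = a * d - b * c := by
  have : (planeMap a b c d : ℝ × ℝ →ₗ[ℝ] ℝ × ℝ) =
      Matrix.toLin (Module.Basis.finTwoProd ℝ) (Module.Basis.finTwoProd ℝ) !![a, b; c, d] := by
    ext <;> simp [planeMap, Matrix.toLin_finTwoProd_apply]
  rw [this, LinearMap.det_toLin, Matrix.det_fin_two_of]

theorem map_planeMap_volume (h : a * d - b * c ≠ 0) :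
    Measure.map (planeMap a b c d) volume =
      ENNReal.ofReal |(a * d - b * c)⁻¹| • (volume : Measure (ℝ × ℝ)) := by
  have := Measure.map_linearMap_addHaar_eq_smul_addHaar (volume : Measure (ℝ × ℝ))
    (f := (planeMap a b c d : ℝ × ℝ →ₗ[ℝ] ℝ × ℝ)) (by rwa [det_planeMap])
  rwa [det_planeMap] at this

theorem planeMap_leftInverse (h : a * d - b * c ≠ 0) (p : ℝ × ℝ) :
    planeMap (d / (a * d - b * c)) (-b / (a * d - b * c)) (-c / (a * d - b * c))
      (a / (a * d - b * c)) (planeMap a b c d p) = p := by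
  obtain ⟨D, hD⟩ : ∃ D, D = a * d - b * c := ⟨_, rfl⟩
  rw [← hD] at h ⊢
  ext <;> simp only [planeMap_apply] <;> field_simp <;> rw [hD] <;> ring

theorem planeMap_rightInverse (h : a * d - b * c ≠ 0) (p : ℝ × ℝ) :
    planeMap a b c d (planeMap (d / (a * d - b * c)) (-b / (a * d - b * c))
      (-c / (a * d - b * c)) (a / (a * d - b * c)) p) = p := by
  obtain ⟨D, hD⟩ : ∃ D, D = a * d - b * c := ⟨_, rfl⟩
  rw [← hD] at h ⊢
  ext <;> simp only [planeMap_apply] <;> field_simp <;> rw [hD] <;> ring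

/-- The affine automorphism `p ↦ q + planeMap a b c d p` of the plane. -/
def planeAffine (q : ℝ × ℝ) (h : a * d - b * c ≠ 0) : ℝ × ℝ ≃ₜ ℝ × ℝ where
  toFun p := q + planeMap a b c d p
  invFun p := planeMap (d / (a * d - b * c)) (-b / (a * d - b * c)) (-c / (a * d - b * c))
      (a / (a * d - b * c)) (p - q)
  left_inv p := by
    beta_reduce
    rw [add_sub_cancel_left, planeMap_leftInverse h]
  right_inv p := by
    beta_reduce
    rw [planeMap_rightInverse h, add_sub_cancel]
  continuous_toFun := by fun_prop
  continuous_invFun := by fun_prop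

theorem map_planeAffine_volume (q : ℝ × ℝ) (h : a * d - b * c ≠ 0) :
    Measure.map (planeAffine q h) volume =
      ENNReal.ofReal |(a * d - b * c)⁻¹| • (volume : Measure (ℝ × ℝ)) := by
  have : ⇑(planeAffine q h) = (fun p => q + p) ∘ planeMap a b c d := rfl
  rw [this, ← Measure.map_map (by fun_prop) (by fun_prop), map_planeMap_volume h,
    Measure.map_smul, map_add_left_eq_self]

theorem integral_planeAffine (q : ℝ × ℝ) (h : a * d - b * c ≠ 0) (F : ℝ × ℝ → ℝ) :
    ∫ p, F (q + planeMap a b c d p) = |a * d - b * c|⁻¹ * ∫ p, F p := by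
  have := (planeAffine q h).measurableEmbedding.integral_map (μ := volume) F
  rw [map_planeAffine_volume, integral_smul_measure, ENNReal.toReal_ofReal (abs_nonneg _),
    smul_eq_mul, abs_inv] at this
  exact this.symm

theorem lineDeriv_comp_planeAffine (u : ℝ × ℝ → ℝ) (q p v : ℝ × ℝ) :
    lineDeriv ℝ (fun p => u (q + planeMap a b c d p)) p v =
      lineDeriv ℝ u (q + planeMap a b c d p) (planeMap a b c d v) := by
  simp only [lineDeriv, map_add, map_smul, add_assoc]

theorem sqNorm_comp_planeAffine (q : ℝ × ℝ) (h : a * d - b * c ≠ 0) (u : ℝ × ℝ → ℝ) :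
    sqNorm (fun p => u (q + planeMap a b c d p)) = |a * d - b * c|⁻¹ * sqNorm u :=
  integral_planeAffine q h fun p => u p ^ 2

theorem dirEnergy_comp_planeAffine (q : ℝ × ℝ) (h : a * d - b * c ≠ 0) (u : ℝ × ℝ → ℝ)
    (v : ℝ × ℝ) : dirEnergy (fun p => u (q + planeMap a b c d p)) v =
      |a * d - b * c|⁻¹ * dirEnergy u (planeMap a b c d v) := by
  simp only [dirEnergy, lineDeriv_comp_planeAffine]
  exact integral_planeAffine q h fun p => lineDeriv ℝ u p (planeMap a b c d v) ^ 2

theorem IsAdmissible.comp_planeAffine {u : ℝ × ℝ → ℝ} (hu : IsAdmissible u) (q : ℝ × ℝ)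
    (h : a * d - b * c ≠ 0) : IsAdmissible fun p => u (q + planeMap a b c d p) where
  lipschitz := by
    obtain ⟨C, hC⟩ := hu.lipschitz
    have := (hC.comp (isometry_add_left q).lipschitz).comp (planeMap a b c d).lipschitz
    exact ⟨_, this⟩
  compact := hu.compact.comp_homeomorph (planeAffine q h)
  nonneg _ := hu.nonneg _

end AffineChange

section IntervalGap

open Filter Topology
open scoped NNReal

theorem cos_half_pi_clamp (s : ℝ) (hs : 1 ≤ |s|) :
    Real.cos (Real.pi / 2 * max (-1) (min s 1)) = 0 := by
  rcases le_abs.1 hs with h | h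
  · rw [min_eq_right h, max_eq_right (by norm_num), mul_one, Real.cos_pi_div_two]
  · rw [min_eq_left (by linarith), max_eq_left (by linarith), mul_neg_one, Real.cos_neg,
      Real.cos_pi_div_two]

theorem lipschitzWith_cos_clamp :
    ∃ C, LipschitzWith C fun s : ℝ => Real.cos (Real.pi / 2 * max (-1) (min s 1)) := by
  have h1 : LipschitzWith 1 fun s : ℝ => max (-1 : ℝ) (min s 1) :=
    (LipschitzWith.id.min_const 1).const_max (-1)
  have h2 := lipschitzWith_smul (α := ℝ) (β := ℝ) (Real.pi / 2)
  exact ⟨_, Real.lipschitzWith_cos.comp (h2.comp h1)⟩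

theorem integral_sq_le_of_vanish_at_zero {h : ℝ → ℝ} {C : ℝ≥0} (hh : LipschitzWith C h)
    (h0 : h 0 = 0) (hs : ∀ s, 1 ≤ |s| → h s = 0) :
    Real.pi ^ 2 * ∫ s, h s ^ 2 ≤ ∫ s, deriv h s ^ 2 := by
  have half : ∀ {k : ℝ → ℝ} {C : ℝ≥0} (ε : ℝ), LipschitzWith C k →
      (∀ s, k s ≠ 0 → |2 * s - ε| < 1) →
      Real.pi ^ 2 * ∫ s, k s ^ 2 ≤ ∫ s, deriv k s ^ 2 ∧ Integrable (fun s => k s ^ 2) ∧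
        Integrable fun s => deriv k s ^ 2 := by
    intro k C ε hk hks
    have hc : HasCompactSupport k := by
      refine HasCompactSupport.intro (isCompact_Icc (a := (ε - 1) / 2) (b := (ε + 1) / 2))
        fun s hs => ?_
      by_contra h
      have := abs_lt.1 (hks s h)
      exact hs ⟨by linarith, by linarith⟩
    have h1 := poincare_slab (μ := volume) hk hc (v := (1 / 2 : ℝ))
      ((2 : ℝ) • ContinuousLinearMap.id ℝ ℝ) (by simp) ε hks
    have h2 : ∀ s, lineDeriv ℝ k s (1 / 2) = 1 / 2 * deriv k s := by
      intro s
      have : (1 / 2 : ℝ) = (1 / 2 : ℝ) • (1 : ℝ) := by simp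
      rw [this, lineDeriv_smul, lineDeriv, smul_eq_mul, smul_eq_mul, mul_one]
      congr 1
      simpa using deriv_comp_const_add k s 0
    have h3 : Integrable fun s => deriv k s ^ 2 := by
      have := (integrable_lineDeriv_sq (μ := volume) hk hc (1 / 2)).const_mul 4
      refine this.congr (Eventually.of_forall fun s => ?_)
      simp only [h2]
      ring
    refine ⟨?_, ?_, h3⟩
    · simp only [h2, mul_pow] at h1
      rw [integral_const_mul] at h1
      linarith
    · have := (hk.continuous.mul hk.continuous).integrable_of_hasCompactSupport
        (μ := volume) hc.mul_left
      simp only [sq]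
      exact this
  have hlip : ∀ {k : ℝ → ℝ}, LipschitzWith 1 k → LipschitzWith (C * 1) fun s => h (k s) :=
    fun hk => hh.comp hk
  obtain ⟨a1, a2, a3⟩ := half 1 (hlip (LipschitzWith.id.max_const 0)) (fun s hs' => by
    simp only [id] at hs'
    have p1 : 0 < s := by
      by_contra! hcon
      rw [max_eq_right hcon, h0] at hs'
      exact hs' rfl
    rw [max_eq_left p1.le] at hs'
    have p2 : |s| < 1 := by
      by_contra! hcon
      exact hs' (hs s hcon)
    have := abs_lt.1 p2
    rw [abs_lt]
    constructor <;> linarith)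
  obtain ⟨b1, b2, b3⟩ := half (-1) (hlip (LipschitzWith.id.min_const 0)) (fun s hs' => by
    simp only [id] at hs'
    have p1 : s < 0 := by
      by_contra! hcon
      rw [min_eq_right hcon, h0] at hs'
      exact hs' rfl
    rw [min_eq_left p1.le] at hs'
    have p2 : |s| < 1 := by
      by_contra! hcon
      exact hs' (hs s hcon)
    have := abs_lt.1 p2
    rw [abs_lt]
    constructor <;> linarith)
  simp only [id] at a1 a2 a3 b1 b2 b3
  have e1 : ∫ s, h s ^ 2 = (∫ s, h (max s 0) ^ 2) + ∫ s, h (min s 0) ^ 2 := by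
    rw [← integral_add a2 b2]
    refine integral_congr_ae (Eventually.of_forall fun s => ?_)
    rcases le_total s 0 with h' | h' <;> simp [h', h0]
  have e2 : ∫ s, deriv h s ^ 2 =
      (∫ s, deriv (fun s => h (max s 0)) s ^ 2) + ∫ s, deriv (fun s => h (min s 0)) s ^ 2 := by
    rw [← integral_add a3 b3]
    refine integral_congr_ae ?_
    filter_upwards [Measure.ae_ne volume (0 : ℝ)] with s hs
    rcases hs.lt_or_gt with h' | h'
    · have i1 : (fun s => h (max s 0)) =ᶠ[𝓝 s] fun _ => 0 := by
        filter_upwards [Iio_mem_nhds h'] with x hx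
        rw [max_eq_right (le_of_lt hx), h0]
      have i2 : (fun s => h (min s 0)) =ᶠ[𝓝 s] h := by
        filter_upwards [Iio_mem_nhds h'] with x hx
        rw [min_eq_left (le_of_lt hx)]
      rw [i1.deriv_eq, i2.deriv_eq]
      simp
    · have i1 : (fun s => h (min s 0)) =ᶠ[𝓝 s] fun _ => 0 := by
        filter_upwards [Ioi_mem_nhds h'] with x hx
        rw [min_eq_right (le_of_lt hx), h0]
      have i2 : (fun s => h (max s 0)) =ᶠ[𝓝 s] h := by
        filter_upwards [Ioi_mem_nhds h'] with x hx
        rw [max_eq_left (le_of_lt hx)]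
      rw [i1.deriv_eq, i2.deriv_eq]
      simp
  rw [e1, e2]
  linarith

theorem integral_cos_sq_interval :
    ∫ s in (-1 : ℝ)..1, Real.cos (Real.pi / 2 * s) ^ 2 = 1 := by
  have hπ := Real.pi_pos
  rw [intervalIntegral.integral_comp_mul_left (fun s => Real.cos s ^ 2) (by positivity),
    integral_cos_sq]
  simp [Real.sin_neg, Real.cos_neg]

theorem integral_sin_sq_interval :
    ∫ s in (-1 : ℝ)..1, Real.sin (Real.pi / 2 * s) ^ 2 = 1 := by
  have hπ := Real.pi_pos
  rw [intervalIntegral.integral_comp_mul_left (fun s => Real.sin s ^ 2) (by positivity),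
    integral_sin_sq]
  simp [Real.sin_neg, Real.cos_neg]

/-- The spectral gap of the interval `(-1, 1)` with Dirichlet conditions. -/
theorem interval_gap {f : ℝ → ℝ} {C : ℝ≥0} (hf : LipschitzWith C f)
    (hs : ∀ s, 1 ≤ |s| → f s = 0) :
    Real.pi ^ 2 * (∫ s in Icc (-1 : ℝ) 1, f s ^ 2) -
      3 / 4 * Real.pi ^ 2 * (∫ s in Icc (-1 : ℝ) 1, f s * Real.cos (Real.pi / 2 * s)) ^ 2 ≤
      ∫ s, deriv f s ^ 2 := by
  have hc : HasCompactSupport f := by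
    refine HasCompactSupport.intro (isCompact_Icc (a := (-1 : ℝ)) (b := 1)) fun s h => ?_
    refine hs s ?_
    by_contra! hcon
    have := abs_lt.1 hcon
    exact h ⟨this.1.le, this.2.le⟩
  obtain ⟨D, hD⟩ := lipschitzWith_cos_clamp
  have hld : ∀ s, lineDeriv ℝ f s 1 = deriv f s := by
    intro s
    simpa [lineDeriv] using deriv_comp_const_add f s 0
  set h : ℝ → ℝ := fun s => f s - f 0 * Real.cos (Real.pi / 2 * max (-1) (min s 1)) with hh
  have hlip : ∃ C', LipschitzWith C' h := by
    have h2 := lipschitzWith_smul (α := ℝ) (β := ℝ) (f 0)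
    exact ⟨_, hf.sub (h2.comp hD)⟩
  obtain ⟨C', hC'⟩ := hlip
  have hout : ∀ s, 1 ≤ |s| → h s = 0 := by
    intro s h1
    simp only [hh, hs s h1, cos_half_pi_clamp s h1, mul_zero, sub_zero]
  have h1 := integral_sq_le_of_vanish_at_zero hC' (by simp [hh]) hout
  have hin : ∀ s ∈ Ioo (-1 : ℝ) 1, h =ᶠ[𝓝 s] fun s => f s - f 0 * Real.cos (Real.pi / 2 * s) := by
    intro s hs'
    filter_upwards [Ioo_mem_nhds hs'.1 hs'.2] with x hx
    simp only [hh]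
    rw [min_eq_left hx.2.le, max_eq_right hx.1.le]
  have hzero : ∀ {k : ℝ → ℝ}, (∀ s, 1 ≤ |s| → k s = 0) → ∀ᵐ s, s ∉ Ioc (-1 : ℝ) 1 →
      deriv k s = 0 := by
    intro k hk
    filter_upwards [Measure.ae_ne volume (-1 : ℝ)] with s hs1 hs'
    have : s < -1 ∨ 1 < s := by
      by_contra! hcon
      exact hs' ⟨hcon.1.lt_of_ne' hs1, hcon.2⟩
    have e : k =ᶠ[𝓝 s] fun _ => 0 := by
      rcases this with h | h
      · filter_upwards [Iio_mem_nhds h] with x hx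
        exact hk x (by rw [abs_of_neg (by linarith [mem_Iio.1 hx])]; linarith [mem_Iio.1 hx])
      · filter_upwards [Ioi_mem_nhds h] with x hx
        exact hk x (by rw [abs_of_pos (by linarith [mem_Ioi.1 hx])]; linarith [mem_Ioi.1 hx])
    rw [e.deriv_eq]
    simp
  have hzero' : ∀ {k : ℝ → ℝ}, (∀ s, 1 ≤ |s| → k s = 0) → ∀ s, s ∉ Ioc (-1 : ℝ) 1 → k s = 0 := by
    intro k hk s hs'
    refine hk s ?_
    by_contra! hcon
    have := abs_lt.1 hcon
    exact hs' ⟨this.1, this.2.le⟩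
  have toInt : ∀ {k : ℝ → ℝ}, (∀ᵐ s, s ∉ Ioc (-1 : ℝ) 1 → k s = 0) →
      ∫ s, k s = ∫ s in (-1 : ℝ)..1, k s := by
    intro k hk
    rw [intervalIntegral.integral_of_le (by norm_num)]
    exact (setIntegral_eq_integral_of_ae_compl_eq_zero hk).symm
  have fin : ∀ {k : ℝ → ℝ}, Integrable k → IntervalIntegrable k volume (-1) 1 :=
    fun hk => hk.intervalIntegrable
  have ci : ∀ {k : ℝ → ℝ}, Continuous k → IntervalIntegrable k volume (-1) 1 :=
    fun hk => hk.intervalIntegrable _ _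
  have hfc := hf.continuous
  have ae01 : ∀ {k l : ℝ → ℝ}, (∀ s ∈ Ioo (-1 : ℝ) 1, k s = l s) →
      ∫ s in (-1 : ℝ)..1, k s = ∫ s in (-1 : ℝ)..1, l s := by
    intro k l hkl
    refine intervalIntegral.integral_congr_ae ?_
    filter_upwards [Measure.ae_ne volume (1 : ℝ)] with s hs1 hs'
    rw [uIoc_of_le (by norm_num)] at hs'
    exact hkl s ⟨hs'.1, hs'.2.lt_of_ne hs1⟩
  have dsq : IntervalIntegrable (fun s => deriv f s ^ 2) volume (-1) 1 := by
    have := integrable_lineDeriv_sq (μ := volume) hf hc 1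
    simp only [hld] at this
    exact fin this
  have dsin : IntervalIntegrable (fun s => deriv f s * Real.sin (Real.pi / 2 * s)) volume (-1) 1 := by
    have := integrable_lineDeriv_mul (μ := volume) hf hc 1
      (f := fun s => Real.sin (Real.pi / 2 * s)) (by fun_prop)
    simp only [hld] at this
    exact fin this
  have hibp : ∫ s in (-1 : ℝ)..1, deriv f s * Real.sin (Real.pi / 2 * s) =
      -(Real.pi / 2) * ∫ s in (-1 : ℝ)..1, f s * Real.cos (Real.pi / 2 * s) := by
    have := integral_lineDeriv_mul_eq_neg (μ := volume) hf hc 1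
      (f := fun s => Real.sin (Real.pi / 2 * s)) (by fun_prop)
    have hd : ∀ s, lineDeriv ℝ (fun s => Real.sin (Real.pi / 2 * s)) s 1 =
        Real.pi / 2 * Real.cos (Real.pi / 2 * s) := by
      intro s
      have e : HasDerivAt (fun s => Real.sin (Real.pi / 2 * s))
          (Real.cos (Real.pi / 2 * s) * (Real.pi / 2 * 1)) s :=
        ((hasDerivAt_id s).const_mul (Real.pi / 2)).sin
      have e' : lineDeriv ℝ (fun s => Real.sin (Real.pi / 2 * s)) s 1 =
          deriv (fun s => Real.sin (Real.pi / 2 * s)) s := by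
        simpa [lineDeriv] using deriv_comp_const_add (fun s => Real.sin (Real.pi / 2 * s)) s 0
      rw [e', e.deriv]
      ring
    simp only [hld, hd] at this
    rw [toInt (by
      filter_upwards [hzero hs] with s h1 h2
      rw [h1 h2, zero_mul]), toInt (Eventually.of_forall fun s h2 => by
        rw [hzero' hs s h2, zero_mul])] at this
    rw [this, neg_mul, ← intervalIntegral.integral_const_mul]
    congr 2
    ext s
    ring
  have E1 : ∫ s, h s ^ 2 = (∫ s in (-1 : ℝ)..1, f s ^ 2) -
      2 * f 0 * (∫ s in (-1 : ℝ)..1, f s * Real.cos (Real.pi / 2 * s)) + f 0 ^ 2 := by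
    rw [toInt (Eventually.of_forall fun s h2 => by rw [hzero' hout s h2]; ring),
      ae01 (l := fun s => f s ^ 2 - 2 * f 0 * (f s * Real.cos (Real.pi / 2 * s)) +
        f 0 ^ 2 * Real.cos (Real.pi / 2 * s) ^ 2) (fun s hs' => by
          rw [(hin s hs').self_of_nhds]; ring),
      intervalIntegral.integral_add (ci (by fun_prop)) (ci (by fun_prop)),
      intervalIntegral.integral_sub (ci (by fun_prop)) (ci (by fun_prop)),
      intervalIntegral.integral_const_mul, intervalIntegral.integral_const_mul,
      integral_cos_sq_interval, mul_one]
  have E2 : ∫ s, deriv h s ^ 2 = (∫ s, deriv f s ^ 2) -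
      f 0 * Real.pi ^ 2 / 2 * (∫ s in (-1 : ℝ)..1, f s * Real.cos (Real.pi / 2 * s)) +
      (f 0 * Real.pi / 2) ^ 2 := by
    rw [toInt (k := fun s => deriv h s ^ 2) (by
        filter_upwards [hzero hout] with s h1 h2
        rw [h1 h2]; ring),
      toInt (k := fun s => deriv f s ^ 2) (by
        filter_upwards [hzero hs] with s h1 h2
        rw [h1 h2]; ring)]
    have step : ∫ s in (-1 : ℝ)..1, deriv h s ^ 2 = ∫ s in (-1 : ℝ)..1, (deriv f s ^ 2 +
        f 0 * Real.pi * (deriv f s * Real.sin (Real.pi / 2 * s)) +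
        (f 0 * Real.pi / 2) ^ 2 * Real.sin (Real.pi / 2 * s) ^ 2) := by
      refine intervalIntegral.integral_congr_ae ?_
      filter_upwards [Measure.ae_ne volume (1 : ℝ), hf.ae_differentiableAt_of_real] with s hs1 hd hs'
      rw [uIoc_of_le (by norm_num)] at hs'
      rw [(hin s ⟨hs'.1, hs'.2.lt_of_ne hs1⟩).deriv_eq]
      have e : HasDerivAt (fun s => Real.cos (Real.pi / 2 * s))
          (-Real.sin (Real.pi / 2 * s) * (Real.pi / 2 * 1)) s :=
        ((hasDerivAt_id s).const_mul (Real.pi / 2)).cos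
      rw [(hd.hasDerivAt.fun_sub (e.const_mul (f 0))).deriv]
      ring
    rw [step, intervalIntegral.integral_add (dsq.add (dsin.const_mul _)) (ci (by fun_prop)),
      intervalIntegral.integral_add dsq (dsin.const_mul _),
      intervalIntegral.integral_const_mul, intervalIntegral.integral_const_mul,
      integral_sin_sq_interval, hibp]
    ring
  rw [E1, E2] at h1
  rw [integral_Icc_eq_integral_Ioc, integral_Icc_eq_integral_Ioc,
    ← intervalIntegral.integral_of_le (by norm_num), ← intervalIntegral.integral_of_le (by norm_num)]
  generalize (∫ s in (-1 : ℝ)..1, f s * Real.cos (Real.pi / 2 * s)) = p at h1 ⊢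
  nlinarith [mul_nonneg (sq_nonneg Real.pi) (sq_nonneg (p - f 0))]

end IntervalGap

section SquareGap

open Filter Topology
open scoped NNReal

theorem integral_square_eq_iterated {F : ℝ × ℝ → ℝ} (hF : Continuous F) :
    ∫ p in Icc (-1 : ℝ) 1 ×ˢ Icc (-1 : ℝ) 1, F p =
      ∫ x in Icc (-1 : ℝ) 1, ∫ y in Icc (-1 : ℝ) 1, F (x, y) :=
  setIntegral_prod F (hF.continuousOn.integrableOn_compact (isCompact_Icc.prod isCompact_Icc))

theorem integral_square_eq_iterated_swap {F : ℝ × ℝ → ℝ} (hF : Continuous F) :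
    ∫ p in Icc (-1 : ℝ) 1 ×ˢ Icc (-1 : ℝ) 1, F p =
      ∫ y in Icc (-1 : ℝ) 1, ∫ x in Icc (-1 : ℝ) 1, F (x, y) := by
  refine (setIntegral_prod_swap (μ := volume) (ν := volume) (Icc (-1 : ℝ) 1) (Icc (-1 : ℝ) 1)
    F).symm.trans ?_
  exact setIntegral_prod _ ((hF.comp continuous_swap).continuousOn.integrableOn_compact
    (isCompact_Icc.prod isCompact_Icc))

theorem integral_square_mul (f g : ℝ → ℝ) :
    ∫ p in Icc (-1 : ℝ) 1 ×ˢ Icc (-1 : ℝ) 1, f p.1 * g p.2 =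
      (∫ x in Icc (-1 : ℝ) 1, f x) * ∫ y in Icc (-1 : ℝ) 1, g y :=
  setIntegral_prod_mul f g _ _

theorem integral_square_add {F G : ℝ × ℝ → ℝ} (hF : Continuous F) (hG : Continuous G) :
    ∫ p in Icc (-1 : ℝ) 1 ×ˢ Icc (-1 : ℝ) 1, (F p + G p) =
      (∫ p in Icc (-1 : ℝ) 1 ×ˢ Icc (-1 : ℝ) 1, F p) +
        ∫ p in Icc (-1 : ℝ) 1 ×ˢ Icc (-1 : ℝ) 1, G p :=
  integral_add (hF.continuousOn.integrableOn_compact (isCompact_Icc.prod isCompact_Icc))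
    (hG.continuousOn.integrableOn_compact (isCompact_Icc.prod isCompact_Icc))

theorem integral_Icc_cos_sq : ∫ s in Icc (-1 : ℝ) 1, Real.cos (Real.pi / 2 * s) ^ 2 = 1 := by
  rw [integral_Icc_eq_integral_Ioc, ← intervalIntegral.integral_of_le (by norm_num),
    integral_cos_sq_interval]

theorem integral_Icc_sin_sq : ∫ s in Icc (-1 : ℝ) 1, Real.sin (Real.pi / 2 * s) ^ 2 = 1 := by
  rw [integral_Icc_eq_integral_Ioc, ← intervalIntegral.integral_of_le (by norm_num),
    integral_sin_sq_interval]

theorem integral_Icc_cos_mul_sin :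
    ∫ s in Icc (-1 : ℝ) 1, Real.cos (Real.pi / 2 * s) * Real.sin (Real.pi / 2 * s) = 0 := by
  rw [integral_Icc_eq_integral_Ioc, ← intervalIntegral.integral_of_le (by norm_num)]
  have h := intervalIntegral.integral_comp_neg (a := -1) (b := 1)
    (fun s : ℝ => Real.cos (Real.pi / 2 * s) * Real.sin (Real.pi / 2 * s))
  simp only [mul_neg, Real.cos_neg, Real.sin_neg, neg_neg, intervalIntegral.integral_neg] at h
  linarith

/-- Inclusion-exclusion for the two commuting projections onto functions proportional to
`cos (π s / 2)` in one of the variables. -/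
theorem sum_projections_le {W : ℝ × ℝ → ℝ} (hW : Continuous W) :
    (∫ y in Icc (-1 : ℝ) 1, (∫ x in Icc (-1 : ℝ) 1, W (x, y) * Real.cos (Real.pi / 2 * x)) ^ 2) +
      (∫ x in Icc (-1 : ℝ) 1, (∫ y in Icc (-1 : ℝ) 1, W (x, y) * Real.cos (Real.pi / 2 * y)) ^ 2) ≤
      (∫ p in Icc (-1 : ℝ) 1 ×ˢ Icc (-1 : ℝ) 1, W p ^ 2) +
        (∫ p in Icc (-1 : ℝ) 1 ×ˢ Icc (-1 : ℝ) 1,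
          W p * (Real.cos (Real.pi / 2 * p.1) * Real.cos (Real.pi / 2 * p.2))) ^ 2 := by
  obtain ⟨c, hcdef⟩ : ∃ c : ℝ → ℝ, c = fun s => Real.cos (Real.pi / 2 * s) := ⟨_, rfl⟩
  have hc : Continuous c := by rw [hcdef]; fun_prop
  have hc2 : ∫ s in Icc (-1 : ℝ) 1, c s ^ 2 = 1 := by rw [hcdef]; exact integral_Icc_cos_sq
  have hcs : ∀ s, Real.cos (Real.pi / 2 * s) = c s := fun s => by rw [hcdef]
  simp only [hcs]
  obtain ⟨P, hP⟩ : ∃ P : ℝ → ℝ, P = fun y => ∫ x in Icc (-1 : ℝ) 1, W (x, y) * c x := ⟨_, rfl⟩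
  obtain ⟨Q, hQ⟩ : ∃ Q : ℝ → ℝ, Q = fun x => ∫ y in Icc (-1 : ℝ) 1, W (x, y) * c y := ⟨_, rfl⟩
  have hPc : Continuous P := by
    rw [hP]
    exact continuous_parametric_integral_of_continuous (f := fun y x => W (x, y) * c x)
      (by fun_prop) isCompact_Icc
  have hQc : Continuous Q := by
    rw [hQ]
    exact continuous_parametric_integral_of_continuous (f := fun x y => W (x, y) * c y)
      (by fun_prop) isCompact_Icc
  have hPs : ∀ y, ∫ x in Icc (-1 : ℝ) 1, W (x, y) * c x = P y := fun y => by rw [hP]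
  have hQs : ∀ x, ∫ y in Icc (-1 : ℝ) 1, W (x, y) * c y = Q x := fun x => by rw [hQ]
  simp only [hPs, hQs]
  set S := Icc (-1 : ℝ) 1 ×ˢ Icc (-1 : ℝ) 1 with hS
  have a1 : ∫ p in S, W p * c p.1 * P p.2 = ∫ y in Icc (-1 : ℝ) 1, P y ^ 2 := by
    rw [integral_square_eq_iterated_swap (by fun_prop)]
    simp only [integral_mul_const, hPs, sq]
  have a2 : ∫ p in S, W p * c p.2 * Q p.1 = ∫ x in Icc (-1 : ℝ) 1, Q x ^ 2 := by
    rw [integral_square_eq_iterated (by fun_prop)]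
    simp only [integral_mul_const, hQs, sq]
  set m := ∫ p in S, W p * (c p.1 * c p.2) with hm
  have a3 : ∫ y in Icc (-1 : ℝ) 1, P y * c y = m := by
    rw [hm, integral_square_eq_iterated_swap (by fun_prop)]
    simp only [← mul_assoc, integral_mul_const, hPs]
  have a4 : ∫ x in Icc (-1 : ℝ) 1, Q x * c x = m := by
    rw [hm, integral_square_eq_iterated (by fun_prop)]
    simp only [fun x y => (by ring : W (x, y) * (c x * c y) = W (x, y) * c y * c x),
      integral_mul_const, hQs]
  have b1 : ∫ p in S, c p.1 ^ 2 * P p.2 ^ 2 = ∫ y in Icc (-1 : ℝ) 1, P y ^ 2 := by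
    rw [integral_square_mul (fun x => c x ^ 2) (fun y => P y ^ 2), hc2, one_mul]
  have b2 : ∫ p in S, Q p.1 ^ 2 * c p.2 ^ 2 = ∫ x in Icc (-1 : ℝ) 1, Q x ^ 2 := by
    rw [integral_square_mul (fun x => Q x ^ 2) (fun y => c y ^ 2), hc2, mul_one]
  have b3 : ∫ p in S, c p.1 ^ 2 * c p.2 ^ 2 = 1 := by
    rw [integral_square_mul (fun x => c x ^ 2) (fun y => c y ^ 2), hc2, mul_one]
  have b4 : ∫ p in S, (Q p.1 * c p.1) * (P p.2 * c p.2) = m * m := by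
    rw [integral_square_mul (fun x => Q x * c x) (fun y => P y * c y), a3, a4]
  have b5 : ∫ p in S, c p.1 ^ 2 * (P p.2 * c p.2) = m := by
    rw [integral_square_mul (fun x => c x ^ 2) (fun y => P y * c y), hc2, a3, one_mul]
  have b6 : ∫ p in S, (Q p.1 * c p.1) * c p.2 ^ 2 = m := by
    rw [integral_square_mul (fun x => Q x * c x) (fun y => c y ^ 2), hc2, a4, mul_one]
  have key : 0 ≤ ∫ p in S, (W p - c p.1 * P p.2 - Q p.1 * c p.2 + m * (c p.1 * c p.2)) ^ 2 :=
    integral_nonneg fun p => sq_nonneg _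
  have exp : ∀ p : ℝ × ℝ, (W p - c p.1 * P p.2 - Q p.1 * c p.2 + m * (c p.1 * c p.2)) ^ 2 =
      W p ^ 2 + c p.1 ^ 2 * P p.2 ^ 2 + Q p.1 ^ 2 * c p.2 ^ 2 +
        m ^ 2 * (c p.1 ^ 2 * c p.2 ^ 2) + (-2) * (W p * c p.1 * P p.2) +
        (-2) * (W p * c p.2 * Q p.1) + (2 * m) * (W p * (c p.1 * c p.2)) +
        2 * ((Q p.1 * c p.1) * (P p.2 * c p.2)) + (-2 * m) * (c p.1 ^ 2 * (P p.2 * c p.2)) +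
        (-2 * m) * ((Q p.1 * c p.1) * c p.2 ^ 2) := fun p => by ring
  simp only [exp] at key
  iterate 9 rw [integral_square_add (by fun_prop) (by fun_prop)] at key
  simp only [← hS, integral_const_mul, a1, a2, b1, b2, b3, b4, b5, b6, ← hm] at key
  linarith

theorem sq_cos_cos_add_sq_sin_sin_le {W : ℝ × ℝ → ℝ} (hW : Continuous W) :
    (∫ p in Icc (-1 : ℝ) 1 ×ˢ Icc (-1 : ℝ) 1,
        W p * (Real.cos (Real.pi / 2 * p.1) * Real.cos (Real.pi / 2 * p.2))) ^ 2 +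
      (∫ p in Icc (-1 : ℝ) 1 ×ˢ Icc (-1 : ℝ) 1,
        W p * (Real.sin (Real.pi / 2 * p.1) * Real.sin (Real.pi / 2 * p.2))) ^ 2 ≤
      ∫ p in Icc (-1 : ℝ) 1 ×ˢ Icc (-1 : ℝ) 1, W p ^ 2 := by
  obtain ⟨c, hc⟩ : ∃ c : ℝ → ℝ, c = fun s => Real.cos (Real.pi / 2 * s) := ⟨_, rfl⟩
  obtain ⟨s, hs⟩ : ∃ s : ℝ → ℝ, s = fun x => Real.sin (Real.pi / 2 * x) := ⟨_, rfl⟩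
  have hcc : Continuous c := by rw [hc]; fun_prop
  have hsc : Continuous s := by rw [hs]; fun_prop
  have c2 : ∫ x in Icc (-1 : ℝ) 1, c x ^ 2 = 1 := by rw [hc]; exact integral_Icc_cos_sq
  have s2 : ∫ x in Icc (-1 : ℝ) 1, s x ^ 2 = 1 := by rw [hs]; exact integral_Icc_sin_sq
  have cs : ∫ x in Icc (-1 : ℝ) 1, c x * s x = 0 := by
    rw [hc, hs]; exact integral_Icc_cos_mul_sin
  have hcs : ∀ x, Real.cos (Real.pi / 2 * x) = c x := fun x => by rw [hc]
  have hss : ∀ x, Real.sin (Real.pi / 2 * x) = s x := fun x => by rw [hs]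
  simp only [hcs, hss]
  set S := Icc (-1 : ℝ) 1 ×ˢ Icc (-1 : ℝ) 1 with hS
  set m := ∫ p in S, W p * (c p.1 * c p.2) with hm
  set n := ∫ p in S, W p * (s p.1 * s p.2) with hn
  have b1 : ∫ p in S, c p.1 ^ 2 * c p.2 ^ 2 = 1 := by
    rw [integral_square_mul (fun x => c x ^ 2) (fun y => c y ^ 2), c2, mul_one]
  have b2 : ∫ p in S, s p.1 ^ 2 * s p.2 ^ 2 = 1 := by
    rw [integral_square_mul (fun x => s x ^ 2) (fun y => s y ^ 2), s2, mul_one]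
  have b3 : ∫ p in S, c p.1 * s p.1 * (c p.2 * s p.2) = 0 := by
    rw [integral_square_mul (fun x => c x * s x) (fun y => c y * s y), cs, mul_zero]
  have key : 0 ≤ ∫ p in S, (W p - m * (c p.1 * c p.2) - n * (s p.1 * s p.2)) ^ 2 :=
    integral_nonneg fun p => sq_nonneg _
  have exp : ∀ p : ℝ × ℝ, (W p - m * (c p.1 * c p.2) - n * (s p.1 * s p.2)) ^ 2 =
      W p ^ 2 + m ^ 2 * (c p.1 ^ 2 * c p.2 ^ 2) + n ^ 2 * (s p.1 ^ 2 * s p.2 ^ 2) +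
        (-2 * m) * (W p * (c p.1 * c p.2)) + (-2 * n) * (W p * (s p.1 * s p.2)) +
        (2 * m * n) * (c p.1 * s p.1 * (c p.2 * s p.2)) := fun p => by ring
  simp only [exp] at key
  iterate 5 rw [integral_square_add (by fun_prop) (by fun_prop)] at key
  simp only [← hS, integral_const_mul, b1, b2, b3, ← hm, ← hn] at key
  linarith

end SquareGap

section SquareStability

open Filter Topology
open scoped NNReal

variable {W : ℝ × ℝ → ℝ}

theorem square_gap_slices (hW : IsAdmissible W)
    (hs : ∀ p, W p ≠ 0 → |p.1| < 1 ∧ |p.2| < 1) :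
    Real.pi ^ 2 * (∫ p in Icc (-1 : ℝ) 1 ×ˢ Icc (-1 : ℝ) 1, W p ^ 2) - 3 / 4 * Real.pi ^ 2 *
      (∫ y in Icc (-1 : ℝ) 1, (∫ x in Icc (-1 : ℝ) 1, W (x, y) * Real.cos (Real.pi / 2 * x)) ^ 2) ≤
      dirEnergy W (1, 0) := by
  obtain ⟨C, hC⟩ := hW.lipschitz
  have hWc := hC.continuous
  have hslice : ∀ y, LipschitzWith C fun x => W (x, y) := fun y => by
    simpa [Function.comp_def] using hC.comp (LipschitzWith.prodMk_right y)
  have hld : ∀ x y, lineDeriv ℝ W (x, y) (1, 0) = deriv (fun x => W (x, y)) x := by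
    intro x y
    have := deriv_comp_const_add (fun x => W (x, y)) x 0
    simpa [lineDeriv] using this
  have hint : Integrable (fun p : ℝ × ℝ => lineDeriv ℝ W p (1, 0) ^ 2)
      ((volume : Measure ℝ).prod volume) := integrable_lineDeriv_sq hC hW.compact (1, 0)
  have h1 := fun y => interval_gap (hslice y) fun x hx => by
    by_contra h
    exact absurd (hs _ h).1 (not_lt.2 hx)
  have c1 : Continuous fun y => ∫ x in Icc (-1 : ℝ) 1, W (x, y) ^ 2 :=
    continuous_parametric_integral_of_continuous (f := fun y x => W (x, y) ^ 2)
      (by fun_prop) isCompact_Icc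
  have c2 : Continuous fun y => ∫ x in Icc (-1 : ℝ) 1, W (x, y) * Real.cos (Real.pi / 2 * x) :=
    continuous_parametric_integral_of_continuous
      (f := fun y x => W (x, y) * Real.cos (Real.pi / 2 * x)) (by fun_prop) isCompact_Icc
  have hr := hint.integral_prod_right
  simp only [hld] at hr
  have i1 : IntegrableOn (fun y => Real.pi ^ 2 * ∫ x in Icc (-1 : ℝ) 1, W (x, y) ^ 2)
      (Icc (-1) 1) := (c1.const_mul _).continuousOn.integrableOn_compact isCompact_Icc
  have i2 : IntegrableOn (fun y => 3 / 4 * Real.pi ^ 2 *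
      (∫ x in Icc (-1 : ℝ) 1, W (x, y) * Real.cos (Real.pi / 2 * x)) ^ 2) (Icc (-1) 1) :=
    ((c2.pow 2).const_mul _).continuousOn.integrableOn_compact isCompact_Icc
  have h2 := setIntegral_mono (i1.sub i2) hr.integrableOn h1
  have h3 := setIntegral_le_integral (s := Icc (-1 : ℝ) 1) hr
    (Eventually.of_forall fun y => integral_nonneg fun x => sq_nonneg _)
  have h4 : dirEnergy W (1, 0) = ∫ y, ∫ x, deriv (fun x => W (x, y)) x ^ 2 := by
    rw [dirEnergy, Measure.volume_eq_prod, integral_prod_symm _ hint]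
    simp only [hld]
  simp only [Pi.sub_apply] at h2
  rw [integral_sub i1 i2, integral_const_mul, integral_const_mul] at h2
  rw [h4, integral_square_eq_iterated_swap (by fun_prop)]
  linarith

/-- Nonnegative functions on the square with almost minimal Dirichlet energy are close to the
first eigenfunction. -/
theorem square_stability (hW : IsAdmissible W)
    (hs : ∀ p, W p ≠ 0 → |p.1| < 1 ∧ |p.2| < 1) {q : ℝ} (hq : 0 ≤ q)
    (hE : dirEnergy W (1, 0) + dirEnergy W (0, 1) ≤
      Real.pi ^ 2 / 2 * (1 + 3 / 2 * q ^ 2) * sqNorm W) :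
    (1 - 2 * q) * √(sqNorm W) ≤ ∫ p, W p * Real.cos (Real.pi / 2 * (p.1 - p.2)) := by
  have hπ := Real.pi_pos
  have hWc : Continuous W := hW.lipschitz.choose_spec.continuous
  have hdet : (0 : ℝ) * 0 - 1 * 1 ≠ 0 := by norm_num
  have e1 := square_gap_slices hW hs
  have e2 := square_gap_slices (hW.comp_planeAffine 0 hdet) fun p hp => by
    have := hs _ hp
    simpa [and_comm] using this
  have e3 : ∫ p in Icc (-1 : ℝ) 1 ×ˢ Icc (-1 : ℝ) 1, W (0 + planeMap 0 1 1 0 p) ^ 2 =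
      ∫ p in Icc (-1 : ℝ) 1 ×ˢ Icc (-1 : ℝ) 1, W p ^ 2 := by
    rw [integral_square_eq_iterated_swap (by fun_prop), integral_square_eq_iterated (by fun_prop)]
    simp
  rw [dirEnergy_comp_planeAffine 0 hdet, e3] at e2
  have e4 := sum_projections_le hWc
  have e5 := sq_cos_cos_add_sq_sin_sin_le hWc
  have hout : ∀ {F : ℝ × ℝ → ℝ}, (∀ p, W p = 0 → F p = 0) →
      ∫ p in Icc (-1 : ℝ) 1 ×ˢ Icc (-1 : ℝ) 1, F p = ∫ p, F p := fun hF =>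
    setIntegral_eq_integral_of_forall_compl_eq_zero fun p hp => by
      refine hF p ?_
      by_contra h
      obtain ⟨h1, h2⟩ := hs p h
      rw [abs_lt] at h1 h2
      exact hp ⟨⟨h1.1.le, h1.2.le⟩, ⟨h2.1.le, h2.2.le⟩⟩
  have e6 : ∫ p in Icc (-1 : ℝ) 1 ×ˢ Icc (-1 : ℝ) 1, W p ^ 2 = sqNorm W :=
    hout fun p hp => by simp [hp]
  have e7 : ∫ p, W p * Real.cos (Real.pi / 2 * (p.1 - p.2)) =
      (∫ p in Icc (-1 : ℝ) 1 ×ˢ Icc (-1 : ℝ) 1,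
        W p * (Real.cos (Real.pi / 2 * p.1) * Real.cos (Real.pi / 2 * p.2))) +
      ∫ p in Icc (-1 : ℝ) 1 ×ˢ Icc (-1 : ℝ) 1,
        W p * (Real.sin (Real.pi / 2 * p.1) * Real.sin (Real.pi / 2 * p.2)) := by
    rw [← integral_square_add (by fun_prop) (by fun_prop), ← hout fun p hp => by simp [hp]]
    simp only [mul_sub, Real.cos_sub, mul_add]
  have e8 : 0 ≤ ∫ p in Icc (-1 : ℝ) 1 ×ˢ Icc (-1 : ℝ) 1,
        W p * (Real.cos (Real.pi / 2 * p.1) * Real.cos (Real.pi / 2 * p.2)) := by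
    refine setIntegral_nonneg (measurableSet_Icc.prod measurableSet_Icc) fun p hp => ?_
    have hcos : ∀ s ∈ Icc (-1 : ℝ) 1, 0 ≤ Real.cos (Real.pi / 2 * s) := fun s hs =>
      Real.cos_nonneg_of_mem_Icc ⟨by nlinarith [hs.1], by nlinarith [hs.2]⟩
    exact mul_nonneg (hW.nonneg p) (mul_nonneg (hcos _ hp.1) (hcos _ hp.2))
  rw [e7]
  rw [e6] at e1 e2 e4 e5
  simp only [planeMap_apply, zero_mul, zero_add, one_mul, mul_zero, mul_one, add_zero, zero_sub,
    abs_neg, abs_one, inv_one] at e2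
  set m := ∫ p in Icc (-1 : ℝ) 1 ×ˢ Icc (-1 : ℝ) 1,
        W p * (Real.cos (Real.pi / 2 * p.1) * Real.cos (Real.pi / 2 * p.2)) with hm
  set n := ∫ p in Icc (-1 : ℝ) 1 ×ˢ Icc (-1 : ℝ) 1,
        W p * (Real.sin (Real.pi / 2 * p.1) * Real.sin (Real.pi / 2 * p.2)) with hn
  have hN := sqNorm_nonneg (w := W)
  obtain ⟨r, hr0, hr⟩ : ∃ r, 0 ≤ r ∧ sqNorm W = r ^ 2 :=
    ⟨√(sqNorm W), Real.sqrt_nonneg _, (Real.sq_sqrt hN).symm⟩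
  rw [hr] at e1 e2 e4 e5 hE ⊢
  rw [Real.sqrt_sq hr0]
  have hp2 : (1 - q ^ 2) * r ^ 2 ≤ m ^ 2 := by
    have := mul_le_mul_of_nonneg_left e4 (sq_nonneg Real.pi)
    have h5 : Real.pi ^ 2 * ((1 - q ^ 2) * r ^ 2) ≤ Real.pi ^ 2 * m ^ 2 := by
      nlinarith
    exact le_of_mul_le_mul_left h5 (by positivity)
  have hn2 : |n| ≤ q * r := abs_le_of_sq_le_sq (by nlinarith) (by positivity)
  have hm2 : (1 - q) * r ≤ m := by
    by_cases h : q ≤ 1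
    · refine le_of_sq_le_sq ?_ e8
      nlinarith [mul_nonneg (mul_nonneg hq (sub_nonneg.2 h)) (sq_nonneg r)]
    · nlinarith
  linarith [(abs_le.1 hn2).1]

end SquareStability

section KiteStability

open Filter Topology
open scoped NNReal

variable {w : ℝ × ℝ → ℝ}

theorem dirEnergy_parallelogram (hw : IsAdmissible w) (a b : ℝ) :
    dirEnergy w (a, b) + dirEnergy w (a, -b) =
      2 * (a ^ 2 * dirEnergy w (1, 0) + b ^ 2 * dirEnergy w (0, 1)) := by
  obtain ⟨C, hC⟩ := hw.lipschitz
  have hi := integrable_lineDeriv_sq (μ := volume) hC hw.compact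
  simp only [dirEnergy]
  rw [← integral_add (hi _) (hi _), ← integral_const_mul, ← integral_const_mul,
    ← integral_add ((hi _).const_mul _) ((hi _).const_mul _), ← integral_const_mul]
  refine integral_congr_ae ?_
  filter_upwards [ae_lineDeriv_eq_combination hC] with p hp
  rw [hp a b, hp a (-b)]
  ring

theorem continuous_integral_mul_cos (hw : IsAdmissible w) :
    Continuous fun k : ℝ => ∫ p, w p * Real.cos (k * p.2) := by
  have hc : Continuous w := hw.lipschitz.choose_spec.continuous
  have h := continuous_parametric_integral_of_continuous (μ := volume)
    (f := fun (k : ℝ) (p : ℝ × ℝ) => w p * Real.cos (k * p.2)) (s := tsupport w)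
    (by fun_prop) hw.compact
  convert h using 2 with k
  exact (setIntegral_eq_integral_of_forall_compl_eq_zero fun p hp => by
    simp [image_eq_zero_of_notMem_tsupport hp]).symm

theorem diamond_stability {u : ℝ × ℝ → ℝ} (hu : IsAdmissible u) {a ρ q : ℝ} (hρ : 0 < ρ)
    (hs : ∀ p, u p ≠ 0 → |p.1 - a| / ρ + |p.2| / ρ < 1) (hq : 0 ≤ q)
    (hE : dirEnergy u (1, 0) + dirEnergy u (0, 1) ≤
      Real.pi ^ 2 / ρ ^ 2 * (1 + 3 / 2 * q ^ 2) * sqNorm u) :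
    (1 - 2 * q) * √(2 / ρ ^ 2 * sqNorm u) ≤
      2 / ρ ^ 2 * ∫ p, u p * Real.cos (Real.pi / ρ * p.2) := by
  have hdet : ρ / 2 * (-(ρ / 2)) - ρ / 2 * (ρ / 2) ≠ 0 := by nlinarith [mul_pos hρ hρ]
  have habs : |ρ / 2 * (-(ρ / 2)) - ρ / 2 * (ρ / 2)|⁻¹ = 2 / ρ ^ 2 := by
    rw [abs_of_neg (by nlinarith [mul_pos hρ hρ])]
    field_simp
    norm_num
  have hpar := dirEnergy_parallelogram hu (ρ / 2) (ρ / 2)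
  have := square_stability (hu.comp_planeAffine (a, 0) hdet) (q := q) (fun p hp => by
    have h := hs _ hp
    simp only [planeMap_apply, Prod.fst_add, Prod.snd_add, add_sub_cancel_left, zero_add] at h
    rw [← mul_add, neg_mul, ← sub_eq_add_neg, ← mul_sub, abs_mul, abs_mul,
      abs_of_pos (half_pos hρ), ← add_div, ← mul_add, div_lt_one hρ] at h
    have h' : |p.1 + p.2| + |p.1 - p.2| < 2 := by nlinarith
    have h1 := abs_le.1 (le_refl |p.1 + p.2|)
    have h2 := abs_le.1 (le_refl |p.1 - p.2|)
    constructor <;> rw [abs_lt] <;> constructor <;> linarith) hq (by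
    rw [dirEnergy_comp_planeAffine _ hdet, dirEnergy_comp_planeAffine _ hdet,
      sqNorm_comp_planeAffine _ hdet, habs]
    simp only [planeMap_apply, mul_one, mul_zero, add_zero, zero_add]
    rw [← mul_add, hpar]
    calc _ = dirEnergy u (1, 0) + dirEnergy u (0, 1) := by field_simp
      _ ≤ _ := hE
      _ = _ := by field_simp)
  rw [sqNorm_comp_planeAffine _ hdet, habs] at this
  refine this.trans (le_of_eq ?_)
  have h2 := integral_planeAffine (a, 0) hdet fun p => u p * Real.cos (Real.pi / ρ * p.2)
  rw [habs] at h2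
  rw [← h2]
  congr 1
  ext p
  simp only [planeMap_apply, Prod.snd_add, zero_add]
  congr 2
  field_simp
  ring

/-- Functions in the kite with almost minimal Dirichlet energy correlate with `cos y`. -/
theorem kite_stability {t : ℝ} (hw : IsAdmissible w) (hs : SupportedInKite t Real.pi w) {q : ℝ}
    (hq : 0 ≤ q)
    (hE : dirEnergy w (1, 0) + dirEnergy w (0, 1) ≤ (1 + 3 / 2 * q ^ 2) * sqNorm w) :
    (1 - 2 * q) * √(2 / Real.pi ^ 2 * sqNorm w) ≤
      2 / Real.pi ^ 2 * ∫ p, w p * Real.cos p.2 := by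
  have hπ := Real.pi_pos
  have key : ∀ k ∈ Ioo (0 : ℝ) 1, (1 - 2 * √(2 / 3 * ((1 + 3 / 2 * q ^ 2) / k ^ 2 - 1))) *
      √(2 / (Real.pi / k) ^ 2 * sqNorm w) ≤
        2 / (Real.pi / k) ^ 2 * ∫ p, w p * Real.cos (k * p.2) := by
    rintro k ⟨hk0, hk1⟩
    obtain ⟨u, hu, hus, hN, hx, hy, hb⟩ := exists_aligned_kite hw hπ hs (one_lt_inv₀ hk0 |>.2 hk1)
    have hnn : 0 ≤ 2 / 3 * ((1 + 3 / 2 * q ^ 2) / k ^ 2 - 1) := by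
      have : 1 ≤ (1 + 3 / 2 * q ^ 2) / k ^ 2 := by
        rw [le_div_iff₀ (by positivity)]
        nlinarith [sq_nonneg q]
      linarith
    have := diamond_stability hu (a := min 0 (t * Real.pi)) (ρ := Real.pi / k)
      (by positivity) hus (Real.sqrt_nonneg (2 / 3 * ((1 + 3 / 2 * q ^ 2) / k ^ 2 - 1))) (by
        rw [Real.sq_sqrt hnn, hN]
        refine (add_le_add hx hy).trans (hE.trans (le_of_eq ?_))
        field_simp
        ring)
    rw [hN, hb (fun y => Real.cos (Real.pi / (Real.pi / k) * y)) (by fun_prop)] at this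
    rwa [show Real.pi / (Real.pi / k) = k by field_simp] at this
  have hcont := continuous_integral_mul_cos hw
  have c1 : ContinuousAt (fun k : ℝ => (1 - 2 * √(2 / 3 * ((1 + 3 / 2 * q ^ 2) / k ^ 2 - 1))) *
      √(2 / (Real.pi / k) ^ 2 * sqNorm w)) 1 := by
    fun_prop (disch := simp [hπ.ne'])
  have c2 : ContinuousAt (fun k : ℝ =>
      2 / (Real.pi / k) ^ 2 * ∫ p, w p * Real.cos (k * p.2)) 1 :=
    ContinuousAt.mul (by fun_prop (disch := simp [hπ.ne'])) hcont.continuousAt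
  have t1 := c1.tendsto.mono_left (nhdsWithin_le_nhds (s := Iio 1))
  have t2 := c2.tendsto.mono_left (nhdsWithin_le_nhds (s := Iio 1))
  have := le_of_tendsto_of_tendsto t1 t2 (by
    filter_upwards [Ioo_mem_nhdsLT (show (0 : ℝ) < 1 by norm_num)] with k hk
    exact key k hk)
  simpa [show 2 / 3 * (3 / 2 * q ^ 2) = q ^ 2 by ring, Real.sqrt_sq hq] using this

end KiteStability

section DiamondIntegrals

/-- The closed diamond with vertices `(±π, 0)` and `(0, ±π)`. -/
def piDiamond : Set (ℝ × ℝ) := {p | |p.1| + |p.2| ≤ Real.pi}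

theorem isClosed_piDiamond : IsClosed piDiamond :=
  isClosed_le (by fun_prop) continuous_const

theorem isCompact_piDiamond : IsCompact piDiamond := by
  refine (isCompact_Icc (a := ((-Real.pi, -Real.pi) : ℝ × ℝ)) (b := (Real.pi, Real.pi))).of_isClosed_subset
    isClosed_piDiamond fun p hp => ?_
  have hp' : |p.1| + |p.2| ≤ Real.pi := hp
  have h1 := abs_le.1 (show |p.1| ≤ Real.pi by linarith [abs_nonneg p.2])
  have h2 := abs_le.1 (show |p.2| ≤ Real.pi by linarith [abs_nonneg p.1])
  exact ⟨⟨h1.1, h2.1⟩, ⟨h1.2, h2.2⟩⟩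

theorem integral_piDiamond (F : ℝ × ℝ → ℝ) : ∫ p in piDiamond, F p = Real.pi ^ 2 / 2 *
    ∫ p in Icc (-1 : ℝ) 1 ×ˢ Icc (-1 : ℝ) 1,
      F (Real.pi / 2 * (p.1 + p.2), Real.pi / 2 * (p.1 - p.2)) := by
  have hπ := Real.pi_pos
  have hdet : Real.pi / 2 * (-(Real.pi / 2)) - Real.pi / 2 * (Real.pi / 2) ≠ 0 := by
    nlinarith [mul_pos hπ hπ]
  have habs : |Real.pi / 2 * (-(Real.pi / 2)) - Real.pi / 2 * (Real.pi / 2)|⁻¹ =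
      2 / Real.pi ^ 2 := by
    rw [abs_of_neg (by nlinarith [mul_pos hπ hπ])]
    field_simp
    norm_num
  have h := integral_planeAffine 0 hdet (piDiamond.indicator F)
  rw [habs, integral_indicator isClosed_piDiamond.measurableSet] at h
  have h2 : ∀ p : ℝ × ℝ, piDiamond.indicator F (0 + planeMap (Real.pi / 2) (Real.pi / 2)
      (Real.pi / 2) (-(Real.pi / 2)) p) = (Icc (-1 : ℝ) 1 ×ˢ Icc (-1 : ℝ) 1).indicator
        (fun p => F (Real.pi / 2 * (p.1 + p.2), Real.pi / 2 * (p.1 - p.2))) p := by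
    intro p
    have e : 0 + planeMap (Real.pi / 2) (Real.pi / 2) (Real.pi / 2) (-(Real.pi / 2)) p =
        (Real.pi / 2 * (p.1 + p.2), Real.pi / 2 * (p.1 - p.2)) := by
      ext <;> simp <;> ring
    have hiff : (Real.pi / 2 * (p.1 + p.2), Real.pi / 2 * (p.1 - p.2)) ∈ piDiamond ↔
        p ∈ Icc (-1 : ℝ) 1 ×ˢ Icc (-1 : ℝ) 1 := by
      change |Real.pi / 2 * (p.1 + p.2)| + |Real.pi / 2 * (p.1 - p.2)| ≤ Real.pi ↔
        (-1 ≤ p.1 ∧ p.1 ≤ 1) ∧ -1 ≤ p.2 ∧ p.2 ≤ 1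
      rw [abs_mul, abs_mul, abs_of_pos (half_pos hπ), ← mul_add]
      constructor
      · intro h
        have h' : |p.1 + p.2| + |p.1 - p.2| ≤ 2 := by nlinarith
        have h1 := abs_le.1 (le_refl |p.1 + p.2|)
        have h2 := abs_le.1 (le_refl |p.1 - p.2|)
        refine ⟨⟨?_, ?_⟩, ?_, ?_⟩ <;> linarith
      · rintro ⟨⟨h1, h2⟩, h3, h4⟩
        have h' : |p.1 + p.2| + |p.1 - p.2| ≤ 2 := by
          rcases abs_cases (p.1 + p.2) with h | h <;> rcases abs_cases (p.1 - p.2) with h' | h' <;>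
            linarith
        nlinarith
    rw [e]
    by_cases hp : p ∈ Icc (-1 : ℝ) 1 ×ˢ Icc (-1 : ℝ) 1
    · rw [indicator_of_mem hp, indicator_of_mem (hiff.2 hp)]
    · rw [indicator_of_notMem hp, indicator_of_notMem (fun h => hp (hiff.1 h))]
  simp only [h2] at h
  rw [integral_indicator (measurableSet_Icc.prod measurableSet_Icc)] at h
  rw [h]
  field_simp

theorem integral_Icc_cos_pi_mul : ∫ s in Icc (-1 : ℝ) 1, Real.cos (Real.pi * s) = 0 := by
  rw [integral_Icc_eq_integral_Ioc, ← intervalIntegral.integral_of_le (by norm_num),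
    intervalIntegral.integral_comp_mul_left (fun s => Real.cos s) Real.pi_ne_zero, integral_cos]
  simp

theorem integral_Icc_sin_pi_mul : ∫ s in Icc (-1 : ℝ) 1, Real.sin (Real.pi * s) = 0 := by
  rw [integral_Icc_eq_integral_Ioc, ← intervalIntegral.integral_of_le (by norm_num),
    intervalIntegral.integral_comp_mul_left (fun s => Real.sin s) Real.pi_ne_zero, integral_sin]
  simp

theorem integral_Icc_id_mul_sin_pi_mul :
    ∫ s in Icc (-1 : ℝ) 1, s * Real.sin (Real.pi * s) = 2 / Real.pi := by
  have hπ := Real.pi_ne_zero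
  rw [integral_Icc_eq_integral_Ioc, ← intervalIntegral.integral_of_le (by norm_num)]
  have hd : ∀ s ∈ uIcc (-1 : ℝ) 1, HasDerivAt
      (fun s => Real.sin (Real.pi * s) / Real.pi ^ 2 - s * Real.cos (Real.pi * s) / Real.pi)
      (s * Real.sin (Real.pi * s)) s := by
    intro s _
    have h1 : HasDerivAt (fun s => Real.pi * s) Real.pi s := by
      simpa using (hasDerivAt_id s).const_mul Real.pi
    have := (h1.sin.div_const (Real.pi ^ 2)).fun_sub
      (((hasDerivAt_id' s).fun_mul h1.cos).div_const Real.pi)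
    refine this.congr_deriv ?_
    field_simp
    ring
  rw [intervalIntegral.integral_eq_sub_of_hasDerivAt hd
    (Continuous.intervalIntegrable (by fun_prop) _ _)]
  simp
  field_simp
  norm_num

theorem integral_Icc_one : ∫ _ in Icc (-1 : ℝ) 1, (1 : ℝ) = 2 := by
  simp
  norm_num

theorem integral_square_const (k : ℝ) :
    ∫ _ in Icc (-1 : ℝ) 1 ×ˢ Icc (-1 : ℝ) 1, (k : ℝ) = 4 * k := by
  have := integral_square_mul (fun _ => k) (fun _ => 1)
  simp only [mul_one] at this
  rw [this, integral_Icc_one, ← integral_Icc_one]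
  simp
  ring

theorem integral_square_cos_pi_add (ε : ℝ) : ∫ p in Icc (-1 : ℝ) 1 ×ˢ Icc (-1 : ℝ) 1,
    Real.cos (Real.pi * (p.1 + ε * p.2)) = 0 := by
  have e : ∀ p : ℝ × ℝ, Real.cos (Real.pi * (p.1 + ε * p.2)) =
      Real.cos (Real.pi * p.1) * Real.cos (Real.pi * ε * p.2) +
        Real.sin (Real.pi * p.1) * -Real.sin (Real.pi * ε * p.2) := by
    intro p
    rw [mul_add, Real.cos_add, ← mul_assoc]
    ring
  simp only [e]
  rw [integral_square_add (by fun_prop) (by fun_prop),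
    integral_square_mul (fun x => Real.cos (Real.pi * x)) (fun y => Real.cos (Real.pi * ε * y)),
    integral_square_mul (fun x => Real.sin (Real.pi * x)) (fun y => -Real.sin (Real.pi * ε * y)),
    integral_Icc_cos_pi_mul, integral_Icc_sin_pi_mul]
  ring

theorem integral_piDiamond_sin_sq_fst : ∫ p in piDiamond, Real.sin p.1 ^ 2 = Real.pi ^ 2 := by
  rw [integral_piDiamond]
  have e : ∀ p : ℝ × ℝ, Real.sin (Real.pi / 2 * (p.1 + p.2)) ^ 2 =
      1 / 2 + -1 / 2 * Real.cos (Real.pi * (p.1 + 1 * p.2)) := by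
    intro p
    rw [Real.sin_sq_eq_half_sub]
    ring_nf
  simp only [e]
  rw [integral_square_add (by fun_prop) (by fun_prop), integral_const_mul,
    integral_square_cos_pi_add, integral_square_const]
  ring

theorem integral_piDiamond_sin_sq_snd : ∫ p in piDiamond, Real.sin p.2 ^ 2 = Real.pi ^ 2 := by
  rw [integral_piDiamond]
  have e : ∀ p : ℝ × ℝ, Real.sin (Real.pi / 2 * (p.1 - p.2)) ^ 2 =
      1 / 2 + -1 / 2 * Real.cos (Real.pi * (p.1 + -1 * p.2)) := by
    intro p
    rw [Real.sin_sq_eq_half_sub]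
    ring_nf
  simp only [e]
  rw [integral_square_add (by fun_prop) (by fun_prop), integral_const_mul,
    integral_square_cos_pi_add, integral_square_const]
  ring

theorem integral_piDiamond_const (k : ℝ) : ∫ _ in piDiamond, k = 2 * Real.pi ^ 2 * k := by
  rw [integral_piDiamond, integral_square_const]
  ring

theorem integral_piDiamond_cos_mul_cos :
    ∫ p in piDiamond, Real.cos p.1 * Real.cos p.2 = 0 := by
  rw [integral_piDiamond]
  have e : ∀ p : ℝ × ℝ, Real.cos (Real.pi / 2 * (p.1 + p.2)) * Real.cos (Real.pi / 2 * (p.1 - p.2)) =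
      Real.cos (Real.pi * p.1) * (1 / 2) + 1 / 2 * Real.cos (Real.pi * p.2) := by
    intro p
    rw [show Real.pi * p.1 = Real.pi / 2 * (p.1 + p.2) + Real.pi / 2 * (p.1 - p.2) by ring,
      show Real.pi * p.2 = Real.pi / 2 * (p.1 + p.2) - Real.pi / 2 * (p.1 - p.2) by ring,
      Real.cos_add, Real.cos_sub]
    ring
  simp only [e]
  rw [integral_square_add (by fun_prop) (by fun_prop),
    integral_square_mul (fun x => Real.cos (Real.pi * x)) (fun _ => 1 / 2),
    integral_square_mul (fun _ => 1 / 2) (fun x => Real.cos (Real.pi * x)),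
    integral_Icc_cos_pi_mul]
  ring

theorem integral_piDiamond_snd_mul_sin_mul_cos :
    ∫ p in piDiamond, p.2 * Real.sin p.2 * Real.cos p.1 = Real.pi ^ 2 := by
  rw [integral_piDiamond]
  have e : ∀ p : ℝ × ℝ, Real.pi / 2 * (p.1 - p.2) * Real.sin (Real.pi / 2 * (p.1 - p.2)) *
      Real.cos (Real.pi / 2 * (p.1 + p.2)) =
      (p.1 * Real.sin (Real.pi * p.1)) * (Real.pi / 4) +
        (Real.pi / 4) * (p.2 * Real.sin (Real.pi * p.2)) +
        (-(Real.pi / 4) * p.1) * Real.sin (Real.pi * p.2) +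
        Real.sin (Real.pi * p.1) * (-(Real.pi / 4) * p.2) := by
    intro p
    rw [show Real.pi * p.1 = Real.pi / 2 * (p.1 + p.2) + Real.pi / 2 * (p.1 - p.2) by ring,
      show Real.pi * p.2 = Real.pi / 2 * (p.1 + p.2) - Real.pi / 2 * (p.1 - p.2) by ring,
      Real.sin_add, Real.sin_sub]
    ring
  simp only [e]
  iterate 3 rw [integral_square_add (by fun_prop) (by fun_prop)]
  rw [integral_square_mul (fun x => x * Real.sin (Real.pi * x)) (fun _ => Real.pi / 4),
    integral_square_mul (fun _ => Real.pi / 4) (fun x => x * Real.sin (Real.pi * x)),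
    integral_square_mul (fun x => -(Real.pi / 4) * x) (fun x => Real.sin (Real.pi * x)),
    integral_square_mul (fun x => Real.sin (Real.pi * x)) (fun x => -(Real.pi / 4) * x),
    integral_Icc_sin_pi_mul, integral_Icc_id_mul_sin_pi_mul]
  simp
  field_simp
  norm_num

end DiamondIntegrals

section DiamondCalibration

open Filter Topology
open scoped NNReal

variable {w : ℝ × ℝ → ℝ}

theorem dirEnergy_calibration (hw : IsAdmissible w) {D : Set (ℝ × ℝ)} (hD : IsCompact D)
    (h0 : ∀ p ∉ D, w p = 0) (v : ℝ × ℝ) {f : ℝ × ℝ → ℝ} (hf : ContDiff ℝ 1 f) :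
    -2 * (∫ p, w p * lineDeriv ℝ f p v) - ∫ p in D, f p ^ 2 ≤ dirEnergy w v := by
  obtain ⟨C, hC⟩ := hw.lipschitz
  have hd : ∀ p ∉ D, lineDeriv ℝ w p v = 0 := fun p hp =>
    lineDeriv_eq_zero_of_nonneg hw.nonneg (h0 p hp) v
  have i1 : IntegrableOn (fun p => lineDeriv ℝ w p v ^ 2) D :=
    (integrable_lineDeriv_sq hC hw.compact v).integrableOn
  have i2 : IntegrableOn (fun p => lineDeriv ℝ w p v * f p) D :=
    (integrable_lineDeriv_mul hC hw.compact v hf.continuous).integrableOn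
  have i3 : IntegrableOn (fun p => f p ^ 2) D :=
    (hf.continuous.pow 2).continuousOn.integrableOn_compact hD
  have e1 : ∫ p in D, lineDeriv ℝ w p v ^ 2 = dirEnergy w v :=
    setIntegral_eq_integral_of_forall_compl_eq_zero fun p hp => by simp [hd p hp]
  have e2 : ∫ p in D, lineDeriv ℝ w p v * f p = -∫ p, w p * lineDeriv ℝ f p v := by
    rw [← integral_lineDeriv_mul_eq_neg hC hw.compact v hf]
    exact setIntegral_eq_integral_of_forall_compl_eq_zero fun p hp => by simp [hd p hp]
  have key : 0 ≤ ∫ p in D, (lineDeriv ℝ w p v - f p) ^ 2 :=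
    integral_nonneg fun p => sq_nonneg _
  have e3 : ∀ p, (lineDeriv ℝ w p v - f p) ^ 2 =
      lineDeriv ℝ w p v ^ 2 + f p ^ 2 - 2 * (lineDeriv ℝ w p v * f p) := fun p => by ring
  simp only [e3] at key
  have i4 : IntegrableOn (fun p => lineDeriv ℝ w p v ^ 2 + f p ^ 2) D := i1.add i3
  rw [integral_sub i4 (i2.const_mul 2), integral_add i1 i3, integral_const_mul,
    e1, e2] at key
  linarith

theorem lineDeriv_fst {f : ℝ → ℝ} {f' x y : ℝ} {g : ℝ × ℝ → ℝ} (hf : HasDerivAt f f' x)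
    (hg : ∀ s, g (s, y) = f s) : lineDeriv ℝ g (x, y) (1, 0) = f' := by
  have := deriv_comp_const_add f x 0
  simpa [lineDeriv, hg, hf.deriv] using this

theorem lineDeriv_snd {f : ℝ → ℝ} {f' x y : ℝ} {g : ℝ × ℝ → ℝ} (hf : HasDerivAt f f' y)
    (hg : ∀ s, g (x, s) = f s) : lineDeriv ℝ g (x, y) (0, 1) = f' := by
  have := deriv_comp_const_add f y 0
  simpa [lineDeriv, hg, hf.deriv] using this

theorem diamond_calibration (hw : IsAdmissible w) (hs : ∀ p, w p ≠ 0 → |p.1| + |p.2| < Real.pi)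
    {θ Λ : ℝ} (hθ : θ ≠ 0) (hΛ : 0 < Λ) (A : ℝ) :
    2 * A * Λ * (∫ p, w p * Real.cos p.2) - A ^ 2 * (Λ * Real.pi ^ 2 - Real.pi ^ 2 / θ ^ 2 +
      (∫ p in piDiamond, (p.2 * Real.cos p.1) ^ 2) / (θ ^ 4 * Λ)) ≤
      dirEnergy w (1, 0) / θ ^ 2 + Λ * dirEnergy w (0, 1) := by
  have h0 : ∀ p ∉ piDiamond, w p = 0 := fun p hp => by
    by_contra h
    exact hp (hs p h).le
  have h1 := dirEnergy_calibration hw isCompact_piDiamond h0 (1, 0)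
    (f := fun p => -A * Real.sin p.1) (by fun_prop)
  have h2 := dirEnergy_calibration hw isCompact_piDiamond h0 (0, 1)
    (f := fun p => A * (-Real.sin p.2 + 1 / (θ ^ 2 * Λ) * (p.2 * Real.cos p.1))) (by fun_prop)
  have d1 : ∀ p : ℝ × ℝ, lineDeriv ℝ (fun p : ℝ × ℝ => -A * Real.sin p.1) p (1, 0) =
      -A * Real.cos p.1 := fun p =>
    lineDeriv_fst (g := fun p : ℝ × ℝ => -A * Real.sin p.1)
      ((Real.hasDerivAt_sin p.1).const_mul (-A)) fun s => rfl
  have d2 : ∀ p : ℝ × ℝ, lineDeriv ℝ (fun p : ℝ × ℝ =>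
      A * (-Real.sin p.2 + 1 / (θ ^ 2 * Λ) * (p.2 * Real.cos p.1))) p (0, 1) =
      A * (-Real.cos p.2 + 1 / (θ ^ 2 * Λ) * (1 * Real.cos p.1)) := fun p =>
    lineDeriv_snd (g := fun p : ℝ × ℝ =>
      A * (-Real.sin p.2 + 1 / (θ ^ 2 * Λ) * (p.2 * Real.cos p.1)))
      (((Real.hasDerivAt_sin p.2).fun_neg.fun_add
        (((hasDerivAt_id' p.2).mul_const (Real.cos p.1)).const_mul (1 / (θ ^ 2 * Λ)))).const_mul A)
      fun s => rfl
  have ic : ∀ {f : ℝ × ℝ → ℝ}, Continuous f → IntegrableOn f piDiamond := fun hf =>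
    hf.continuousOn.integrableOn_compact isCompact_piDiamond
  set X := ∫ p, w p * Real.cos p.1 with hX
  set Y := ∫ p, w p * Real.cos p.2 with hY
  set M := ∫ p in piDiamond, (p.2 * Real.cos p.1) ^ 2 with hM
  have e1 : ∫ p, w p * lineDeriv ℝ (fun p : ℝ × ℝ => -A * Real.sin p.1) p (1, 0) = -A * X := by
    simp only [d1]
    rw [hX, ← integral_const_mul]
    congr 1 with p
    ring
  have e2 : ∫ p, w p * lineDeriv ℝ (fun p : ℝ × ℝ =>
      A * (-Real.sin p.2 + 1 / (θ ^ 2 * Λ) * (p.2 * Real.cos p.1))) p (0, 1) =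
      -A * Y + A * (1 / (θ ^ 2 * Λ)) * X := by
    simp only [d2]
    rw [hX, hY, ← integral_const_mul, ← integral_const_mul, ← integral_add
      ((hw.integrable_mul (by fun_prop)).const_mul _)
      ((hw.integrable_mul (by fun_prop)).const_mul _)]
    congr 1 with p
    ring
  have e3 : ∫ p in piDiamond, (-A * Real.sin p.1) ^ 2 = A ^ 2 * Real.pi ^ 2 := by
    rw [← integral_piDiamond_sin_sq_fst, ← integral_const_mul]
    congr 1 with p
    ring
  have e4 : ∫ p in piDiamond, (A * (-Real.sin p.2 + 1 / (θ ^ 2 * Λ) * (p.2 * Real.cos p.1))) ^ 2 =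
      A ^ 2 * Real.pi ^ 2 + (-2 * A ^ 2 * (1 / (θ ^ 2 * Λ))) * Real.pi ^ 2 +
        (A ^ 2 * (1 / (θ ^ 2 * Λ)) ^ 2) * M := by
    rw [hM, ← integral_const_mul (A ^ 2 * (1 / (θ ^ 2 * Λ)) ^ 2)]
    nth_rw 1 [← integral_piDiamond_sin_sq_snd]
    rw [← integral_piDiamond_snd_mul_sin_mul_cos, ← integral_const_mul, ← integral_const_mul,
      ← integral_add (ic (by fun_prop)) (ic (by fun_prop)),
      ← integral_add (ic (by fun_prop)) (ic (by fun_prop))]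
    congr 1 with p
    ring
  rw [e1, e3] at h1
  rw [e2, e4] at h2
  have hθ2 : 0 < θ ^ 2 := by positivity
  have h1' := div_le_div_of_nonneg_right h1 hθ2.le
  have h2' := mul_le_mul_of_nonneg_left h2 hΛ.le
  refine le_trans (le_of_eq ?_) (add_le_add h1' h2')
  field_simp
  ring

end DiamondCalibration

section Fold

open Filter Topology
open scoped NNReal

variable {w : ℝ × ℝ → ℝ} {p θ : ℝ}

/-- Fold the plane along the vertical line of abscissa `p`, rescaling by `θ`. -/
def foldAt (p θ : ℝ) (w : ℝ × ℝ → ℝ) (z : ℝ × ℝ) : ℝ := w (p + θ * |z.1|, z.2)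

theorem integral_foldAt {F : ℝ × ℝ → ℝ} (hF : Integrable F) (hθ : θ ≠ 0) :
    ∫ z, foldAt p θ F z = 2 * |θ|⁻¹ * ∫ z in {z : ℝ × ℝ | 0 < θ * (z.1 - p)}, F z := by
  have hH : MeasurableSet {z : ℝ × ℝ | 0 < θ * (z.1 - p)} :=
    (isOpen_lt continuous_const (by fun_prop)).measurableSet
  set G := {z : ℝ × ℝ | 0 < θ * (z.1 - p)}.indicator F with hG
  have hGi : Integrable G := hF.indicator hH
  have hd : ∀ {s : ℝ}, s ≠ 0 → s * 1 - 0 * 0 ≠ 0 := fun h => by simpa using h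
  have hcomp : ∀ {s : ℝ} (h : s ≠ 0), Integrable fun z => G ((p, 0) + planeMap s 0 0 1 z) := by
    intro s h
    refine ((planeAffine (p, 0) (hd h)).measurableEmbedding.integrable_map_iff (μ := volume)
      (g := G)).1 ?_
    rw [map_planeAffine_volume]
    exact hGi.smul_measure ENNReal.ofReal_ne_top
  have e : (fun z => foldAt p θ F z) =ᵐ[volume] fun z =>
      G ((p, 0) + planeMap θ 0 0 1 z) + G ((p, 0) + planeMap (-θ) 0 0 1 z) := by
    filter_upwards [ae_fst_ne 0] with z hz
    have e1 : ∀ s : ℝ, (p, 0) + planeMap s 0 0 1 z = (p + s * z.1, z.2) := fun s => by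
      ext <;> simp
    have hθ2 : 0 < θ * θ := mul_self_pos.2 hθ
    rw [e1, e1, hG, foldAt]
    rcases hz.lt_or_gt with h | h
    · rw [indicator_of_notMem, indicator_of_mem, zero_add, abs_of_neg h, mul_neg, neg_mul]
      · simp only [mem_ofPred_eq]
        nlinarith
      · simp only [mem_ofPred_eq]
        nlinarith
    · rw [indicator_of_mem, indicator_of_notMem, add_zero, abs_of_pos h]
      · simp only [mem_ofPred_eq]
        nlinarith
      · simp only [mem_ofPred_eq]
        nlinarith
  rw [integral_congr_ae e, integral_add (hcomp hθ) (hcomp (neg_ne_zero.2 hθ)),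
    integral_planeAffine _ (hd hθ), integral_planeAffine _ (hd (neg_ne_zero.2 hθ)), hG,
    integral_indicator hH]
  simp only [mul_one, mul_zero, sub_zero, abs_neg]
  ring

theorem IsAdmissible.foldAt (hw : IsAdmissible w) (hθ : θ ≠ 0) : IsAdmissible (foldAt p θ w) where
  lipschitz := by
    obtain ⟨C, hC⟩ := hw.lipschitz
    have h1 : LipschitzWith (1 + ‖θ‖₊) fun z : ℝ × ℝ => (p + θ * |z.1|, z.2) := by
      refine LipschitzWith.of_dist_le_mul fun a b => ?_
      rw [Prod.dist_eq, Prod.dist_eq]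
      have e1 : |(|a.1| - |b.1|)| ≤ |a.1 - b.1| := abs_abs_sub_abs_le_abs_sub _ _
      have hm1 : |a.1 - b.1| ≤ max (dist a.1 b.1) (dist a.2 b.2) := le_max_left _ _
      have hm2 : dist a.2 b.2 ≤ max (dist a.1 b.1) (dist a.2 b.2) := le_max_right _ _
      set m := max (dist a.1 b.1) (dist a.2 b.2) with hm
      have hm0 : 0 ≤ m := le_trans dist_nonneg hm2
      simp only [NNReal.coe_add, NNReal.coe_one, coe_nnnorm, Real.norm_eq_abs]
      refine max_le ?_ ?_
      · rw [Real.dist_eq, add_sub_add_left_eq_sub, ← mul_sub, abs_mul]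
        nlinarith [abs_nonneg θ, mul_le_mul_of_nonneg_left (e1.trans hm1) (abs_nonneg θ)]
      · nlinarith [abs_nonneg θ, mul_nonneg (abs_nonneg θ) hm0]
    exact ⟨_, hC.comp h1⟩
  compact := by
    obtain ⟨R, hR⟩ := hw.compact.isBounded.subset_closedBall ((p, 0) : ℝ × ℝ)
    refine HasCompactSupport.intro
      (isCompact_closedBall (0 : ℝ × ℝ) (max (R / |θ|) R)) fun z hz => ?_
    by_contra h
    have h1 := hR (subset_tsupport w h)
    rw [Metric.mem_closedBall, Prod.dist_eq, max_le_iff, Real.dist_eq, Real.dist_eq] at h1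
    simp only [add_sub_cancel_left, abs_mul, abs_abs, sub_zero] at h1
    refine hz ?_
    rw [mem_closedBall_zero_iff, Prod.norm_def, Real.norm_eq_abs, Real.norm_eq_abs]
    refine max_le_max ?_ h1.2
    rw [le_div_iff₀ (abs_pos.2 hθ), mul_comm]
    exact h1.1
  nonneg _ := hw.nonneg _

theorem dirEnergy_foldAt_fst (hw : IsAdmissible w) (hθ : θ ≠ 0) :
    dirEnergy (foldAt p θ w) (1, 0) =
      2 * |θ| * ∫ z in {z : ℝ × ℝ | 0 < θ * (z.1 - p)}, lineDeriv ℝ w z (1, 0) ^ 2 := by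
  obtain ⟨C, hC⟩ := hw.lipschitz
  have h := integral_foldAt (p := p) (integrable_lineDeriv_sq hC hw.compact (1, 0)) hθ
  have e : dirEnergy (foldAt p θ w) (1, 0) =
      ∫ z, θ ^ 2 * foldAt p θ (fun z => lineDeriv ℝ w z (1, 0) ^ 2) z := by
    refine integral_congr_ae ?_
    filter_upwards [ae_fst_ne 0] with z hz
    have key : ∀ ε : ℝ, ε ^ 2 = 1 → (∀ᶠ s in 𝓝 z.1, |s| = ε * s) →
        lineDeriv ℝ (foldAt p θ w) z (1, 0) ^ 2 =
          θ ^ 2 * lineDeriv ℝ w (p + θ * |z.1|, z.2) (1, 0) ^ 2 := by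
      intro ε hε hev
      have e1 : (foldAt p θ w) =ᶠ[𝓝 z] fun z => w ((p, 0) + planeMap (θ * ε) 0 0 1 z) := by
        filter_upwards [continuous_fst.continuousAt.eventually hev] with y hy
        rw [foldAt, hy]
        congr 1
        ext <;> simp
        ring
      rw [e1.lineDeriv_eq, lineDeriv_comp_planeAffine]
      have e2 : planeMap (θ * ε) 0 0 1 (1, 0) = (θ * ε) • ((1 : ℝ), (0 : ℝ)) := by
        ext <;> simp
      have e3 : (p, 0) + planeMap (θ * ε) 0 0 1 z = (p + θ * |z.1|, z.2) := by
        rw [hev.self_of_nhds]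
        ext <;> simp
        ring
      rw [e2, e3, lineDeriv_smul, smul_eq_mul, mul_pow, mul_pow, hε, mul_one]
    rcases hz.lt_or_gt with h | h
    · refine key (-1) (by norm_num) ?_
      filter_upwards [Iio_mem_nhds h] with s hs
      rw [abs_of_neg hs]
      ring
    · refine key 1 (by norm_num) ?_
      filter_upwards [Ioi_mem_nhds h] with s hs
      rw [abs_of_pos hs]
      ring
  rw [e, integral_const_mul, h, ← sq_abs]
  have := abs_ne_zero.2 hθ
  field_simp

theorem dirEnergy_foldAt_snd (hw : IsAdmissible w) (hθ : θ ≠ 0) :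
    dirEnergy (foldAt p θ w) (0, 1) =
      2 * |θ|⁻¹ * ∫ z in {z : ℝ × ℝ | 0 < θ * (z.1 - p)}, lineDeriv ℝ w z (0, 1) ^ 2 := by
  obtain ⟨C, hC⟩ := hw.lipschitz
  rw [← integral_foldAt (integrable_lineDeriv_sq hC hw.compact (0, 1)) hθ]
  simp [dirEnergy, foldAt, lineDeriv]

theorem half_calibration (hw : IsAdmissible w)
    (hs : ∀ z : ℝ × ℝ, w (p + θ * |z.1|, z.2) ≠ 0 → |z.1| + |z.2| < Real.pi)
    (hθ : θ ≠ 0) {Λ : ℝ} (hΛ : 0 < Λ) (A : ℝ) :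
    2 * A * Λ * (∫ z in {z : ℝ × ℝ | 0 < θ * (z.1 - p)}, w z * Real.cos z.2) -
      A ^ 2 * (|θ| / 2) * (Λ * Real.pi ^ 2 - Real.pi ^ 2 / θ ^ 2 +
        (∫ z in piDiamond, (z.2 * Real.cos z.1) ^ 2) / (θ ^ 4 * Λ)) ≤
      (∫ z in {z : ℝ × ℝ | 0 < θ * (z.1 - p)}, lineDeriv ℝ w z (1, 0) ^ 2) +
        Λ * ∫ z in {z : ℝ × ℝ | 0 < θ * (z.1 - p)}, lineDeriv ℝ w z (0, 1) ^ 2 := by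
  have h := diamond_calibration (hw.foldAt hθ) hs hθ hΛ A
  have e := integral_foldAt (p := p) (hw.integrable_mul (f := fun z => Real.cos z.2) (by fun_prop)) hθ
  rw [dirEnergy_foldAt_fst hw hθ, dirEnergy_foldAt_snd hw hθ] at h
  have e' : ∫ z, foldAt p θ w z * Real.cos z.2 = 2 * |θ|⁻¹ *
    ∫ z in {z : ℝ × ℝ | 0 < θ * (z.1 - p)}, w z * Real.cos z.2 := e
  rw [e'] at h
  have hθ' := abs_pos.2 hθ
  have h' := mul_le_mul_of_nonneg_left h (show 0 ≤ |θ| / 2 by positivity)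
  refine le_trans (le_of_eq ?_) (h'.trans (le_of_eq ?_))
  · field_simp
  · rw [← sq_abs θ]
    field_simp

end Fold

section KiteStrict

variable {w : ℝ × ℝ → ℝ} {t : ℝ}

theorem setIntegral_half_add_half {F : ℝ × ℝ → ℝ} (hF : Integrable F) {p θ₁ θ₂ : ℝ} (h₁ : θ₁ < 0)
    (h₂ : 0 < θ₂) : (∫ z in {z : ℝ × ℝ | 0 < θ₁ * (z.1 - p)}, F z) +
      ∫ z in {z : ℝ × ℝ | 0 < θ₂ * (z.1 - p)}, F z = ∫ z, F z := by
  have hH : MeasurableSet {z : ℝ × ℝ | 0 < θ₁ * (z.1 - p)} :=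
    (isOpen_lt continuous_const (by fun_prop)).measurableSet
  rw [← integral_add_compl hH hF]
  congr 1
  refine setIntegral_congr_set ?_
  filter_upwards [ae_fst_ne p] with z hz
  refine propext (show 0 < θ₂ * (z.1 - p) ↔ ¬ 0 < θ₁ * (z.1 - p) from ?_)
  rw [mul_pos_iff_of_pos_left h₂, sub_pos, not_lt]
  constructor
  · intro h
    nlinarith
  · intro h
    refine lt_of_le_of_ne ?_ hz.symm
    by_contra! hcon
    nlinarith

theorem kite_calibration (hw : IsAdmissible w) (hs : SupportedInKite t Real.pi w) (ht : |t| < 1)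
    {Λ : ℝ} (hΛ : 0 < Λ) (A : ℝ) :
    2 * A * Λ * (∫ p, w p * Real.cos p.2) - A ^ 2 * (Λ * Real.pi ^ 2 -
      1 / (1 - t ^ 2) * Real.pi ^ 2 + (∫ z in piDiamond, (z.2 * Real.cos z.1) ^ 2) / 2 *
        (1 / (1 + t) ^ 3 + 1 / (1 - t) ^ 3) / Λ) ≤
      dirEnergy w (1, 0) + Λ * dirEnergy w (0, 1) := by
  obtain ⟨hl, hr⟩ := abs_lt.1 ht
  have hl' : 0 < 1 + t := by linarith
  have hr' : 0 < 1 - t := by linarith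
  have hπ := Real.pi_pos
  have sup : ∀ z, w z ≠ 0 → |z.1 - t * abs z.2| < Real.pi - |z.2| := fun z hz => by
    have := hs z hz
    rwa [div_self hπ.ne', one_mul] at this
  have h1 := half_calibration (p := t * Real.pi) (θ := -(1 + t)) hw (fun z hz => by
    have h := (abs_lt.1 (sup _ hz)).1
    simp only at h
    by_contra! hcon
    nlinarith [mul_le_mul_of_nonneg_left hcon hl'.le]) (by linarith) hΛ A
  have h2 := half_calibration (p := t * Real.pi) (θ := 1 - t) hw (fun z hz => by
    have h := (abs_lt.1 (sup _ hz)).2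
    simp only at h
    by_contra! hcon
    nlinarith [mul_le_mul_of_nonneg_left hcon hr'.le]) hr'.ne' hΛ A
  obtain ⟨C, hC⟩ := hw.lipschitz
  have i1 := integrable_lineDeriv_sq (μ := volume) hC hw.compact (1, 0)
  have i2 := integrable_lineDeriv_sq (μ := volume) hC hw.compact (0, 1)
  have i3 := hw.integrable_mul (f := fun z => Real.cos z.2) (by fun_prop)
  have hneg : -(1 + t) < 0 := by linarith
  have e1 := setIntegral_half_add_half (p := t * Real.pi) i1 hneg hr'
  have e2 := setIntegral_half_add_half (p := t * Real.pi) i2 hneg hr'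
  have e3 := setIntegral_half_add_half (p := t * Real.pi) i3 hneg hr'
  rw [dirEnergy, dirEnergy, ← e1, ← e2, ← e3]
  rw [abs_neg, abs_of_pos hl'] at h1
  rw [abs_of_pos hr'] at h2
  have h := add_le_add h1 h2
  refine le_trans (le_of_eq ?_) (h.trans (le_of_eq ?_))
  · have : 1 - t ^ 2 = (1 + t) * (1 - t) := by ring
    rw [this]
    field_simp
    ring
  · ring

/-- For kites of the same area as the diamond that are not rhombic, the lower bound on the
Dirichlet energy is strict. -/
lemma calibration_margin_pos {Λ q σ : ℝ} (hΛ : 1 ≤ Λ) (hq0 : 0 < q) (hq1 : q ≤ 1 / 2)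
    (hqΛ : q * Λ ≤ (σ - 1) / 40) (hσ : 0 < σ - 1) :
    0 < (1 - 2 * q) * Λ - (Λ - σ + (σ - 1) / 4) / 2 -
      (Λ + 1) / 2 * (1 + 3 / 2 * q ^ 2) - (Λ - 1) * q := by
  have f1 : (Λ + 1) * q ^ 2 ≤ 2 * Λ * q ^ 2 :=
    mul_le_mul_of_nonneg_right (by linarith) (sq_nonneg q)
  have f2 : Λ * q * q ≤ Λ * q * (1 / 2) :=
    mul_le_mul_of_nonneg_left hq1 (by positivity)
  linarith

theorem kite_strict_bound (ht0 : t ≠ 0) (ht : |t| < 1) :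
    ∃ δ > 0, ∀ w, IsAdmissible w → SupportedInKite t Real.pi w →
      (1 + δ) * sqNorm w ≤ dirEnergy w (1, 0) + dirEnergy w (0, 1) := by
  obtain ⟨hl, hr⟩ := abs_lt.1 ht
  have hl' : 0 < 1 + t := by linarith
  have hr' : 0 < 1 - t := by linarith
  have hπ := Real.pi_pos
  obtain ⟨σ, hσ⟩ : ∃ σ, σ = 1 / (1 - t ^ 2) := ⟨_, rfl⟩
  obtain ⟨M, hM⟩ : ∃ M, M = (∫ z in piDiamond, (z.2 * Real.cos z.1) ^ 2) / 2 *
        (1 / (1 + t) ^ 3 + 1 / (1 - t) ^ 3) := ⟨_, rfl⟩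
  have hσ1 : 0 < σ - 1 := by
    have h1 : 0 < 1 - t ^ 2 := by nlinarith
    have h2 : 0 < t ^ 2 := by positivity
    rw [hσ, sub_pos, lt_div_iff₀ h1]
    linarith
  have hM0 : 0 ≤ M := by
    have : 0 ≤ ∫ z in piDiamond, (z.2 * Real.cos z.1) ^ 2 :=
      integral_nonneg fun z => sq_nonneg _
    rw [hM]
    positivity
  obtain ⟨Λ, hΛ⟩ : ∃ Λ, Λ = 1 + M / (σ - 1) := ⟨_, rfl⟩
  have hΛ1 : 1 ≤ Λ := by
    have : 0 ≤ M / (σ - 1) := by positivity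
    linarith
  have hMΛ : M / Λ ≤ σ - 1 := by
    rw [div_le_iff₀ (by linarith), hΛ, mul_add, mul_div_cancel₀ _ hσ1.ne']
    linarith
  obtain ⟨q, hq⟩ : ∃ q, q = min (1 / 2) ((σ - 1) / (40 * Λ)) := ⟨_, rfl⟩
  have hq0 : 0 < q := by
    rw [hq]
    exact lt_min (by norm_num) (by positivity)
  have hq1 : q ≤ 1 / 2 := hq ▸ min_le_left _ _
  have hqΛ : q * Λ ≤ (σ - 1) / 40 := by
    have : q ≤ (σ - 1) / (40 * Λ) := hq ▸ min_le_right _ _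
    rw [le_div_iff₀ (by positivity)] at this
    linarith
  refine ⟨3 / 2 * q ^ 2, by positivity, fun w hw hs => ?_⟩
  by_contra! hcon
  have hN : 0 < sqNorm w := by
    refine lt_of_le_of_ne sqNorm_nonneg fun h => ?_
    rw [← h, mul_zero] at hcon
    linarith [dirEnergy_nonneg (w := w) (v := (1, 0)), dirEnergy_nonneg (w := w) (v := (0, 1))]
  have h1 := kite_stability hw hs hq0.le hcon.le
  have h2 := kite_anisotropic_bound hw hs (s := q) (by linarith) (by linarith)
  obtain ⟨a, ha0, ha⟩ : ∃ a, 0 ≤ a ∧ √(2 / Real.pi ^ 2 * sqNorm w) = a :=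
    ⟨_, Real.sqrt_nonneg _, rfl⟩
  have ha2 : Real.pi ^ 2 / 2 * a ^ 2 = sqNorm w := by
    rw [← ha, Real.sq_sqrt (by positivity)]
    field_simp
  have h3 := kite_calibration hw hs ht (Λ := Λ) (by linarith) (a / 2)
  rw [← hσ, ← hM] at h3
  rw [ha] at h1
  set S := ∫ p, w p * Real.cos p.2 with hS
  set N := sqNorm w with hNdef
  set X := dirEnergy w (1, 0) with hX
  set Y := dirEnergy w (0, 1) with hY
  have h4 : Real.pi ^ 2 / 2 * ((1 - 2 * q) * a) ≤ S := by
    have := mul_le_mul_of_nonneg_left h1 (show 0 ≤ Real.pi ^ 2 / 2 by positivity)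
    rwa [← mul_assoc (Real.pi ^ 2 / 2) (2 / Real.pi ^ 2), div_mul_div_cancel₀ (by norm_num),
      div_self (by positivity), one_mul] at this
  have h5 : (1 - 2 * q) * N * Λ ≤ 2 * (a / 2) * Λ * S := by
    have := mul_le_mul_of_nonneg_left h4 (show 0 ≤ a * Λ by positivity)
    rw [← ha2]
    linarith
  have hM' : M / Λ ≤ Real.pi ^ 2 * ((σ - 1) / 4) := by
    have : 4 ≤ Real.pi ^ 2 := by nlinarith [Real.pi_gt_three]
    nlinarith
  have h6 : (a / 2) ^ 2 * (Λ * Real.pi ^ 2 - σ * Real.pi ^ 2 + M / Λ) ≤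
      N / 2 * (Λ - σ + (σ - 1) / 4) := by
    have := mul_le_mul_of_nonneg_left hM' (sq_nonneg (a / 2))
    rw [← ha2]
    linarith
  have h7 : Y - X ≤ 2 * q * N := by
    have : q * (Y - X) ≤ q * (2 * q * N) := by nlinarith
    exact le_of_mul_le_mul_left this hq0
  have h8 : X + Λ * Y ≤ (Λ + 1) / 2 * ((1 + 3 / 2 * q ^ 2) * N) +
      (Λ - 1) / 2 * (2 * q * N) := by
    have e1 := mul_le_mul_of_nonneg_left hcon.le (show 0 ≤ (Λ + 1) / 2 by linarith)
    have e2 := mul_le_mul_of_nonneg_left h7 (show 0 ≤ (Λ - 1) / 2 by linarith)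
    linarith
  have h9 : N * ((1 - 2 * q) * Λ - (Λ - σ + (σ - 1) / 4) / 2 -
      (Λ + 1) / 2 * (1 + 3 / 2 * q ^ 2) - (Λ - 1) * q) ≤ 0 := by linarith
  have h10 := calibration_margin_pos hΛ1 hq0 hq1 hqΛ hσ1
  exact absurd h9 (not_le.2 (mul_pos hN h10))

end KiteStrict

section ModelTriangle

open Filter Topology
open scoped NNReal

variable {t β : ℝ} {v : ℝ × ℝ → ℝ}

/-- The triangle with vertices `(-π, 0)`, `(π, 0)` and `(t * β, β)`. -/
def modelTriangle (t β : ℝ) : Set (ℝ × ℝ) :=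
  {z | 0 ≤ z.2 ∧ |z.1 - t * z.2| ≤ Real.pi - Real.pi / β * z.2}

/-- The union of the two sides of the model triangle which meet at the vertex `(t * β, β)`. -/
def modelSides (t β : ℝ) : Set (ℝ × ℝ) :=
  {z | 0 ≤ z.2 ∧ |z.1 - t * z.2| = Real.pi - Real.pi / β * z.2}

theorem isClosed_modelTriangle : IsClosed (modelTriangle t β) :=
  IsClosed.inter (isClosed_le continuous_const continuous_snd)
    (isClosed_le (f := fun z : ℝ × ℝ => |z.1 - t * z.2|) (by fun_prop) (by fun_prop))

theorem snd_le_of_mem_modelTriangle (hβ : 0 < β) {z : ℝ × ℝ} (hz : z ∈ modelTriangle t β) :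
    z.2 ≤ β := by
  have h : 0 ≤ Real.pi - Real.pi / β * z.2 := (abs_nonneg _).trans hz.2
  rw [div_mul_eq_mul_div, sub_nonneg, div_le_iff₀ hβ] at h
  exact le_of_mul_le_mul_left h Real.pi_pos

theorem isCompact_modelTriangle (hβ : 0 < β) : IsCompact (modelTriangle t β) := by
  refine (isCompact_Icc (a := ((-Real.pi - |t| * β, 0) : ℝ × ℝ))
    (b := (Real.pi + |t| * β, β))).of_isClosed_subset isClosed_modelTriangle fun z hz => ?_
  have h1 := snd_le_of_mem_modelTriangle hβ hz
  have h2 : |t * z.2| ≤ |t| * β := by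
    rw [abs_mul, abs_of_nonneg hz.1]
    exact mul_le_mul_of_nonneg_left h1 (abs_nonneg _)
  have h3 : 0 ≤ Real.pi / β * z.2 := mul_nonneg (by positivity) hz.1
  have h4 := abs_le.1 hz.2
  have h5 := abs_le.1 h2
  exact ⟨⟨by simp only; linarith, hz.1⟩, ⟨by simp only; linarith, h1⟩⟩

theorem convex_modelTriangle : Convex ℝ (modelTriangle t β) := by
  have h1 : Convex ℝ {z : ℝ × ℝ | 0 ≤ z.2} :=
    convex_halfSpace_ge (LinearMap.snd ℝ ℝ ℝ).isLinear 0
  have h2 : Convex ℝ {z : ℝ × ℝ | z.1 - t * z.2 + Real.pi / β * z.2 ≤ Real.pi} :=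
    convex_halfSpace_le (LinearMap.fst ℝ ℝ ℝ - t • LinearMap.snd ℝ ℝ ℝ +
      (Real.pi / β) • LinearMap.snd ℝ ℝ ℝ).isLinear Real.pi
  have h3 : Convex ℝ {z : ℝ × ℝ | -Real.pi ≤ z.1 - t * z.2 - Real.pi / β * z.2} :=
    convex_halfSpace_ge (LinearMap.fst ℝ ℝ ℝ - t • LinearMap.snd ℝ ℝ ℝ -
      (Real.pi / β) • LinearMap.snd ℝ ℝ ℝ).isLinear (-Real.pi)
  convert (h1.inter h2).inter h3 using 1
  ext z
  simp only [modelTriangle, mem_ofPred_eq, mem_inter_iff, abs_le]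
  constructor
  · rintro ⟨h, h', h''⟩
    exact ⟨⟨h, by linarith⟩, by linarith⟩
  · rintro ⟨⟨h, h'⟩, h''⟩
    exact ⟨h, by linarith, by linarith⟩

/-- A Lipschitz map of the plane to the model triangle, which folds the plane along the horizontal
axis and sends the complement of the folded-out triangle to the two upper sides. -/
def kiteRetract (t β : ℝ) (z : ℝ × ℝ) : ℝ × ℝ :=
  (t * min |z.2| β + max (-(Real.pi - Real.pi / β * min |z.2| β))
    (min (z.1 - t * min |z.2| β) (Real.pi - Real.pi / β * min |z.2| β)), min |z.2| β)

theorem kiteRetract_height_nonneg (hβ : 0 < β) (z : ℝ × ℝ) :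
    0 ≤ Real.pi - Real.pi / β * min |z.2| β := by
  rw [sub_nonneg, div_mul_eq_mul_div, div_le_iff₀ hβ]
  exact mul_le_mul_of_nonneg_left (min_le_right _ _) Real.pi_pos.le

theorem kiteRetract_mem (hβ : 0 < β) (z : ℝ × ℝ) : kiteRetract t β z ∈ modelTriangle t β := by
  have h := kiteRetract_height_nonneg hβ z
  refine ⟨le_min (abs_nonneg _) hβ.le, ?_⟩
  simp only [kiteRetract, add_sub_cancel_left]
  exact abs_le.2 ⟨le_max_left _ _, max_le (by linarith) (min_le_right _ _)⟩

theorem kiteRetract_of_mem (hβ : 0 < β) {z : ℝ × ℝ} (hz : (z.1, |z.2|) ∈ modelTriangle t β) :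
    kiteRetract t β z = (z.1, |z.2|) := by
  have h1 : |z.2| ≤ β := snd_le_of_mem_modelTriangle hβ hz
  have h2 := abs_le.1 hz.2
  simp only [kiteRetract, min_eq_left h1]
  rw [min_eq_left h2.2, max_eq_right h2.1, add_sub_cancel]

theorem kiteRetract_mem_modelSides (hβ : 0 < β) {z : ℝ × ℝ}
    (hz : ¬ |z.1 - t * abs z.2| < Real.pi - Real.pi / β * |z.2|) :
    kiteRetract t β z ∈ modelSides t β := by
  refine ⟨le_min (abs_nonneg _) hβ.le, ?_⟩
  have h := kiteRetract_height_nonneg hβ z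
  simp only [kiteRetract, add_sub_cancel_left]
  rcases le_total β |z.2| with h1 | h1
  · rw [min_eq_right h1] at h ⊢
    rw [div_mul_cancel₀ _ hβ.ne', sub_self, neg_zero, abs_eq_zero]
    exact max_eq_left (min_le_right _ _)
  · rw [min_eq_left h1] at h ⊢
    rcases le_abs.1 (not_lt.1 hz) with h2 | h2
    · rw [min_eq_right h2, max_eq_right (by linarith), abs_of_nonneg h]
    · rw [max_eq_left ((min_le_left _ _).trans (by linarith)), abs_neg, abs_of_nonneg h]

theorem exists_lipschitzWith_kiteRetract : ∃ C, LipschitzWith C (kiteRetract t β) := by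
  have h1 : LipschitzWith 1 fun z : ℝ × ℝ => min |z.2| β :=
    (((lipschitzWith_one_norm (E := ℝ)).comp LipschitzWith.prod_snd).weaken (by simp)).min_const β
  have hmul : ∀ c : ℝ, LipschitzWith ‖c‖₊ fun z : ℝ × ℝ => c * min |z.2| β := fun c =>
    mul_one ‖c‖₊ ▸ (lipschitzWith_smul (α := ℝ) (β := ℝ) c).comp h1
  have h2 := (LipschitzWith.const (α := ℝ × ℝ) Real.pi).sub (hmul (Real.pi / β))
  have h3 := (LipschitzWith.prod_fst (α := ℝ) (β := ℝ)).sub (hmul t)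
  exact ⟨_, ((hmul t).add (h2.neg.max (h3.min h2))).prodMk h1⟩

/-- The even reflection of `|v|` across the base of the model triangle, extended by zero. -/
def kiteExtension (t β : ℝ) (v : ℝ × ℝ → ℝ) (z : ℝ × ℝ) : ℝ := |v (kiteRetract t β z)|

theorem supportedInKite_kiteExtension (hβ : 0 < β) (hv : ∀ z ∈ modelSides t β, v z = 0) :
    SupportedInKite t β (kiteExtension t β v) := by
  intro z hz
  by_contra h
  exact hz (by rw [kiteExtension, hv _ (kiteRetract_mem_modelSides hβ h), abs_zero])

theorem kiteExtension_of_mem (hβ : 0 < β) {z : ℝ × ℝ} (hz : (z.1, |z.2|) ∈ modelTriangle t β) :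
    kiteExtension t β v z = |v (z.1, |z.2|)| := by
  rw [kiteExtension, kiteRetract_of_mem hβ hz]

theorem kiteExtension_of_notMem (hβ : 0 < β) (hv : ∀ z ∈ modelSides t β, v z = 0) {z : ℝ × ℝ}
    (hz : (z.1, |z.2|) ∉ modelTriangle t β) : kiteExtension t β v z = 0 := by
  by_contra h
  exact hz ⟨abs_nonneg _, (supportedInKite_kiteExtension hβ hv z h).le⟩

theorem isAdmissible_kiteExtension (hβ : 0 < β) (hc : ContDiff ℝ 1 v)
    (hv : ∀ z ∈ modelSides t β, v z = 0) : IsAdmissible (kiteExtension t β v) where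
  lipschitz := by
    obtain ⟨g, hg, hgc, hgv⟩ := exists_contDiff_eventuallyEq (isCompact_modelTriangle (t := t) hβ)
      isOpen_univ (subset_univ _) hc.contDiffOn
    obtain ⟨C, hC⟩ := hg.lipschitzWith_of_hasCompactSupport hgc one_ne_zero
    obtain ⟨D, hD⟩ := exists_lipschitzWith_kiteRetract (t := t) (β := β)
    have := (lipschitzWith_one_norm (E := ℝ)).comp (hC.comp hD)
    refine ⟨_, (?_ : kiteExtension t β v = norm ∘ (g ∘ kiteRetract t β)) ▸ this⟩
    funext z
    rw [Function.comp_apply, Function.comp_apply, (hgv _ (kiteRetract_mem hβ z)).eq_of_nhds]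
    rfl
  compact := by
    refine HasCompactSupport.intro (K := modelTriangle t β ∪
        (fun z : ℝ × ℝ => (z.1, -z.2)) '' modelTriangle t β)
      ((isCompact_modelTriangle hβ).union ((isCompact_modelTriangle hβ).image (by fun_prop)))
      fun z hz => kiteExtension_of_notMem hβ hv fun h => hz ?_
    rcases abs_choice z.2 with h' | h' <;> rw [h'] at h
    · exact Or.inl h
    · exact Or.inr ⟨_, h, by simp⟩
  nonneg z := abs_nonneg _

theorem kiteExtension_reflect (z : ℝ × ℝ) :
    kiteExtension t β v (z.1, -z.2) = kiteExtension t β v z := by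
  simp [kiteExtension, kiteRetract]

theorem integral_eq_two_mul_of_even {F : ℝ × ℝ → ℝ} (hF : Integrable F)
    (he : ∀ z : ℝ × ℝ, F (z.1, -z.2) = F z) :
    ∫ z, F z = 2 * ∫ z in {z : ℝ × ℝ | 0 < z.2}, F z := by
  have hH : MeasurableSet {z : ℝ × ℝ | 0 < z.2} :=
    (isOpen_lt continuous_const continuous_snd).measurableSet
  have hmp : MeasurePreserving (fun z : ℝ × ℝ => (z.1, -z.2)) volume volume :=
    (MeasurePreserving.id volume).prod (Measure.measurePreserving_neg volume)
  have hemb : MeasurableEmbedding fun z : ℝ × ℝ => (z.1, -z.2) :=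
    ((Homeomorph.refl ℝ).prodCongr (Homeomorph.neg ℝ)).measurableEmbedding
  have h := hmp.setIntegral_preimage_emb hemb F {z : ℝ × ℝ | 0 < z.2}
  simp only [he] at h
  rw [← integral_add_compl hH hF, two_mul]
  congr 1
  rw [← h]
  refine setIntegral_congr_set ?_
  have h0 : ∀ᵐ z : ℝ × ℝ, z.2 ≠ 0 :=
    Measure.quasiMeasurePreserving_snd.ae (Measure.ae_ne volume (0 : ℝ))
  filter_upwards [h0] with z hz
  refine propext (show ¬ 0 < z.2 ↔ 0 < -z.2 from ?_)
  rw [not_lt, neg_pos]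
  exact ⟨fun h => lt_of_le_of_ne h hz, le_of_lt⟩

theorem setIntegral_upper_indicator (G : ℝ × ℝ → ℝ) :
    ∫ z in {z : ℝ × ℝ | 0 < z.2}, (modelTriangle t β).indicator G z =
      ∫ z in modelTriangle t β, G z := by
  rw [setIntegral_indicator isClosed_modelTriangle.measurableSet]
  refine setIntegral_congr_set ?_
  have h0 : ∀ᵐ z : ℝ × ℝ, z.2 ≠ 0 :=
    Measure.quasiMeasurePreserving_snd.ae (Measure.ae_ne volume (0 : ℝ))
  filter_upwards [h0] with z hz
  refine propext (show 0 < z.2 ∧ z ∈ modelTriangle t β ↔ z ∈ modelTriangle t β from ?_)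
  exact ⟨And.right, fun h => ⟨lt_of_le_of_ne h.1 hz.symm, h⟩⟩

theorem sqNorm_kiteExtension (hβ : 0 < β) (hc : ContDiff ℝ 1 v)
    (hv : ∀ z ∈ modelSides t β, v z = 0) :
    sqNorm (kiteExtension t β v) = 2 * ∫ z in modelTriangle t β, v z ^ 2 := by
  rw [sqNorm, integral_eq_two_mul_of_even (isAdmissible_kiteExtension hβ hc hv).integrable_sq
    fun z => by rw [kiteExtension_reflect], ← setIntegral_upper_indicator]
  congr 1
  refine setIntegral_congr_fun (isOpen_lt continuous_const continuous_snd).measurableSet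
    fun z (hz : 0 < z.2) => ?_
  have hz' : (z.1, |z.2|) = z := by rw [abs_of_pos hz]
  by_cases h : z ∈ modelTriangle t β
  · rw [indicator_of_mem h, kiteExtension_of_mem hβ (by rwa [hz']), hz', sq_abs]
  · rw [indicator_of_notMem h, kiteExtension_of_notMem hβ hv (by rwa [hz'])]
    ring

theorem lineDeriv_kiteExtension_sq_le (hβ : 0 < β) (hc : ContDiff ℝ 1 v)
    (hv : ∀ z ∈ modelSides t β, v z = 0) {z : ℝ × ℝ} (hz : 0 < z.2) (e : ℝ × ℝ) :
    lineDeriv ℝ (kiteExtension t β v) z e ^ 2 ≤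
      (modelTriangle t β).indicator (fun z => fderiv ℝ v z e ^ 2) z := by
  by_cases hw : kiteExtension t β v z = 0
  · rw [lineDeriv_eq_zero_of_nonneg (w := kiteExtension t β v) (fun z => abs_nonneg _) hw, zero_pow two_ne_zero]
    exact indicator_nonneg (fun z _ => sq_nonneg _) z
  have hs := supportedInKite_kiteExtension hβ hv z hw
  rw [abs_of_pos hz] at hs
  have hmem : z ∈ modelTriangle t β := ⟨hz.le, hs.le⟩
  have hev : kiteExtension t β v =ᶠ[𝓝 z] fun z => |v z| := by
    have h1 : ∀ᶠ z : ℝ × ℝ in 𝓝 z, 0 < z.2 :=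
      (isOpen_lt continuous_const continuous_snd).mem_nhds hz
    have h2 : ∀ᶠ z : ℝ × ℝ in 𝓝 z, |z.1 - t * z.2| < Real.pi - Real.pi / β * z.2 :=
      (isOpen_lt (by fun_prop) (by fun_prop)).mem_nhds hs
    filter_upwards [h1, h2] with y hy hy'
    have : (y.1, |y.2|) = y := by rw [abs_of_pos hy]
    rw [kiteExtension_of_mem hβ (by rw [this]; exact ⟨hy.le, hy'.le⟩), this]
  rw [indicator_of_mem hmem, hev.lineDeriv_eq]
  have hvz : v z ≠ 0 := fun h => hw (by rw [hev.eq_of_nhds, h, abs_zero])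
  have hd := (hc.differentiable one_ne_zero z).lineDeriv_eq_fderiv (v := e)
  rcases lt_or_gt_of_ne hvz with h | h
  · have : (fun z => |v z|) =ᶠ[𝓝 z] fun z => -v z := by
      filter_upwards [hc.continuous.continuousAt.eventually_lt continuousAt_const h] with y hy
      exact abs_of_neg hy
    rw [this.lineDeriv_eq, ← hd]
    simp [lineDeriv, deriv.fun_neg]
  · have : (fun z => |v z|) =ᶠ[𝓝 z] v := by
      filter_upwards [continuousAt_const.eventually_lt hc.continuous.continuousAt h] with y hy
      exact abs_of_pos hy
    rw [this.lineDeriv_eq, hd]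

theorem dirEnergy_kiteExtension_le (hβ : 0 < β) (hc : ContDiff ℝ 1 v)
    (hv : ∀ z ∈ modelSides t β, v z = 0) {e : ℝ × ℝ} (he : (e.1, -e.2) = e ∨ (e.1, -e.2) = -e) :
    dirEnergy (kiteExtension t β v) e ≤ 2 * ∫ z in modelTriangle t β, fderiv ℝ v z e ^ 2 := by
  have hA := isAdmissible_kiteExtension hβ hc hv
  obtain ⟨C, hC⟩ := hA.lipschitz
  have hi := integrable_lineDeriv_sq (μ := volume) hC hA.compact e
  have hcont : Continuous fun z => fderiv ℝ v z e ^ 2 :=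
    ((hc.continuous_fderiv one_ne_zero).clm_apply continuous_const).pow 2
  have heven : ∀ z : ℝ × ℝ, lineDeriv ℝ (kiteExtension t β v) (z.1, -z.2) e ^ 2 =
      lineDeriv ℝ (kiteExtension t β v) z e ^ 2 := fun z => by
    have h1 : lineDeriv ℝ (kiteExtension t β v) (z.1, -z.2) e =
        lineDeriv ℝ (kiteExtension t β v) z (e.1, -e.2) := by
      simp only [lineDeriv]
      congr 1
      funext s
      rw [← kiteExtension_reflect]
      congr 1
      ext <;> simp
      ring
    rw [h1]
    rcases he with h | h <;> rw [h]
    rw [lineDeriv_neg, neg_sq]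
  rw [dirEnergy, integral_eq_two_mul_of_even hi heven, ← setIntegral_upper_indicator]
  refine mul_le_mul_of_nonneg_left ?_ zero_le_two
  refine setIntegral_mono_on hi.integrableOn ?_
    (isOpen_lt continuous_const continuous_snd).measurableSet
    fun z hz => lineDeriv_kiteExtension_sq_le hβ hc hv hz e
  exact ((hcont.continuousOn.integrableOn_compact (isCompact_modelTriangle hβ)).integrable_indicator
    isClosed_modelTriangle.measurableSet).integrableOn

theorem modelTriangle_energy_bound (hβ : 0 < β) {Λ : ℝ}
    (hΛ : ∀ w, IsAdmissible w → SupportedInKite t β w →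
      Λ * sqNorm w ≤ dirEnergy w (1, 0) + dirEnergy w (0, 1))
    (hc : ContDiff ℝ 1 v) (hv : ∀ z ∈ modelSides t β, v z = 0) :
    Λ * ∫ z in modelTriangle t β, v z ^ 2 ≤ ∫ z in modelTriangle t β,
      (fderiv ℝ v z (1, 0) ^ 2 + fderiv ℝ v z (0, 1) ^ 2) := by
  have h := hΛ _ (isAdmissible_kiteExtension hβ hc hv) (supportedInKite_kiteExtension hβ hv)
  have h1 := dirEnergy_kiteExtension_le hβ hc hv (e := (1, 0)) (by simp)
  have h2 := dirEnergy_kiteExtension_le hβ hc hv (e := (0, 1)) (by simp)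
  rw [sqNorm_kiteExtension hβ hc hv] at h
  have hi : ∀ e, IntegrableOn (fun z => fderiv ℝ v z e ^ 2) (modelTriangle t β) := fun e =>
    (((hc.continuous_fderiv one_ne_zero).clm_apply continuous_const).pow
      2).continuousOn.integrableOn_compact (isCompact_modelTriangle hβ)
  rw [integral_add (hi _) (hi _)]
  linarith

end ModelTriangle

section KiteGap

variable {t β : ℝ}

theorem isotropic_constant_sub (hβ : 0 < β) :
    (Real.pi ^ 2 + β ^ 2) / (4 * β ^ 2) + Real.pi ^ 2 / (Real.pi ^ 2 + β ^ 2) - Real.pi / β =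
      (Real.pi - β) ^ 4 / (4 * β ^ 2 * (Real.pi ^ 2 + β ^ 2)) := by
  have h : Real.pi ^ 2 + β ^ 2 ≠ 0 := by positivity
  field_simp
  ring

theorem kite_rayleigh_bound (hβ : 0 < β) {w : ℝ × ℝ → ℝ} (hw : IsAdmissible w)
    (hs : SupportedInKite t β w) :
    Real.pi / β * sqNorm w ≤ dirEnergy w (1, 0) + dirEnergy w (0, 1) := by
  refine le_trans ?_ (kite_isotropic_bound hw hβ hs)
  rw [← add_mul]
  refine mul_le_mul_of_nonneg_right ?_ sqNorm_nonneg
  rw [← sub_nonneg, isotropic_constant_sub hβ]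
  positivity

theorem exists_kite_energy_gap (hβ : 0 < β) (h : ¬(t = 0 ∧ β = Real.pi))
    (ht : β = Real.pi → |t| < 1) : ∃ Λ, Real.pi / β < Λ ∧ ∀ w, IsAdmissible w →
      SupportedInKite t β w → Λ * sqNorm w ≤ dirEnergy w (1, 0) + dirEnergy w (0, 1) := by
  by_cases hβπ : β = Real.pi
  · obtain ⟨δ, hδ, hw⟩ := kite_strict_bound (fun h0 => h ⟨h0, hβπ⟩) (ht hβπ)
    subst hβπ
    exact ⟨1 + δ, by rw [div_self hβ.ne']; linarith, hw⟩
  · refine ⟨_, ?_, fun w hw hs => (add_mul _ _ (sqNorm w)).trans_le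
      (kite_isotropic_bound hw hβ hs)⟩
    have h0 : Real.pi - β ≠ 0 := fun h0 => hβπ (by linarith)
    rw [← sub_pos, isotropic_constant_sub hβ]
    have := (Nat.even_iff.2 (by norm_num) : Even 4).pow_pos h0
    positivity

end KiteGap

section ModelIntegrals

variable {t β : ℝ}

theorem setIntegral_piDiamond_of_even {G : ℝ × ℝ → ℝ} (hG : Continuous G)
    (he : ∀ z : ℝ × ℝ, G (z.1, -z.2) = G z) :
    ∫ z in piDiamond, G z = 2 * ∫ z in modelTriangle 0 Real.pi, G z := by
  have hm := isClosed_piDiamond.measurableSet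
  have hi : Integrable (piDiamond.indicator G) :=
    (hG.continuousOn.integrableOn_compact isCompact_piDiamond).integrable_indicator hm
  rw [← integral_indicator hm, integral_eq_two_mul_of_even hi fun z => ?_,
    ← setIntegral_upper_indicator]
  · congr 1
    refine setIntegral_congr_fun (isOpen_lt continuous_const continuous_snd).measurableSet
      fun z (hz : 0 < z.2) => ?_
    have : z ∈ piDiamond ↔ z ∈ modelTriangle 0 Real.pi := by
      simp only [piDiamond, modelTriangle, mem_ofPred_eq, abs_of_pos hz, hz.le, true_and, zero_mul,
        sub_zero, div_self Real.pi_pos.ne', one_mul, le_sub_iff_add_le]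
    by_cases h : z ∈ piDiamond
    · simp [h, this.1 h]
    · simp [h, this.not.1 h]
  · have : (z.1, -z.2) ∈ piDiamond ↔ z ∈ piDiamond := by simp [piDiamond]
    by_cases h : z ∈ piDiamond
    · simp [h, this.2 h, he]
    · simp [h, this.not.2 h]

theorem setIntegral_modelTriangle_one (hβ : 0 < β) :
    ∫ _ in modelTriangle t β, (1 : ℝ) = Real.pi * β := by
  have hπ := Real.pi_pos
  have hdet : 1 * (β / Real.pi) - (t * (β / Real.pi)) * 0 ≠ 0 := by
    rw [one_mul, mul_zero, sub_zero]
    positivity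
  have h := integral_planeAffine 0 hdet ((modelTriangle t β).indicator fun _ => (1 : ℝ))
  have hpre : ∀ z : ℝ × ℝ, (modelTriangle t β).indicator (fun _ => (1 : ℝ))
      (0 + planeMap 1 (t * (β / Real.pi)) 0 (β / Real.pi) z) =
        (modelTriangle 0 Real.pi).indicator (fun _ => 1) z := by
    intro z
    have : 0 + planeMap 1 (t * (β / Real.pi)) 0 (β / Real.pi) z ∈ modelTriangle t β ↔
        z ∈ modelTriangle 0 Real.pi := by
      have e1 : 0 ≤ β / Real.pi * z.2 ↔ 0 ≤ z.2 := mul_nonneg_iff_of_pos_left (by positivity)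
      have e2 : Real.pi / β * (β / Real.pi * z.2) = z.2 := by field_simp
      simp only [modelTriangle, mem_ofPred_eq, zero_add, planeMap_apply, zero_mul, e1, e2,
        div_self hπ.ne', one_mul, sub_zero, mul_assoc, add_sub_cancel_right]
    by_cases h : z ∈ modelTriangle 0 Real.pi
    · rw [indicator_of_mem h, indicator_of_mem (this.2 h)]
    · rw [indicator_of_notMem h, indicator_of_notMem (this.not.2 h)]
  simp only [hpre] at h
  rw [integral_indicator isClosed_modelTriangle.measurableSet,
    integral_indicator isClosed_modelTriangle.measurableSet] at h
  have h2 := setIntegral_piDiamond_of_even (G := fun _ => 1) continuous_const fun _ => rfl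
  rw [integral_piDiamond_const, h, one_mul, mul_zero, sub_zero, abs_of_pos (by positivity)] at h2
  field_simp at h2
  linarith

theorem setIntegral_cos_add_cos_sq :
    ∫ z in modelTriangle 0 Real.pi, (Real.cos z.1 + Real.cos z.2) ^ 2 = Real.pi ^ 2 := by
  have hc : ∀ {G : ℝ × ℝ → ℝ}, Continuous G → IntegrableOn G piDiamond := fun hG =>
    hG.continuousOn.integrableOn_compact isCompact_piDiamond
  have h := setIntegral_piDiamond_of_even (G := fun z => (Real.cos z.1 + Real.cos z.2) ^ 2)
    (by fun_prop) fun z => by simp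
  have e : ∀ z : ℝ × ℝ, (Real.cos z.1 + Real.cos z.2) ^ 2 =
      2 - Real.sin z.1 ^ 2 - Real.sin z.2 ^ 2 + 2 * (Real.cos z.1 * Real.cos z.2) := fun z => by
    rw [Real.sin_sq, Real.sin_sq]
    ring
  have i1 : IntegrableOn (fun z : ℝ × ℝ => 2 - Real.sin z.1 ^ 2) piDiamond := hc (by fun_prop)
  have i2 : IntegrableOn (fun z : ℝ × ℝ => 2 - Real.sin z.1 ^ 2 - Real.sin z.2 ^ 2) piDiamond :=
    hc (by fun_prop)
  rw [integral_congr_ae (Filter.Eventually.of_forall e),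
    integral_add i2 (hc (by fun_prop)), integral_sub i1 (hc (by fun_prop)),
    integral_sub (hc continuous_const) (hc (by fun_prop)), integral_const_mul,
    integral_piDiamond_const, integral_piDiamond_sin_sq_fst, integral_piDiamond_sin_sq_snd,
    integral_piDiamond_cos_mul_cos] at h
  linarith

theorem setIntegral_sin_sq_add_sin_sq :
    ∫ z in modelTriangle 0 Real.pi, (Real.sin z.1 ^ 2 + Real.sin z.2 ^ 2) = Real.pi ^ 2 := by
  have hc : ∀ {G : ℝ × ℝ → ℝ}, Continuous G → IntegrableOn G piDiamond := fun hG =>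
    hG.continuousOn.integrableOn_compact isCompact_piDiamond
  have h := setIntegral_piDiamond_of_even (G := fun z => Real.sin z.1 ^ 2 + Real.sin z.2 ^ 2)
    (by fun_prop) fun z => by simp
  rw [integral_add (hc (by fun_prop)) (hc (by fun_prop)), integral_piDiamond_sin_sq_fst,
    integral_piDiamond_sin_sq_snd] at h
  linarith

theorem convexHull_modelTriangle (hβ : 0 < β) :
    convexHull ℝ {(t * β, β), (-Real.pi, 0), (Real.pi, 0)} = modelTriangle t β := by
  have hπ := Real.pi_pos
  refine Subset.antisymm (convexHull_min ?_ convex_modelTriangle) fun z hz => ?_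
  · rintro z (rfl | rfl | rfl)
    · exact ⟨hβ.le, by simp [div_mul_cancel₀ _ hβ.ne']⟩
    · exact ⟨le_rfl, by simp [abs_of_pos hπ]⟩
    · exact ⟨le_rfl, by simp [abs_of_pos hπ]⟩
  · set s : Set (ℝ × ℝ) := {(t * β, β), (-Real.pi, 0), (Real.pi, 0)} with hs
    have h2 := abs_le.1 hz.2
    have hsum := (convex_convexHull ℝ s).sum_mem (t := Finset.univ)
      (w := ![z.2 / β, (1 - z.2 / β - (z.1 - t * z.2) / Real.pi) / 2,
        (1 - z.2 / β + (z.1 - t * z.2) / Real.pi) / 2])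
      (z := ![(t * β, β), (-Real.pi, 0), (Real.pi, 0)]) ?_ ?_ ?_
    · convert hsum using 1
      ext
      · simp [Fin.sum_univ_three]
        field_simp
        ring
      · simp [Fin.sum_univ_three]
        field_simp
    · have e1 : 1 - z.2 / β - (z.1 - t * z.2) / Real.pi =
          (Real.pi - Real.pi / β * z.2 - (z.1 - t * z.2)) / Real.pi := by field_simp
      have e2 : 1 - z.2 / β + (z.1 - t * z.2) / Real.pi =
          (Real.pi - Real.pi / β * z.2 + (z.1 - t * z.2)) / Real.pi := by field_simp
      intro i _
      fin_cases i
      · exact div_nonneg hz.1 hβ.le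
      · exact div_nonneg (e1 ▸ div_nonneg (by linarith) hπ.le) zero_le_two
      · exact div_nonneg (e2 ▸ div_nonneg (by linarith) hπ.le) zero_le_two
    · simp [Fin.sum_univ_three]
      ring
    · intro i _
      fin_cases i <;> exact subset_convexHull ℝ s (by simp [hs])

theorem modelSides_eq (hβ : 0 < β) : modelSides t β =
    segment ℝ (t * β, β) (Real.pi, 0) ∪ segment ℝ (t * β, β) (-Real.pi, 0) := by
  have hπ := Real.pi_pos
  ext z
  constructor
  · rintro ⟨h0, h1⟩
    have h2 : z.2 ≤ β := snd_le_of_mem_modelTriangle hβ ⟨h0, h1.le⟩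
    have h3 : 0 ≤ 1 - z.2 / β := by
      rw [sub_nonneg, div_le_one hβ]
      exact h2
    have h4 : 0 ≤ Real.pi - Real.pi / β * z.2 := h1 ▸ abs_nonneg _
    rcases (abs_eq h4).1 h1 with h | h
    · refine Or.inl ⟨z.2 / β, 1 - z.2 / β, div_nonneg h0 hβ.le, h3, by ring, ?_⟩
      ext
      · rw [sub_eq_iff_eq_add] at h
        simp [h]
        field_simp
        ring
      · simp
        field_simp
    · refine Or.inr ⟨z.2 / β, 1 - z.2 / β, div_nonneg h0 hβ.le, h3, by ring, ?_⟩
      ext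
      · rw [sub_eq_iff_eq_add] at h
        simp [h]
        field_simp
        ring
      · simp
        field_simp
  · rintro (⟨a, b, ha, hb, hab, rfl⟩ | ⟨a, b, ha, hb, hab, rfl⟩) <;>
    · refine ⟨by simpa using mul_nonneg ha hβ.le, ?_⟩
      have e : Real.pi - Real.pi / β * (a * β) = Real.pi * b := by
        rw [← eq_sub_iff_add_eq'] at hab
        rw [hab]
        field_simp
      have e' : a * (t * β) + b * Real.pi - t * (a * β) = Real.pi * b := by ring
      have e'' : a * (t * β) + -(b * Real.pi) - t * (a * β) = -(Real.pi * b) := by ring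
      simp [e, e', e'', abs_of_nonneg hb, abs_of_pos hπ]

end ModelIntegrals

section PlaneChart

variable {O E : E2} {ε : ℝ}

/-- The linear map sending the standard basis of `ℝ × ℝ` to `E` and to `ε` times the rotation of `E`
by a right angle. -/
def chartLinear (E : E2) (ε : ℝ) : ℝ × ℝ →L[ℝ] E2 :=
  (ContinuousLinearMap.fst ℝ ℝ ℝ).smulRight E +
    (ContinuousLinearMap.snd ℝ ℝ ℝ).smulRight (ε • !₂[-E 1, E 0])

/-- The affine chart of the plane with origin `O` and linear part `chartLinear E ε`. -/
def planeChart (O E : E2) (ε : ℝ) (z : ℝ × ℝ) : E2 := O + chartLinear E ε z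

/-- The inverse of `planeChart O E ε` when `E ≠ 0` and `ε ^ 2 = 1`. -/
def planeChartInv (O E : E2) (ε : ℝ) (x : E2) : ℝ × ℝ :=
  ((E 0 * (x 0 - O 0) + E 1 * (x 1 - O 1)) / ‖E‖ ^ 2,
    ε * (E 0 * (x 1 - O 1) - E 1 * (x 0 - O 0)) / ‖E‖ ^ 2)

theorem norm_sq_eq_coord (x : E2) : ‖x‖ ^ 2 = x 0 ^ 2 + x 1 ^ 2 := by
  rw [EuclideanSpace.norm_sq_eq, Fin.sum_univ_two, Real.norm_eq_abs, Real.norm_eq_abs, sq_abs,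
    sq_abs]

@[simp] theorem planeChart_zero (z : ℝ × ℝ) :
    planeChart O E ε z 0 = O 0 + (E 0 * z.1 + -(ε * E 1) * z.2) := by
  simp [planeChart, chartLinear]
  ring

@[simp] theorem planeChart_one (z : ℝ × ℝ) :
    planeChart O E ε z 1 = O 1 + (E 1 * z.1 + ε * E 0 * z.2) := by
  simp [planeChart, chartLinear]
  ring

theorem planeChart_planeChartInv (hE : E ≠ 0) (hε : ε ^ 2 = 1) (x : E2) :
    planeChart O E ε (planeChartInv O E ε x) = x := by
  have h := norm_sq_eq_coord E
  have h0 : ‖E‖ ^ 2 ≠ 0 := by positivity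
  ext i
  fin_cases i
  · simp only [Fin.zero_eta, planeChart_zero, planeChartInv]
    field_simp
    linear_combination (O 0 - x 0) * h + (E 1 ^ 2 * (x 0 - O 0) - E 0 * E 1 * (x 1 - O 1)) * hε
  · simp only [Fin.mk_one, planeChart_one, planeChartInv]
    field_simp
    linear_combination (O 1 - x 1) * h + (E 0 ^ 2 * (x 1 - O 1) - E 0 * E 1 * (x 0 - O 0)) * hε

theorem planeChartInv_planeChart (hE : E ≠ 0) (hε : ε ^ 2 = 1) (z : ℝ × ℝ) :
    planeChartInv O E ε (planeChart O E ε z) = z := by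
  have h := norm_sq_eq_coord E
  have h0 : ‖E‖ ^ 2 ≠ 0 := by positivity
  ext
  · simp only [planeChart_zero, planeChart_one, planeChartInv]
    rw [div_eq_iff h0]
    linear_combination -z.1 * h
  · simp only [planeChart_zero, planeChart_one, planeChartInv]
    rw [div_eq_iff h0]
    linear_combination -z.2 * h + z.2 * (E 0 ^ 2 + E 1 ^ 2) * hε

theorem contDiff_planeChart {n : WithTop ℕ∞} : ContDiff ℝ n (planeChart O E ε) :=
  contDiff_const.add (chartLinear E ε).contDiff

theorem contDiff_planeChartInv {n : WithTop ℕ∞} : ContDiff ℝ n (planeChartInv O E ε) := by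
  have h : ∀ i, ContDiff ℝ n fun x : E2 => x i := fun i =>
    (EuclideanSpace.proj (𝕜 := ℝ) i).contDiff
  have h0 := (h 0).sub (contDiff_const (c := O 0))
  have h1 := (h 1).sub (contDiff_const (c := O 1))
  exact (((contDiff_const.mul h0).add (contDiff_const.mul h1)).div_const _).prodMk
    ((contDiff_const.mul ((contDiff_const.mul h1).sub (contDiff_const.mul h0))).div_const _)

theorem dual_norm_sq_eq_coord (φ : E2 →L[ℝ] ℝ) : ‖φ‖ ^ 2 = φ !₂[1, 0] ^ 2 + φ !₂[0, 1] ^ 2 := by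
  obtain ⟨y, rfl⟩ := (InnerProductSpace.toDual ℝ E2).surjective φ
  rw [LinearIsometryEquiv.norm_map, norm_sq_eq_coord]
  simp [InnerProductSpace.toDual_apply_apply, PiLp.inner_apply, Fin.sum_univ_two]

theorem dual_chartLinear_sq_add_sq (hε : ε ^ 2 = 1) (φ : E2 →L[ℝ] ℝ) :
    φ (chartLinear E ε (1, 0)) ^ 2 + φ (chartLinear E ε (0, 1)) ^ 2 = ‖E‖ ^ 2 * ‖φ‖ ^ 2 := by
  have h : ∀ x : E2, φ x = x 0 * φ !₂[1, 0] + x 1 * φ !₂[0, 1] := fun x => by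
    rw [← smul_eq_mul, ← smul_eq_mul, ← map_smul, ← map_smul, ← map_add]
    congr 1
    ext i
    fin_cases i <;> simp
  rw [h (chartLinear E ε (1, 0)), h (chartLinear E ε (0, 1)), dual_norm_sq_eq_coord,
    norm_sq_eq_coord]
  simp [chartLinear]
  linear_combination (E 0 * φ !₂[0, 1] - E 1 * φ !₂[1, 0]) ^ 2 * hε

theorem measurePreserving_toLp_prod :
    MeasurePreserving (fun z : ℝ × ℝ => (!₂[z.1, z.2] : E2)) volume volume :=
  (PiLp.volume_preserving_toLp (Fin 2)).comp (volume_preserving_finTwoArrow ℝ).symm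

theorem integral_planeChart (hE : E ≠ 0) (hε : ε ^ 2 = 1) (G : E2 → ℝ) :
    ∫ x, G x = ‖E‖ ^ 2 * ∫ z, G (planeChart O E ε z) := by
  have hN : 0 < ‖E‖ ^ 2 := by positivity
  have hdet : E 0 * (ε * E 0) - -(ε * E 1) * E 1 = ε * ‖E‖ ^ 2 := by
    rw [norm_sq_eq_coord]
    ring
  have habs : |ε| = 1 := by
    rw [← sq_eq_sq₀ (abs_nonneg _) zero_le_one, sq_abs, hε, one_pow]
  have hemb : MeasurableEmbedding fun z : ℝ × ℝ => (!₂[z.1, z.2] : E2) :=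
    ((MeasurableEquiv.finTwoArrow (α := ℝ)).symm.trans
      (MeasurableEquiv.toLp 2 (Fin 2 → ℝ))).measurableEmbedding
  have hne : E 0 * (ε * E 0) - -(ε * E 1) * E 1 ≠ 0 := by
    rw [hdet]
    exact mul_ne_zero (fun h => by simp [h] at hε) hN.ne'
  have h := integral_planeAffine (O 0, O 1) hne fun z => G !₂[z.1, z.2]
  rw [measurePreserving_toLp_prod.integral_comp hemb G, hdet, abs_mul, habs, one_mul,
    abs_of_pos hN] at h
  rw [← mul_inv_cancel_left₀ hN.ne' (∫ x, G x), ← h]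
  congr 2
  funext z
  congr 1
  ext i
  fin_cases i <;> simp

end PlaneChart

section TriangleTransfer

open Filter Topology

variable {O E : E2} {ε t β : ℝ}

/-- The triangle with vertices `planeChart O E ε` of `(t * β, β)`, `(-π, 0)` and `(π, 0)`. -/
def chartTriangle (O E : E2) (ε t β : ℝ) : Set E2 :=
  convexHull ℝ {planeChart O E ε (t * β, β), planeChart O E ε (-Real.pi, 0),
    planeChart O E ε (Real.pi, 0)}

/-- The two sides of `chartTriangle O E ε t β` which meet at the vertex
`planeChart O E ε (t * β, β)`. -/
def chartSides (O E : E2) (ε t β : ℝ) : Set E2 :=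
  segment ℝ (planeChart O E ε (t * β, β)) (planeChart O E ε (Real.pi, 0)) ∪
    segment ℝ (planeChart O E ε (t * β, β)) (planeChart O E ε (-Real.pi, 0))

/-- `planeChart O E ε` as an affine map. -/
def planeChartAffine (O E : E2) (ε : ℝ) : ℝ × ℝ →ᵃ[ℝ] E2 :=
  AffineMap.const ℝ (ℝ × ℝ) O + (chartLinear E ε : ℝ × ℝ →ₗ[ℝ] E2).toAffineMap

theorem coe_planeChartAffine : ⇑(planeChartAffine O E ε) = planeChart O E ε := rfl

theorem injective_planeChart (hE : E ≠ 0) (hε : ε ^ 2 = 1) :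
    Function.Injective (planeChart O E ε) :=
  Function.LeftInverse.injective (planeChartInv_planeChart hE hε)

theorem image_modelTriangle (hβ : 0 < β) :
    planeChart O E ε '' modelTriangle t β = chartTriangle O E ε t β := by
  rw [← convexHull_modelTriangle hβ, ← coe_planeChartAffine, AffineMap.image_convexHull,
    image_insert_eq, image_pair, chartTriangle, coe_planeChartAffine]

theorem image_modelSides (hβ : 0 < β) :
    planeChart O E ε '' modelSides t β = chartSides O E ε t β := by
  rw [modelSides_eq hβ, image_union, ← coe_planeChartAffine, image_segment, image_segment,
    chartSides, coe_planeChartAffine]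

theorem setIntegral_interior_chartTriangle (hE : E ≠ 0) (hε : ε ^ 2 = 1) (hβ : 0 < β)
    (G : E2 → ℝ) : ∫ x in interior (chartTriangle O E ε t β), G x =
      ‖E‖ ^ 2 * ∫ z in modelTriangle t β, G (planeChart O E ε z) := by
  have hconv : Convex ℝ (chartTriangle O E ε t β) := convex_convexHull ℝ _
  have hclosed : IsClosed (chartTriangle O E ε t β) := by
    rw [← image_modelTriangle hβ]
    exact ((isCompact_modelTriangle hβ).image
      (contDiff_planeChart (n := 0)).continuous).isClosed
  rw [setIntegral_congr_set
    (interior_ae_eq_of_null_frontier (hconv.addHaar_frontier volume)),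
    ← integral_indicator hclosed.measurableSet, integral_planeChart hE hε,
    ← integral_indicator isClosed_modelTriangle.measurableSet]
  congr 2
  funext z
  have : planeChart O E ε z ∈ chartTriangle O E ε t β ↔ z ∈ modelTriangle t β := by
    rw [← image_modelTriangle hβ, (injective_planeChart hE hε).mem_set_image]
  by_cases h : z ∈ modelTriangle t β
  · rw [indicator_of_mem h, indicator_of_mem (this.2 h)]
  · rw [indicator_of_notMem h, indicator_of_notMem (this.not.2 h)]

theorem area2_chartTriangle (hE : E ≠ 0) (hε : ε ^ 2 = 1) (hβ : 0 < β) :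
    area2 (chartTriangle O E ε t β) = ‖E‖ ^ 2 * (Real.pi * β) := by
  have h := setIntegral_interior_chartTriangle (O := O) (t := t) hE hε hβ fun _ => 1
  have hconv : Convex ℝ (chartTriangle O E ε t β) := convex_convexHull ℝ _
  rw [setIntegral_modelTriangle_one hβ, setIntegral_const, smul_eq_mul, mul_one,
    measureReal_congr (interior_ae_eq_of_null_frontier (hconv.addHaar_frontier volume))] at h
  exact h

theorem rayleigh_chartTriangle (hE : E ≠ 0) (hε : ε ^ 2 = 1) (hβ : 0 < β) {u : E2 → ℝ}
    (hu : ContDiff ℝ (⊤ : ℕ∞) u) : rayleigh (interior (chartTriangle O E ε t β)) u =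
      (∫ z in modelTriangle t β, (fderiv ℝ (u ∘ planeChart O E ε) z (1, 0) ^ 2 +
        fderiv ℝ (u ∘ planeChart O E ε) z (0, 1) ^ 2)) /
      (‖E‖ ^ 2 * ∫ z in modelTriangle t β, (u ∘ planeChart O E ε) z ^ 2) := by
  have hf : ∀ z e, fderiv ℝ (u ∘ planeChart O E ε) z e =
      fderiv ℝ u (planeChart O E ε z) (chartLinear E ε e) := fun z e => by
    have h1 : HasFDerivAt (planeChart O E ε) (chartLinear E ε) z :=
      (chartLinear E ε).hasFDerivAt.const_add O
    have h2 := (hu.differentiable (by simp) (planeChart O E ε z)).hasFDerivAt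
    rw [(h2.comp z h1).fderiv]
    rfl
  simp only [hf, dual_chartLinear_sq_add_sq hε]
  rw [rayleigh, setIntegral_interior_chartTriangle hE hε hβ,
    setIntegral_interior_chartTriangle hE hε hβ, integral_const_mul]
  rfl

theorem setIntegral_sq_pos_of_notAEZero (hE : E ≠ 0) (hε : ε ^ 2 = 1) (hβ : 0 < β) {u : E2 → ℝ}
    (hu : Continuous u) (h : NotAEZero (interior (chartTriangle O E ε t β)) u) :
    0 < ∫ z in modelTriangle t β, (u ∘ planeChart O E ε) z ^ 2 := by
  refine lt_of_le_of_ne (integral_nonneg fun z => sq_nonneg _) fun h0 => h ?_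
  have h1 := setIntegral_interior_chartTriangle (O := O) (t := t) hE hε hβ fun x => u x ^ 2
  have hcomp : IsCompact (chartTriangle O E ε t β) := by
    rw [← image_modelTriangle hβ]
    exact (isCompact_modelTriangle hβ).image (contDiff_planeChart (n := 0)).continuous
  have hi : IntegrableOn (fun x => u x ^ 2) (interior (chartTriangle O E ε t β)) :=
    ((hu.pow 2).continuousOn.integrableOn_compact hcomp).mono_set interior_subset
  have h2 : ∫ x in interior (chartTriangle O E ε t β), u x ^ 2 = 0 := by
    rw [h1]
    exact mul_eq_zero_of_right _ h0.symm
  rw [integral_eq_zero_iff_of_nonneg (fun x => sq_nonneg _) hi] at h2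
  filter_upwards [h2] with x hx
  exact pow_eq_zero_iff two_ne_zero |>.1 hx

theorem notAEZero_of_ne_zero (hE : E ≠ 0) (hε : ε ^ 2 = 1) (hβ : 0 < β) {v : ℝ × ℝ → ℝ}
    (hv : Continuous v) (h : v (t * (β / 2), β / 2) ≠ 0) :
    NotAEZero (interior (chartTriangle O E ε t β)) (v ∘ planeChartInv O E ε) := by
  have hci : Continuous (planeChartInv O E ε) := (contDiff_planeChartInv (n := 0)).continuous
  set x := planeChart O E ε (t * (β / 2), β / 2) with hx
  have hmem : x ∈ interior (chartTriangle O E ε t β) := by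
    have hopen : IsOpen {z : ℝ × ℝ | 0 < z.2 ∧ |z.1 - t * z.2| < Real.pi - Real.pi / β * z.2} :=
      (isOpen_lt continuous_const continuous_snd).inter
        (isOpen_lt (f := fun z : ℝ × ℝ => |z.1 - t * z.2|) (by fun_prop) (by fun_prop))
    refine interior_maximal ?_ (hopen.preimage hci) ?_
    · rintro y ⟨h1, h2⟩
      rw [← image_modelTriangle hβ]
      exact ⟨_, ⟨h1.le, h2.le⟩, planeChart_planeChartInv hE hε y⟩
    · rw [mem_preimage, hx, planeChartInv_planeChart hE hε]
      refine ⟨half_pos hβ, ?_⟩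
      simp only [sub_self, abs_zero]
      have : Real.pi / β * (β / 2) = Real.pi / 2 := by field_simp
      rw [this]
      linarith [Real.pi_pos]
  intro hae
  have heq := Measure.eqOn_open_of_ae_eq (f := v ∘ planeChartInv O E ε) (g := fun _ => 0)
    (μ := volume) hae isOpen_interior (hv.comp hci).continuousOn continuousOn_const hmem
  rw [Function.comp_apply, hx, planeChartInv_planeChart hE hε] at heq
  exact h heq

/-- The set of Rayleigh quotients of the admissible functions on a triangle. -/
def rayleighValues (Ω D : Set E2) : Set ℝ :=
  { r | ∃ u : E2 → ℝ, ContDiff ℝ (⊤ : ℕ∞) u ∧ (∀ x ∈ D, u x = 0) ∧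
    NotAEZero Ω u ∧ r = rayleigh Ω u }

theorem rayleighValues_bddBelow (Ω D : Set E2) : BddBelow (rayleighValues Ω D) := by
  refine ⟨0, ?_⟩
  rintro r ⟨u, -, -, -, rfl⟩
  exact div_nonneg (integral_nonneg fun x => sq_nonneg _) (integral_nonneg fun x => sq_nonneg _)

theorem rayleigh_mem_rayleighValues (hE : E ≠ 0) (hε : ε ^ 2 = 1) (hβ : 0 < β) {v : ℝ × ℝ → ℝ}
    (hv : ContDiff ℝ (⊤ : ℕ∞) v) (h0 : ∀ z ∈ modelSides t β, v z = 0)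
    (h : v (t * (β / 2), β / 2) ≠ 0) :
    rayleigh (interior (chartTriangle O E ε t β)) (v ∘ planeChartInv O E ε) ∈
      rayleighValues (interior (chartTriangle O E ε t β)) (chartSides O E ε t β) := by
  refine ⟨_, hv.comp contDiff_planeChartInv, ?_,
    notAEZero_of_ne_zero hE hε hβ hv.continuous h, rfl⟩
  rw [← image_modelSides hβ]
  rintro _ ⟨z, hz, rfl⟩
  rw [Function.comp_apply, planeChartInv_planeChart hE hε, h0 z hz]

theorem le_firstMixedEig_chartTriangle (hE : E ≠ 0) (hε : ε ^ 2 = 1) (hβ : 0 < β) {Λ : ℝ}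
    (hΛ : ∀ w, IsAdmissible w → SupportedInKite t β w →
      Λ * sqNorm w ≤ dirEnergy w (1, 0) + dirEnergy w (0, 1)) :
    Λ / ‖E‖ ^ 2 ≤
      firstMixedEig (interior (chartTriangle O E ε t β)) (chartSides O E ε t β) := by
  refine le_csInf (s := rayleighValues _ _) ⟨_, rayleigh_mem_rayleighValues hE hε hβ
    (v := fun z => (Real.pi - Real.pi / β * z.2) ^ 2 - (z.1 - t * z.2) ^ 2) (by fun_prop) ?_ ?_⟩ ?_
  · rintro z ⟨-, hz⟩
    rw [← hz, sq_abs, sub_self]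
  · have : Real.pi / β * (β / 2) = Real.pi / 2 := by field_simp
    simp only [this, sub_self]
    have := Real.pi_pos
    have : (Real.pi - Real.pi / 2) ^ 2 - 0 ^ 2 = Real.pi ^ 2 / 4 := by ring
    rw [this]
    positivity
  · rintro r ⟨u, hu, hu0, hne, rfl⟩
    have hN : 0 < ‖E‖ ^ 2 := by positivity
    have hpos := setIntegral_sq_pos_of_notAEZero hE hε hβ hu.continuous hne
    have hb := modelTriangle_energy_bound hβ hΛ (v := u ∘ planeChart O E ε)
      ((hu.of_le (by simp)).comp contDiff_planeChart) fun z hz => hu0 _ (by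
        rw [← image_modelSides hβ]
        exact mem_image_of_mem _ hz)
    rw [rayleigh_chartTriangle hE hε hβ hu, div_le_div_iff₀ hN (mul_pos hN hpos)]
    linarith [mul_le_mul_of_nonneg_left hb hN.le]

theorem firstMixedEig_chartTriangle_le (hE : E ≠ 0) (hε : ε ^ 2 = 1) :
    firstMixedEig (interior (chartTriangle O E ε 0 Real.pi)) (chartSides O E ε 0 Real.pi) ≤
      1 / ‖E‖ ^ 2 := by
  have hπ := Real.pi_pos
  set v : ℝ × ℝ → ℝ := fun z => Real.cos z.1 + Real.cos z.2 with hvdef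
  have hv : ContDiff ℝ (⊤ : ℕ∞) v := by
    rw [hvdef]
    fun_prop
  have hmem := rayleigh_mem_rayleighValues (O := O) hE hε hπ (t := 0) hv ?_ ?_
  · refine (csInf_le (rayleighValues_bddBelow _ _) hmem).trans_eq ?_
    have hcomp : (v ∘ planeChartInv O E ε) ∘ planeChart O E ε = v := by
      funext z
      simp only [Function.comp_apply, planeChartInv_planeChart hE hε]
    have hd := hv.differentiable (by simp)
    have h1 : ∀ z, fderiv ℝ v z (1, 0) = -Real.sin z.1 := fun z => by
      rw [← (hd z).lineDeriv_eq_fderiv]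
      exact lineDeriv_fst ((Real.hasDerivAt_cos z.1).add_const (Real.cos z.2)) fun s => rfl
    have h2 : ∀ z, fderiv ℝ v z (0, 1) = -Real.sin z.2 := fun z => by
      rw [← (hd z).lineDeriv_eq_fderiv]
      exact lineDeriv_snd ((Real.hasDerivAt_cos z.2).const_add (Real.cos z.1)) fun s => rfl
    rw [rayleigh_chartTriangle hE hε hπ (hv.comp contDiff_planeChartInv), hcomp]
    simp only [h1, h2, neg_sq, setIntegral_sin_sq_add_sin_sq]
    rw [hvdef, setIntegral_cos_add_cos_sq]
    have hN : ‖E‖ ^ 2 ≠ 0 := by positivity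
    field_simp
  · rintro z ⟨-, hz⟩
    rw [zero_mul, sub_zero, div_self hπ.ne', one_mul] at hz
    rw [hvdef]
    simp only
    rw [← Real.cos_abs z.1, hz, Real.cos_pi_sub, neg_add_cancel]
  · simp [hvdef]

end TriangleTransfer

section ChartMetric

variable {O E : E2} {ε t β : ℝ}

theorem inner_chartLinear (hε : ε ^ 2 = 1) (y z : ℝ × ℝ) :
    inner ℝ (chartLinear E ε y) (chartLinear E ε z) = ‖E‖ ^ 2 * (y.1 * z.1 + y.2 * z.2) := by
  rw [norm_sq_eq_coord]
  simp [chartLinear, PiLp.inner_apply, Fin.sum_univ_two]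
  linear_combination (y.2 * z.2 * (E 0 ^ 2 + E 1 ^ 2)) * hε

theorem planeChart_sub (y z : ℝ × ℝ) :
    planeChart O E ε y - planeChart O E ε z = chartLinear E ε (y - z) := by
  simp [planeChart]

theorem dist_planeChart_le_iff (hE : E ≠ 0) (hε : ε ^ 2 = 1) (a b c d : ℝ × ℝ) :
    dist (planeChart O E ε a) (planeChart O E ε b) ≤
        dist (planeChart O E ε c) (planeChart O E ε d) ↔
      (a.1 - b.1) ^ 2 + (a.2 - b.2) ^ 2 ≤ (c.1 - d.1) ^ 2 + (c.2 - d.2) ^ 2 := by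
  have hN : 0 < ‖E‖ ^ 2 := by positivity
  rw [← sq_le_sq₀ dist_nonneg dist_nonneg, dist_eq_norm, dist_eq_norm, planeChart_sub,
    planeChart_sub, ← real_inner_self_eq_norm_sq, ← real_inner_self_eq_norm_sq,
    inner_chartLinear hε, inner_chartLinear hε, mul_le_mul_iff_right₀ hN]
  simp [sq]

theorem chart_angle_and_dist_iff (hE : E ≠ 0) (hε : ε ^ 2 = 1) (hβ : 0 < β) :
    (∠ (planeChart O E ε (-Real.pi, 0)) (planeChart O E ε (t * β, β))
        (planeChart O E ε (Real.pi, 0)) = Real.pi / 2 ∧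
      dist (planeChart O E ε (t * β, β)) (planeChart O E ε (-Real.pi, 0)) =
        dist (planeChart O E ε (t * β, β)) (planeChart O E ε (Real.pi, 0))) ↔
      t = 0 ∧ β = Real.pi := by
  have hπ := Real.pi_pos
  have hN : ‖E‖ ^ 2 ≠ 0 := by positivity
  rw [EuclideanGeometry.angle, ← InnerProductGeometry.inner_eq_zero_iff_angle_eq_pi_div_two,
    vsub_eq_sub, vsub_eq_sub, planeChart_sub, planeChart_sub, inner_chartLinear hε,
    mul_eq_zero_iff_left hN, le_antisymm_iff (a := dist _ _), dist_planeChart_le_iff hE hε,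
    dist_planeChart_le_iff hE hε, ← le_antisymm_iff]
  simp only [Prod.fst_sub, Prod.snd_sub]
  constructor
  · rintro ⟨h1, h2⟩
    have h3 : t = 0 := by
      have : t * (4 * (β * Real.pi)) = 0 := by linarith
      exact (mul_eq_zero.1 this).resolve_right (by positivity)
    subst h3
    refine ⟨rfl, ?_⟩
    rw [← sq_eq_sq₀ hβ.le hπ.le]
    linarith
  · rintro ⟨rfl, rfl⟩
    constructor <;> ring

theorem abs_slope_lt_one_of_dist_le (hE : E ≠ 0) (hε : ε ^ 2 = 1) (hβ : 0 < β)
    (h₁ : dist (planeChart O E ε (t * β, β)) (planeChart O E ε (Real.pi, 0)) ≤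
      dist (planeChart O E ε (-Real.pi, 0)) (planeChart O E ε (Real.pi, 0)))
    (h₂ : dist (planeChart O E ε (t * β, β)) (planeChart O E ε (-Real.pi, 0)) ≤
      dist (planeChart O E ε (t * β, β)) (planeChart O E ε (Real.pi, 0))) :
    |t * β| < Real.pi := by
  have hπ := Real.pi_pos
  rw [dist_planeChart_le_iff hE hε] at h₁ h₂
  simp only [sub_zero, zero_pow two_ne_zero, add_zero] at h₁ h₂
  have h3 : t * β ≤ 0 := by
    by_contra! h
    have := mul_pos h hπ
    linarith
  rw [abs_lt]
  refine ⟨?_, by linarith⟩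
  by_contra! h
  nlinarith [pow_pos hβ 2]

theorem exists_planeChart {A B C : E2} (h : ¬ Collinear ℝ ({A, B, C} : Set E2)) :
    ∃ (O E : E2) (ε t β : ℝ), E ≠ 0 ∧ ε ^ 2 = 1 ∧ 0 < β ∧
      A = planeChart O E ε (t * β, β) ∧ B = planeChart O E ε (-Real.pi, 0) ∧
      C = planeChart O E ε (Real.pi, 0) := by
  have hπ := Real.pi_pos
  set O : E2 := (2⁻¹ : ℝ) • (B + C) with hO
  set E : E2 := (2 * Real.pi)⁻¹ • (C - B) with hE
  have hlin : ∀ (ε x : ℝ), chartLinear E ε (x, 0) = x • E := fun ε x => by simp [chartLinear]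
  have hB : ∀ ε, B = planeChart O E ε (-Real.pi, 0) := fun ε => by
    have : Real.pi * (2 * Real.pi)⁻¹ = 2⁻¹ := by field_simp
    rw [planeChart, hlin, hO, hE, smul_smul, neg_mul, this]
    module
  have hC : ∀ ε, C = planeChart O E ε (Real.pi, 0) := fun ε => by
    have : Real.pi * (2 * Real.pi)⁻¹ = 2⁻¹ := by field_simp
    rw [planeChart, hlin, hO, hE, smul_smul, this]
    module
  have hE0 : E ≠ 0 := by
    intro h0
    rw [hE, smul_eq_zero_iff_right (by positivity), sub_eq_zero] at h0
    rw [h0, pair_eq_singleton] at h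
    exact h (collinear_pair ℝ A B)
  obtain ⟨p, q, hpq⟩ : ∃ p q, planeChartInv O E 1 A = (p, q) := ⟨_, _, rfl⟩
  have hA : A = planeChart O E 1 (p, q) := by
    rw [← hpq, planeChart_planeChartInv hE0 (one_pow 2)]
  have hq : q ≠ 0 := by
    rintro rfl
    refine h ((collinear_iff_exists_forall_eq_smul_vadd _).2 ⟨O, E, ?_⟩)
    have hline : ∀ x, planeChart O E 1 (x, 0) = x • E +ᵥ O := fun x => by
      rw [planeChart, hlin, vadd_eq_add, add_comm]
    rintro x (rfl | rfl | rfl)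
    · exact ⟨p, hA.trans (hline p)⟩
    · exact ⟨-Real.pi, (hB 1).trans (hline _)⟩
    · exact ⟨Real.pi, (hC 1).trans (hline _)⟩
  have hflip : planeChart O E (-1) (p, -q) = planeChart O E 1 (p, q) := by
    ext i
    fin_cases i <;> simp
  rcases lt_or_gt_of_ne hq with hq' | hq'
  · refine ⟨O, E, -1, p / (-q), -q, hE0, by norm_num, by linarith, ?_, hB _, hC _⟩
    rw [div_mul_cancel₀ _ (neg_ne_zero.2 hq), hflip, hA]
  · refine ⟨O, E, 1, p / q, q, hE0, one_pow 2, hq', ?_, hB _, hC _⟩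
    rw [div_mul_cancel₀ _ hq, hA]

end ChartMetric

/-- For every nondegenerate triangle `T = △ABC` with sides labelled so that
`|AB| ≤ |AC| ≤ |BC|` (thus `L = BC`, `M = AC`, `S = AB`), one has
`λ₁^{MS}(T) ≥ π²/|T|`, with equality iff `T` is an isosceles right triangle
(right angle at `A`, legs `AB = AC`). -/
theorem stmt_1 (A B C : E2)
    (hT : ¬ Collinear ℝ ({A, B, C} : Set E2))
    (hLM : dist A C ≤ dist B C) (hMS : dist A B ≤ dist A C) :
    firstMixedEig (triangleO A B C) (segment ℝ A C ∪ segment ℝ A B) ≥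
      Real.pi ^ 2 / area2 (convexHull ℝ ({A, B, C} : Set E2)) ∧
    (firstMixedEig (triangleO A B C) (segment ℝ A C ∪ segment ℝ A B) =
        Real.pi ^ 2 / area2 (convexHull ℝ ({A, B, C} : Set E2)) ↔
      ∠ B A C = Real.pi / 2 ∧ dist A B = dist A C) := by
  obtain ⟨O, E, ε, t, β, hE, hε, hβ, rfl, rfl, rfl⟩ := exists_planeChart hT
  have hπ := Real.pi_pos
  have hN : 0 < ‖E‖ ^ 2 := by positivity
  have hslope := abs_slope_lt_one_of_dist_le hE hε hβ hLM hMS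
  rw [chart_angle_and_dist_iff hE hε hβ]
  change firstMixedEig (interior (chartTriangle O E ε t β)) (chartSides O E ε t β) ≥
      Real.pi ^ 2 / area2 (chartTriangle O E ε t β) ∧
    (firstMixedEig (interior (chartTriangle O E ε t β)) (chartSides O E ε t β) =
      Real.pi ^ 2 / area2 (chartTriangle O E ε t β) ↔ _)
  have harea : Real.pi ^ 2 / area2 (chartTriangle O E ε t β) = Real.pi / β / ‖E‖ ^ 2 := by
    rw [area2_chartTriangle hE hε hβ]
    field_simp
  rw [harea]
  have hle := le_firstMixedEig_chartTriangle (O := O) hE hε hβ (t := t)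
    fun w => kite_rayleigh_bound hβ
  refine ⟨hle, fun heq => ?_, ?_⟩
  · by_contra hne
    obtain ⟨Λ, hΛ, hw⟩ := exists_kite_energy_gap hβ hne fun hβπ => by
      rw [hβπ, abs_mul, abs_of_pos hπ] at hslope
      exact (mul_lt_iff_lt_one_left hπ).1 hslope
    have := le_firstMixedEig_chartTriangle (O := O) hE hε hβ hw
    rw [heq] at this
    exact absurd this (not_le.2 (div_lt_div_of_pos_right hΛ hN))
  · rintro ⟨rfl, rfl⟩
    refine le_antisymm ?_ hle
    rw [div_self hπ.ne']
    exact firstMixedEig_chartTriangle_le hE hε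

end
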